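/- For every admissible Strichartz pair (n,p) there is a constant C > 0 such that for every real N ≥ 1 and every finitely supported a : ℤⁿ → ℂ with supp a ⊆ {ξ ∈ ℤⁿ : |ξ| ≤ N}, the free Schrödinger wave satisfies ‖u_a‖_{L^p([0,2π]×[0,2π]ⁿ)} ≤ C · N^{n/2 − (n+2)/p} · ‖a‖_{ℓ²}. -/

import Mathlib

open MeasureTheory Real Finset

noncomputable section

/-- The free Schrödinger wave `u_a(t,x) = Σ_ξ a(ξ) e^{i(x·ξ − t|ξ|²)}` on the torus. -/
def tWave (n : ℕ) (a : (Fin n → ℤ) →₀ ℂ) (t : ℝ) (x : Fin n → ℝ) : ℂ :=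
  ∑ ξ ∈ a.support, a ξ *
    Complex.exp (Complex.I *
      (((∑ i, x i * (ξ i : ℝ)) - t * ∑ i, ((ξ i : ℝ)) ^ 2 : ℝ) : ℂ))

/-- The ℓ² norm of the Fourier coefficients. -/
def l2Norm (n : ℕ) (a : (Fin n → ℤ) →₀ ℂ) : ℝ :=
  Real.sqrt (∑ ξ ∈ a.support, ‖a ξ‖ ^ 2)

/-- Euclidean norm of a lattice point in `ℤⁿ`. -/
def znorm (n : ℕ) (ξ : Fin n → ℤ) : ℝ :=
  Real.sqrt (∑ i, ((ξ i : ℝ)) ^ 2)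

/-- The period box `[0,2π] × [0,2π]ⁿ`. -/
def stBox (n : ℕ) : Set (ℝ × (Fin n → ℝ)) :=
  Set.Icc 0 (2 * π) ×ˢ Set.univ.pi fun _ => Set.Icc 0 (2 * π)

/-- The `L^p` norm over the period box `[0,2π] × [0,2π]ⁿ`. -/
def boxLpNorm (n : ℕ) (p : ℝ) (f : ℝ → (Fin n → ℝ) → ℂ) : ℝ :=
  (∫ q in stBox n, ‖f q.1 q.2‖ ^ p) ^ (1 / p)

end

/-- `(n,p)` is an admissible Strichartz pair. -/
def AdmissibleStrichartz (n : ℕ) (p : ℝ) : Prop :=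
  (n = 1 ∧ 6 < p) ∨ ((n = 2 ∨ n = 3) ∧ 4 < p) ∨ (4 ≤ n ∧ 2 * ((n : ℝ) + 4) / n ≤ p)

/-- The unimodular phase `e^{iθ}`. -/
noncomputable def cis (θ : ℝ) : ℂ := Complex.exp (Complex.I * (θ : ℂ))

lemma norm_cis (θ : ℝ) : ‖cis θ‖ = 1 := by
  rw [cis, mul_comm]; exact Complex.norm_exp_ofReal_mul_I θ

lemma cis_add (a b : ℝ) : cis (a + b) = cis a * cis b := by
  simp only [cis, ← Complex.exp_add]; push_cast; ring_nf

lemma cis_zero : cis 0 = 1 := by simp [cis]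

lemma conj_cis (a : ℝ) : (starRingEnd ℂ) (cis a) = cis (-a) := by
  simp [cis, ← Complex.exp_conj]

lemma cis_neg_mul_cis (a : ℝ) : cis (-a) * cis a = 1 := by
  rw [← cis_add]; simp [cis_zero]

@[fun_prop] lemma continuous_cis : Continuous cis := by unfold cis; fun_prop

@[fun_prop] lemma measurable_cis : Measurable cis := continuous_cis.measurable

lemma cis_sum {ι : Type*} (s : Finset ι) (f : ι → ℝ) : cis (∑ i ∈ s, f i) = ∏ i ∈ s, cis (f i) := by
  simp only [cis, ← Complex.exp_sum]; push_cast; rw [Finset.mul_sum]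

lemma cis_nat_mul (n : ℕ) (θ : ℝ) : cis (n * θ) = cis θ ^ n := by
  simp only [cis, ← Complex.exp_nat_mul]; push_cast; ring_nf

lemma cis_two_pi_int (k : ℤ) : cis (2 * π * k) = 1 := by
  rw [cis, Complex.exp_eq_one_iff]; exact ⟨k, by push_cast; ring⟩

lemma integral_cis_int (k : ℤ) :
    ∫ t in Set.Icc 0 (2 * π), cis (t * k) = if k = 0 then (2 * π : ℂ) else 0 := by
  rw [integral_Icc_eq_integral_Ioc, ← intervalIntegral.integral_of_le (by positivity)]
  split_ifs with h
  · subst h; simp [cis_zero]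
  · have hc : (Complex.I * k : ℂ) ≠ 0 := by simp [h]
    have := integral_exp_mul_complex (a := 0) (b := 2 * π) hc
    have e : (fun t : ℝ => cis (t * k)) = fun t : ℝ => Complex.exp (Complex.I * k * t) := by
      ext t; simp only [cis]; push_cast; ring_nf
    rw [e, this]
    have h2 := cis_two_pi_int k
    simp only [cis] at h2
    have : Complex.exp (Complex.I * k * ((2 * π : ℝ) : ℂ)) = 1 := by
      rw [← h2]; push_cast; ring_nf
    rw [this]; simp

/-- Lebesgue measure on the time period. -/
noncomputable abbrev timeMeas : Measure ℝ := volume.restrict (Set.Icc 0 (2 * π))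

/-- Lebesgue measure on the spatial period box. -/
noncomputable abbrev spaceMeas (n : ℕ) : Measure (Fin n → ℝ) :=
  volume.restrict (Set.univ.pi fun _ => Set.Icc 0 (2 * π))

lemma spaceMeas_eq (n : ℕ) : spaceMeas n = Measure.pi fun _ => timeMeas := by
  rw [spaceMeas, volume_pi, Measure.restrict_pi_pi]

instance : IsFiniteMeasure timeMeas := by
  refine ⟨?_⟩; simp [ENNReal.mul_lt_top]

instance (n : ℕ) : IsFiniteMeasure (spaceMeas n) := by
  rw [spaceMeas_eq]; infer_instance

lemma restrict_stBox (n : ℕ) : volume.restrict (stBox n) = timeMeas.prod (spaceMeas n) := by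
  rw [stBox, Measure.volume_eq_prod, Measure.prod_restrict]

/-- The spatial character `e^{i x·ξ}`. -/
noncomputable def spaceChar {n : ℕ} (ξ : Fin n → ℤ) (x : Fin n → ℝ) : ℂ :=
  cis (∑ i, x i * (ξ i : ℝ))

/-- The space-time character `e^{i (x·ξ - t k)}`. -/
noncomputable def stChar {n : ℕ} (v : ℤ × (Fin n → ℤ)) (q : ℝ × (Fin n → ℝ)) : ℂ :=
  cis ((∑ i, q.2 i * (v.2 i : ℝ)) - q.1 * v.1)

/-- `|ξ|²` for a lattice point. -/
def sqNorm {n : ℕ} (ξ : Fin n → ℤ) : ℤ := ∑ i, ξ i ^ 2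

lemma tWave_eq (n : ℕ) (a : (Fin n → ℤ) →₀ ℂ) (t : ℝ) (x : Fin n → ℝ) :
    tWave n a t x = ∑ ξ ∈ a.support, a ξ * stChar (sqNorm ξ, ξ) (t, x) := by
  simp [tWave, stChar, sqNorm, cis]

lemma integral_spaceChar {n : ℕ} (ξ : Fin n → ℤ) :
    ∫ x, spaceChar ξ x ∂(spaceMeas n) = if ξ = 0 then (((2 * π) ^ n : ℝ) : ℂ) else 0 := by
  rw [spaceMeas_eq]
  have : ∀ x : Fin n → ℝ, spaceChar ξ x = ∏ i, (fun (i : Fin n) (y : ℝ) => cis (y * ξ i)) i (x i) := by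
    intro x; simp [spaceChar, cis_sum]
  rw [integral_congr_ae (Filter.Eventually.of_forall this),
    integral_fintype_prod_eq_prod (fun (i : Fin n) (y : ℝ) => cis (y * ξ i))]
  simp_rw [integral_cis_int]
  split_ifs with h
  · subst h; simp
  · obtain ⟨i, hi⟩ := Function.ne_iff.1 h
    exact Finset.prod_eq_zero (Finset.mem_univ i) (by simpa using hi)

/-- A uniformly bounded orthogonal family, each member having squared norm `c`. -/
structure IsOrthoFamily {X ι : Type*} [MeasurableSpace X] (μ : Measure X) (c : ℝ)
    (e : ι → X → ℂ) : Prop where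
  meas : ∀ i, Measurable (e i)
  norm_eq : ∀ i x, ‖e i x‖ = 1
  self : ∀ i, ∫ x, e i x * (starRingEnd ℂ) (e i x) ∂μ = c
  orth : ∀ i j, i ≠ j → ∫ x, e i x * (starRingEnd ℂ) (e j x) ∂μ = 0

lemma spaceChar_mul_conj {n : ℕ} (ξ η : Fin n → ℤ) (x : Fin n → ℝ) :
    spaceChar ξ x * (starRingEnd ℂ) (spaceChar η x) = spaceChar (ξ - η) x := by
  rw [spaceChar, spaceChar, conj_cis, ← cis_add, spaceChar]
  congr 1
  rw [← Finset.sum_neg_distrib, ← Finset.sum_add_distrib]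
  exact Finset.sum_congr rfl fun i _ => by simp; ring

lemma isOrthoFamily_spaceChar (n : ℕ) :
    IsOrthoFamily (spaceMeas n) ((2 * π) ^ n) (spaceChar (n := n)) where
  meas i := by unfold spaceChar; fun_prop
  norm_eq i x := norm_cis _
  self i := by simp_rw [spaceChar_mul_conj, integral_spaceChar]; simp
  orth i j h := by simp_rw [spaceChar_mul_conj, integral_spaceChar, if_neg (sub_ne_zero.2 h)]

lemma isOrthoFamily_time :
    IsOrthoFamily timeMeas (2 * π) (fun (k : ℤ) (t : ℝ) => cis (t * k)) where
  meas i := by fun_prop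
  norm_eq i x := norm_cis _
  self i := by
    have : ∀ t : ℝ, cis (t * i) * (starRingEnd ℂ) (cis (t * i)) = 1 := fun t => by
      rw [conj_cis, mul_comm, cis_neg_mul_cis]
    simp_rw [this]; simp [pi_nonneg]
  orth i j h := by
    have : ∀ t : ℝ, cis (t * i) * (starRingEnd ℂ) (cis (t * j)) = cis (t * (i - j : ℤ)) := by
      intro t; rw [conj_cis, ← cis_add]; push_cast; ring_nf
    simp_rw [this, integral_cis_int, if_neg (sub_ne_zero.2 h)]

lemma isOrthoFamily_stChar (n : ℕ) :
    IsOrthoFamily (timeMeas.prod (spaceMeas n)) ((2 * π) ^ (n + 1)) (stChar (n := n)) := by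
  have key : ∀ (v w : ℤ × (Fin n → ℤ)) (q : ℝ × (Fin n → ℝ)),
      stChar v q * (starRingEnd ℂ) (stChar w q)
        = cis (q.1 * (w.1 - v.1 : ℤ)) * spaceChar (v.2 - w.2) q.2 := by
    intro v w q
    rw [← spaceChar_mul_conj]
    simp only [stChar, spaceChar, conj_cis, ← cis_add]
    congr 1; push_cast; ring
  refine ⟨fun i => by unfold stChar; fun_prop, fun i x => norm_cis _, fun i => ?_, fun i j h => ?_⟩
  · simp_rw [key]
    rw [integral_prod_mul (fun t : ℝ => cis (t * _)) (spaceChar _), integral_cis_int, integral_spaceChar]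
    simp [pow_succ, mul_comm]
  · simp_rw [key]
    rw [integral_prod_mul (fun t : ℝ => cis (t * _)) (spaceChar _), integral_cis_int, integral_spaceChar]
    by_cases h1 : i.1 = j.1
    · have h2 : i.2 ≠ j.2 := fun h2 => h (Prod.ext h1 h2)
      rw [if_neg (sub_ne_zero.2 h2), mul_zero]
    · rw [if_neg (sub_ne_zero.2 (Ne.symm h1)), zero_mul]

section
variable {X ι : Type*} [MeasurableSpace X] {μ : Measure X} {c : ℝ}
  {e : ι → X → ℂ}

lemma integrable_of_bound [IsFiniteMeasure μ] {f : X → ℂ} (hf : Measurable f) (A : ℝ) (hA : ∀ x, ‖f x‖ ≤ A) :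
    Integrable f μ :=
  Integrable.of_bound hf.aestronglyMeasurable A (Filter.Eventually.of_forall hA)

lemma IsOrthoFamily.measurable_sum (he : IsOrthoFamily μ c e) (s : Finset ι) (a : ι → ℂ) :
    Measurable fun x => ∑ i ∈ s, a i * e i x :=
  Finset.measurable_sum _ fun i _ => (he.meas i).const_mul _

lemma IsOrthoFamily.norm_sum_mul_le (he : IsOrthoFamily μ c e) (s : Finset ι) (a : ι → ℂ) (x : X) :
    ‖∑ i ∈ s, a i * e i x‖ ≤ ∑ i ∈ s, ‖a i‖ :=
  (norm_sum_le s _).trans (Finset.sum_le_sum fun i _ => by simp [he.norm_eq])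

lemma IsOrthoFamily.integral_mul_conj_sum [IsFiniteMeasure μ] (he : IsOrthoFamily μ c e)
    (s : Finset ι) (a : ι → ℂ)
    {f : X → ℂ} (hf : Measurable f) (A : ℝ) (hA : ∀ x, ‖f x‖ ≤ A) :
    ∫ x, f x * (starRingEnd ℂ) (∑ i ∈ s, a i * e i x) ∂μ
      = ∑ i ∈ s, (starRingEnd ℂ) (a i) * ∫ x, f x * (starRingEnd ℂ) (e i x) ∂μ := by
  simp_rw [map_sum, map_mul, Finset.mul_sum]
  rw [integral_finsetSum]
  · refine Finset.sum_congr rfl fun i _ => ?_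
    rw [← integral_const_mul]; congr 1; ext x; ring
  · intro i _
    have hm := he.meas i
    refine integrable_of_bound (A := A * ‖a i‖) (by fun_prop) fun x => ?_
    simp only [norm_mul, RCLike.norm_conj, he.norm_eq, mul_one]
    exact mul_le_mul_of_nonneg_right (hA x) (norm_nonneg _)

lemma IsOrthoFamily.parseval [IsFiniteMeasure μ] (he : IsOrthoFamily μ c e) (s : Finset ι) (a : ι → ℂ) :
    ∫ x, ‖∑ i ∈ s, a i * e i x‖ ^ 2 ∂μ = c * ∑ i ∈ s, ‖a i‖ ^ 2 := by
  classical
  have h1 := he.integral_mul_conj_sum s a (he.measurable_sum s a) _ (he.norm_sum_mul_le s a)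
  have h2 : ∀ i ∈ s, ∫ x, (∑ j ∈ s, a j * e j x) * (starRingEnd ℂ) (e i x) ∂μ = c * a i := by
    intro i hi
    simp_rw [Finset.sum_mul, mul_assoc]
    rw [integral_finsetSum]
    · simp_rw [integral_const_mul]
      rw [Finset.sum_eq_single i]
      · rw [he.self, mul_comm]
      · intro j _ hj; rw [he.orth j i hj, mul_zero]
      · exact fun h => absurd hi h
    · intro j _
      have hm := he.meas i
      have hm' := he.meas j
      exact integrable_of_bound (A := ‖a j‖) (by fun_prop) fun x => by simp [he.norm_eq]
  rw [Finset.sum_congr rfl fun i hi => by rw [h2 i hi]] at h1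
  have h3 : ∀ z : ℂ, z * (starRingEnd ℂ) z = ((‖z‖ ^ 2 : ℝ) : ℂ) := by
    intro z; rw [Complex.mul_conj, Complex.normSq_eq_norm_sq]
  simp_rw [h3] at h1
  rw [integral_complex_ofReal] at h1
  have h4 : ∑ i ∈ s, (starRingEnd ℂ) (a i) * (c * a i) = ((c * ∑ i ∈ s, ‖a i‖ ^ 2 : ℝ) : ℂ) := by
    push_cast
    rw [Finset.mul_sum]
    refine Finset.sum_congr rfl fun i _ => ?_
    have := h3 (a i)
    push_cast at this
    rw [← this]; ring
  rw [h4] at h1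
  exact_mod_cast h1

lemma IsOrthoFamily.integral_sq_le_of_fiber [IsFiniteMeasure μ] (he : IsOrthoFamily μ c e)
    (hc : 0 ≤ c) {κ : Type*}
    (s : Finset κ) (b : κ → ℂ) (φ : κ → ι) (K : ℝ)
    (hK : ∀ i, ∀ t ⊆ s, (∀ k ∈ t, φ k = i) → (t.card : ℝ) ≤ K) :
    ∫ x, ‖∑ k ∈ s, b k * e (φ k) x‖ ^ 2 ∂μ ≤ c * (K * ∑ k ∈ s, ‖b k‖ ^ 2) := by
  classical
  have h1 : ∀ x, ∑ k ∈ s, b k * e (φ k) x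
      = ∑ i ∈ s.image φ, (∑ k ∈ s with φ k = i, b k) * e i x := by
    intro x
    rw [← Finset.sum_fiberwise_of_maps_to (g := φ) (t := s.image φ)
      (fun k hk => Finset.mem_image_of_mem _ hk)]
    refine Finset.sum_congr rfl fun i _ => ?_
    rw [Finset.sum_mul]
    exact Finset.sum_congr rfl fun k hk => by rw [(Finset.mem_filter.1 hk).2]
  simp_rw [h1]
  rw [he.parseval]
  refine mul_le_mul_of_nonneg_left ?_ hc
  rw [← Finset.sum_fiberwise_of_maps_to (g := φ) (t := s.image φ)
      (fun k hk => Finset.mem_image_of_mem _ hk) (f := fun k => ‖b k‖ ^ 2), Finset.mul_sum]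
  refine Finset.sum_le_sum fun i _ => ?_
  calc ‖∑ k ∈ s with φ k = i, b k‖ ^ 2 ≤ (∑ k ∈ s with φ k = i, ‖b k‖) ^ 2 := by
        gcongr; exact norm_sum_le _ _
    _ ≤ (s.filter (fun k => φ k = i)).card * ∑ k ∈ s with φ k = i, ‖b k‖ ^ 2 :=
        sq_sum_le_card_mul_sum_sq
    _ ≤ _ := by
        refine mul_le_mul_of_nonneg_right ?_ (Finset.sum_nonneg fun _ _ => by positivity)
        exact hK i _ (Finset.filter_subset _ _) fun k hk => (Finset.mem_filter.1 hk).2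

lemma IsOrthoFamily.bessel [IsFiniteMeasure μ] (he : IsOrthoFamily μ c e) (hc : 0 < c) (s : Finset ι)
    {f : X → ℂ} (hf : Measurable f) (A : ℝ) (hA : ∀ x, ‖f x‖ ≤ A) :
    ∑ i ∈ s, ‖∫ x, f x * (starRingEnd ℂ) (e i x) ∂μ‖ ^ 2 ≤ c * ∫ x, ‖f x‖ ^ 2 ∂μ := by
  set b : ι → ℂ := fun i => ∫ x, f x * (starRingEnd ℂ) (e i x) ∂μ with hb
  set g : X → ℂ := fun x => ∑ i ∈ s, b i * e i x with hg
  have hgm : Measurable g := he.measurable_sum s b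
  have hgb : ∀ x, ‖g x‖ ≤ ∑ i ∈ s, ‖b i‖ := he.norm_sum_mul_le s b
  have h1 := he.integral_mul_conj_sum s b hf A hA
  have h2 : ∫ x, ‖g x‖ ^ 2 ∂μ = c * ∑ i ∈ s, ‖b i‖ ^ 2 := he.parseval s b
  have h3 : ∑ i ∈ s, (starRingEnd ℂ) (b i) * b i = ((∑ i ∈ s, ‖b i‖ ^ 2 : ℝ) : ℂ) := by
    push_cast
    refine Finset.sum_congr rfl fun i _ => ?_
    rw [mul_comm, Complex.mul_conj, Complex.normSq_eq_norm_sq]; push_cast; rfl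
  have h4 : ∫ x, (f x * (starRingEnd ℂ) (g x)).re ∂μ = ∑ i ∈ s, ‖b i‖ ^ 2 := by
    have hi : Integrable (fun x => f x * (starRingEnd ℂ) (g x)) μ := by
      refine integrable_of_bound (A := A * ∑ i ∈ s, ‖b i‖) (by fun_prop) fun x => ?_
      rw [norm_mul, RCLike.norm_conj]
      exact mul_le_mul (hA x) (hgb x) (norm_nonneg _) ((norm_nonneg _).trans (hA x))
    have := integral_re hi
    simp only [RCLike.re_to_complex] at this
    rw [this, h1, h3, Complex.ofReal_re]
  have hif : Integrable (fun x => ‖f x‖ ^ 2) μ := by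
    refine Integrable.of_bound (by fun_prop) (A ^ 2) (Filter.Eventually.of_forall fun x => ?_)
    rw [Real.norm_of_nonneg (by positivity)]
    exact pow_le_pow_left₀ (norm_nonneg _) (hA x) 2
  have hig : Integrable (fun x => ‖g x‖ ^ 2) μ := by
    refine Integrable.of_bound (by fun_prop) ((∑ i ∈ s, ‖b i‖) ^ 2)
      (Filter.Eventually.of_forall fun x => ?_)
    rw [Real.norm_of_nonneg (by positivity)]
    exact pow_le_pow_left₀ (norm_nonneg _) (hgb x) 2
  have hifg : Integrable (fun x => (f x * (starRingEnd ℂ) (g x)).re) μ := by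
    refine Integrable.re (𝕜 := ℂ) (μ := μ) (f := fun x => f x * (starRingEnd ℂ) (g x)) ?_
    refine integrable_of_bound (A := A * ∑ i ∈ s, ‖b i‖) (by fun_prop) fun x => ?_
    rw [norm_mul, RCLike.norm_conj]
    exact mul_le_mul (hA x) (hgb x) (norm_nonneg _) ((norm_nonneg _).trans (hA x))
  have h5 : ∀ x, 2 * c * (f x * (starRingEnd ℂ) (g x)).re ≤ c ^ 2 * ‖f x‖ ^ 2 + ‖g x‖ ^ 2 := by
    intro x
    have hre : (f x * (starRingEnd ℂ) (g x)).re ≤ ‖f x‖ * ‖g x‖ := by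
      refine (Complex.re_le_norm _).trans ?_
      rw [norm_mul, RCLike.norm_conj]
    nlinarith [sq_nonneg (c * ‖f x‖ - ‖g x‖), mul_le_mul_of_nonneg_left hre hc.le]
  have h6 := integral_mono (hifg.const_mul (2 * c)) ((hif.const_mul (c ^ 2)).add hig) h5
  simp only [Pi.add_apply] at h6
  rw [integral_const_mul, integral_add (hif.const_mul _) hig, integral_const_mul, h4, h2] at h6
  have : c * ∑ i ∈ s, ‖b i‖ ^ 2 ≤ c * (c * ∫ x, ‖f x‖ ^ 2 ∂μ) := by nlinarith
  exact le_of_mul_le_mul_left this hc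

end

lemma succ_le_mul_rpow {ε : ℝ} (hε : 0 < ε) {p : ℕ} (hp : 2 ≤ p) (e : ℕ) :
    ((e : ℝ) + 1) ≤ (if (p : ℝ) ^ ε < 2 then 1 + 1 / (ε * log 2) else 1) * ((p : ℝ) ^ e) ^ ε := by
  have hp0 : (0 : ℝ) ≤ p := by positivity
  have hl : 0 < log 2 := log_pos (by norm_num)
  rw [← Real.rpow_natCast, ← Real.rpow_mul hp0, mul_comm (e : ℝ), Real.rpow_mul hp0,
    Real.rpow_natCast]
  split_ifs with h
  · have h1 : 1 + ε * log 2 ≤ (p : ℝ) ^ ε := by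
      calc 1 + ε * log 2 ≤ exp (ε * log 2) := by linarith [add_one_le_exp (ε * log 2)]
        _ = (2 : ℝ) ^ ε := by rw [Real.rpow_def_of_pos (by norm_num)]; ring_nf
        _ ≤ _ := by gcongr; exact_mod_cast hp
    have h2 : 1 + (e : ℝ) * (ε * log 2) ≤ ((p : ℝ) ^ ε) ^ e :=
      (one_add_mul_le_pow (by nlinarith [mul_pos hε hl]) e).trans (by gcongr)
    have h3 : (e : ℝ) + 1 ≤ (1 + 1 / (ε * log 2)) * (1 + (e : ℝ) * (ε * log 2)) := by
      have hx : 0 < ε * log 2 := by positivity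
      have : (1 + 1 / (ε * log 2)) * (1 + (e : ℝ) * (ε * log 2))
        = 1 + e + (e : ℝ) * (ε * log 2) + 1 / (ε * log 2) := by field_simp; ring
      rw [this]
      have : 0 ≤ (e : ℝ) * (ε * log 2) := by positivity
      have : 0 ≤ 1 / (ε * log 2) := by positivity
      linarith
    exact h3.trans (by gcongr)
  · push Not at h
    have h2 : (1 : ℝ) + e * 1 ≤ (1 + 1) ^ e := one_add_mul_le_pow (by norm_num) e
    rw [mul_one, one_add_one_eq_two] at h2
    calc (e : ℝ) + 1 ≤ 2 ^ e := by linarith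
      _ ≤ _ := by rw [one_mul]; gcongr

/-- The divisor bound `d(m) = O(m^ε)`. -/
lemma exists_card_divisors_le {ε : ℝ} (hε : 0 < ε) :
    ∃ C : ℝ, 1 ≤ C ∧ ∀ m : ℕ, m ≠ 0 → (m.divisors.card : ℝ) ≤ C * (m : ℝ) ^ ε := by
  have hl : 0 < log 2 := log_pos (by norm_num)
  set K : ℝ := 1 + 1 / (ε * log 2) with hK
  have hK1 : 1 ≤ K := by have : 0 ≤ 1 / (ε * log 2) := by positivity
                         linarith
  obtain ⟨P, hP⟩ := exists_nat_gt ((2 : ℝ) ^ (1 / ε))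
  refine ⟨K ^ P, one_le_pow₀ hK1, fun m hm => ?_⟩
  rw [Nat.card_divisors hm]
  have hm' : (m : ℝ) ^ ε = ∏ p ∈ m.primeFactors, ((p : ℝ) ^ m.factorization p) ^ ε := by
    conv_lhs => rw [← Nat.prod_factorization_pow_eq_self hm]
    rw [Finsupp.prod, Nat.support_factorization]
    push_cast
    rw [Real.finsetProd_rpow]
    intro i _; positivity
  rw [hm']
  push_cast
  calc ∏ p ∈ m.primeFactors, ((m.factorization p : ℝ) + 1)
      ≤ ∏ p ∈ m.primeFactors, ((if (p : ℝ) ^ ε < 2 then K else 1) *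
          ((p : ℝ) ^ m.factorization p) ^ ε) := by
        refine Finset.prod_le_prod (fun _ _ => by positivity) fun p hp => ?_
        exact succ_le_mul_rpow hε (Nat.prime_of_mem_primeFactors hp).two_le _
    _ = (∏ p ∈ m.primeFactors, (if (p : ℝ) ^ ε < 2 then K else 1)) *
          ∏ p ∈ m.primeFactors, ((p : ℝ) ^ m.factorization p) ^ ε := Finset.prod_mul_distrib
    _ ≤ _ := by
        gcongr
        rw [Finset.prod_ite, Finset.prod_const, Finset.prod_const_one, mul_one]
        refine pow_le_pow_right₀ hK1 ?_
        calc _ ≤ (Finset.range P).card := by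
              refine Finset.card_le_card fun p hp => ?_
              have h1 := (Finset.mem_filter.1 hp).2
              rw [Finset.mem_range]
              have h2 : (p : ℝ) < P := by
                refine lt_trans ?_ hP
                have := Real.rpow_lt_rpow (by positivity) h1 (show 0 < 1 / ε by positivity)
                rwa [← Real.rpow_mul (by positivity), mul_one_div_cancel hε.ne', Real.rpow_one] at this
              exact_mod_cast h2
          _ = P := Finset.card_range P

/-- Every divisor of `z` is associated to an element of `T`. -/
def CoversDivisors (T : Finset GaussianInt) (z : GaussianInt) : Prop :=
  ∀ d, d ∣ z → ∃ w ∈ T, Associated d w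

lemma coversDivisors_mul {S T : Finset GaussianInt} {y z : GaussianInt} (hS : CoversDivisors S y)
    (hT : CoversDivisors T z) : CoversDivisors (Finset.image₂ (· * ·) S T) (y * z) := by
  intro d hd
  obtain ⟨a, b, ha, hb, rfl⟩ := exists_dvd_and_dvd_of_dvd_mul hd
  obtain ⟨s, hs, h1⟩ := hS a ha
  obtain ⟨t, ht, h2⟩ := hT b hb
  exact ⟨s * t, Finset.mem_image₂_of_mem hs ht, h1.mul_mul h2⟩

lemma exists_coversDivisors_prime_pow {z : GaussianInt} (hz : Prime z) (e : ℕ) :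
    ∃ T : Finset GaussianInt, T.card ≤ e + 1 ∧ CoversDivisors T (z ^ e) := by
  classical
  refine ⟨(Finset.range (e + 1)).image (z ^ ·), ?_, fun d hd => ?_⟩
  · exact Finset.card_image_le.trans (by simp)
  · obtain ⟨i, hi, h⟩ := (dvd_prime_pow hz e).1 hd
    exact ⟨z ^ i, Finset.mem_image_of_mem _ (Finset.mem_range.2 (by omega)), h⟩

lemma exists_prime_mul_or_prime {p : ℕ} (hp : p.Prime) :
    Prime (p : GaussianInt) ∨ ∃ a b : GaussianInt, Prime a ∧ Prime b ∧ (p : GaussianInt) = a * b := by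
  by_cases h : Irreducible (p : GaussianInt)
  · exact Or.inl h.prime
  right
  have hnorm : (p : GaussianInt).norm = (p : ℤ) * p := Zsqrtd.norm_natCast p
  have hunit : ¬ IsUnit (p : GaussianInt) := by
    intro hu
    have := Zsqrtd.norm_eq_one_iff.2 hu
    rw [hnorm] at this
    have h2 := hp.two_le
    simp [Int.natAbs_mul] at this
    omega
  rw [irreducible_iff] at h
  push Not at h
  obtain ⟨a, b, hab, ha, hb⟩ := h hunit
  have hn : a.norm.natAbs * b.norm.natAbs = p * p := by
    rw [← Int.natAbs_mul, ← Zsqrtd.norm_mul, ← hab, hnorm]; simp [Int.natAbs_mul]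
  have ha1 : a.norm.natAbs ≠ 1 := fun h => ha (Zsqrtd.norm_eq_one_iff.1 h)
  have hb1 : b.norm.natAbs ≠ 1 := fun h => hb (Zsqrtd.norm_eq_one_iff.1 h)
  have key : a.norm.natAbs = p ∧ b.norm.natAbs = p := by
    rw [← sq] at hn
    exact ((Nat.Prime.mul_eq_prime_sq_iff hp ha1 hb1).1 hn)
  have irr : ∀ z : GaussianInt, z.norm.natAbs = p → Prime z := by
    intro z hz
    refine Irreducible.prime ⟨fun hu => ?_, fun x y hxy => ?_⟩
    · have := Zsqrtd.norm_eq_one_iff.2 hu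
      rw [hz] at this; exact hp.one_lt.ne' this
    · have : x.norm.natAbs * y.norm.natAbs = p := by
        rw [← Int.natAbs_mul, ← Zsqrtd.norm_mul, ← hxy, hz]
      rcases (Nat.dvd_prime hp).1 ⟨_, this.symm⟩ with h1 | h1
      · exact Or.inl (Zsqrtd.norm_eq_one_iff.1 h1)
      · right
        refine Zsqrtd.norm_eq_one_iff.1 ?_
        rw [h1] at this
        exact Nat.eq_of_mul_eq_mul_left hp.pos (by rw [this, mul_one])
  exact ⟨a, b, irr a key.1, irr b key.2, hab⟩

lemma exists_coversDivisors (m : ℕ) (hm : m ≠ 0) :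
    ∃ T : Finset GaussianInt, T.card ≤ m.divisors.card ^ 2 ∧ CoversDivisors T (m : GaussianInt) := by
  classical
  revert hm
  refine Nat.recOnPosPrimePosCoprime ?_ ?_ ?_ ?_ m
  · intro p e hp he _
    rw [Nat.divisors_prime_pow hp, Finset.card_map, Finset.card_range, Nat.cast_pow]
    rcases exists_prime_mul_or_prime hp with h | ⟨a, b, ha, hb, h⟩
    · obtain ⟨T, h1, h2⟩ := exists_coversDivisors_prime_pow h e
      exact ⟨T, h1.trans (Nat.le_self_pow (by norm_num) _), h2⟩
    · obtain ⟨S, h1, h2⟩ := exists_coversDivisors_prime_pow ha e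
      obtain ⟨T, h3, h4⟩ := exists_coversDivisors_prime_pow hb e
      refine ⟨_, ?_, by rw [h, mul_pow]; exact coversDivisors_mul h2 h4⟩
      exact (Finset.card_image₂_le _ _ _).trans (by rw [sq]; exact Nat.mul_le_mul h1 h3)
  · exact fun h => absurd rfl h
  · intro _
    exact ⟨{1}, by simp, fun d hd => ⟨1, by simp, by
      rw [Nat.cast_one] at hd; exact associated_one_iff_isUnit.2 (isUnit_of_dvd_one hd)⟩⟩
  · intro a b ha hb hab iha ihb _
    obtain ⟨S, h1, h2⟩ := iha (by omega)
    obtain ⟨T, h3, h4⟩ := ihb (by omega)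
    refine ⟨_, ?_, by rw [Nat.cast_mul]; exact coversDivisors_mul h2 h4⟩
    rw [hab.card_divisors_mul, mul_pow]
    exact (Finset.card_image₂_le _ _ _).trans (Nat.mul_le_mul h1 h3)

lemma gaussianInt_unit_cases (u : GaussianIntˣ) :
    (u : GaussianInt) ∈ ({⟨1, 0⟩, ⟨-1, 0⟩, ⟨0, 1⟩, ⟨0, -1⟩} : Finset GaussianInt) := by
  have h := Zsqrtd.norm_eq_one_iff.2 u.isUnit
  generalize (u : GaussianInt) = z at h
  obtain ⟨x, y⟩ := z
  rw [Zsqrtd.norm] at h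
  have h' : x * x + y * y = 1 := by
    have h0 : 0 ≤ x * x - -1 * y * y := by nlinarith [mul_self_nonneg x, mul_self_nonneg y]
    have := Int.natAbs_of_nonneg h0
    rw [h] at this; push_cast at this; linarith
  have hx : x ≤ 1 := by nlinarith [mul_self_nonneg y]
  have hx' : -1 ≤ x := by nlinarith [mul_self_nonneg y]
  have hy : y ≤ 1 := by nlinarith [mul_self_nonneg x]
  have hy' : -1 ≤ y := by nlinarith [mul_self_nonneg x]
  interval_cases x <;> interval_cases y <;> simp_all

/-- The number of representations of `m ≥ 1` as a sum of two squares is at most `4 d(m)²`. -/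
lemma card_sum_two_squares_le (m : ℕ) (hm : m ≠ 0) (t : Finset (ℤ × ℤ))
    (ht : ∀ z ∈ t, z.1 ^ 2 + z.2 ^ 2 = (m : ℤ)) : t.card ≤ 4 * m.divisors.card ^ 2 := by
  classical
  obtain ⟨T, hT, hc⟩ := exists_coversDivisors m hm
  set U : Finset GaussianInt := {⟨1, 0⟩, ⟨-1, 0⟩, ⟨0, 1⟩, ⟨0, -1⟩}
  have hU : U.card ≤ 4 := Finset.card_le_four
  have hinj : Function.Injective (fun z : ℤ × ℤ => (⟨z.1, z.2⟩ : GaussianInt)) := by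
    rintro ⟨a, b⟩ ⟨c, d⟩ h
    simpa [Zsqrtd.ext_iff] using h
  rw [← Finset.card_image_of_injective t hinj]
  have : t.image (fun z : ℤ × ℤ => (⟨z.1, z.2⟩ : GaussianInt)) ⊆ Finset.image₂ (· * ·) T U := by
    intro w hw
    obtain ⟨z, hz, rfl⟩ := Finset.mem_image.1 hw
    have hd : (⟨z.1, z.2⟩ : GaussianInt) ∣ (m : GaussianInt) := by
      refine ⟨⟨z.1, -z.2⟩, ?_⟩
      have := ht z hz
      ext
      · simp; linarith
      · simp; ring
    obtain ⟨v, hv, u, hu⟩ := hc _ hd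
    refine Finset.mem_image₂.2 ⟨v, hv, ((u⁻¹ : GaussianIntˣ) : GaussianInt), gaussianInt_unit_cases _, ?_⟩
    rw [← hu, mul_assoc, Units.mul_inv, mul_one]
  calc _ ≤ _ := Finset.card_le_card this
    _ ≤ T.card * U.card := Finset.card_image₂_le _ _ _
    _ ≤ m.divisors.card ^ 2 * 4 := Nat.mul_le_mul hT hU
    _ = _ := mul_comm _ _

/-- The number of divisors of `k` in `[1, R]`. -/
def truncDivisors (R : ℕ) (k : ℕ) : ℕ := ((Finset.Icc 1 R).filter (· ∣ k)).card

lemma truncDivisors_pow (R k B : ℕ) : truncDivisors R k ^ B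
    = ((Fintype.piFinset fun _ : Fin B => Finset.Icc 1 R).filter (fun q => ∀ i, q i ∣ k)).card := by
  rw [truncDivisors, ← Fintype.card_piFinset_const]
  congr 1
  ext q
  simp only [Fintype.mem_piFinset, Finset.mem_filter, forall_and]

lemma exists_sum_truncDivisors_pow_le (B : ℕ) (hB : 0 < B) :
    ∃ C : ℝ, 0 < C ∧ ∀ R K : ℕ, 1 ≤ R →
      ∑ k ∈ Finset.Icc 1 K, (truncDivisors R k : ℝ) ^ B ≤ C * K * R := by
  classical
  have hB' : (0 : ℝ) < B := by exact_mod_cast hB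
  obtain ⟨C₀, hC₀, hdiv⟩ := exists_card_divisors_le (ε := 1 / (2 * B ^ 2)) (by positivity)
  refine ⟨C₀ ^ B * (1 + 2 * B), by positivity, fun R K hR => ?_⟩
  set Q := Fintype.piFinset fun _ : Fin B => Finset.Icc 1 R with hQ
  set L : (Fin B → ℕ) → ℕ := fun q => Finset.univ.lcm q with hL
  have hL1 : ∀ q ∈ Q, L q ∈ Finset.Icc 1 (R ^ B) := by
    intro q hq
    have hq' : ∀ i, 1 ≤ q i ∧ q i ≤ R := by simpa [hQ, Fintype.mem_piFinset] using hq
    rw [Finset.mem_Icc]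
    have hdvd : L q ∣ ∏ i, q i :=
      Finset.lcm_dvd fun i hi => Finset.dvd_prod_of_mem q hi
    have hpos : 0 < ∏ i, q i := Finset.prod_pos fun i _ => (hq' i).1
    refine ⟨Nat.pos_of_dvd_of_pos hdvd hpos, (Nat.le_of_dvd hpos hdvd).trans ?_⟩
    calc ∏ i, q i ≤ ∏ _i : Fin B, R := Finset.prod_le_prod' fun i _ => (hq' i).2
      _ = R ^ B := by simp
  have h1 : ∑ k ∈ Finset.Icc 1 K, (truncDivisors R k : ℝ) ^ B ≤ ∑ q ∈ Q, (K : ℝ) / L q := by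
    have e : ∀ k, (truncDivisors R k : ℝ) ^ B = ∑ q ∈ Q, if L q ∣ k then (1 : ℝ) else 0 := by
      intro k
      rw [← Nat.cast_pow, truncDivisors_pow, Finset.sum_boole]
      congr 2
      ext q
      simp [hL, Finset.lcm_dvd_iff, hQ]
    simp_rw [e]
    rw [Finset.sum_comm]
    refine Finset.sum_le_sum fun q hq => ?_
    rw [Finset.sum_boole]
    have : (Finset.Icc 1 K).filter (L q ∣ ·) = (Finset.Ioc 0 K).filter (L q ∣ ·) := rfl
    rw [this, Nat.Ioc_filter_dvd_card_eq_div]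
    exact Nat.cast_div_le
  refine h1.trans ?_
  rw [← Finset.sum_fiberwise_of_maps_to hL1]
  set X : ℕ := R ^ B with hX
  have hX1 : (1 : ℝ) ≤ X := by rw [hX]; exact_mod_cast Nat.one_le_pow _ _ hR
  have h2 : ∀ m ∈ Finset.Icc 1 X, ∑ q ∈ Q with L q = m, (K : ℝ) / L q
      ≤ K * C₀ ^ B * (X : ℝ) ^ (1 / (2 * B : ℝ)) * (1 / m) := by
    intro m hm
    rw [Finset.mem_Icc] at hm
    have hm1 : (1 : ℝ) ≤ m := by exact_mod_cast hm.1
    have hmX : (m : ℝ) ≤ X := by exact_mod_cast hm.2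
    have hcard : ((Q.filter (fun q => L q = m)).card : ℝ) ≤ (m.divisors.card : ℝ) ^ B := by
      have : ((Q.filter (fun q => L q = m)).card) ≤ (m.divisors.card) ^ B := by
        rw [← Fintype.card_piFinset_const]
        refine Finset.card_le_card fun q hq => ?_
        rw [Finset.mem_filter] at hq
        rw [Fintype.mem_piFinset]
        intro i
        rw [Nat.mem_divisors]
        exact ⟨by rw [← hq.2]; exact Finset.dvd_lcm (Finset.mem_univ i), by omega⟩
      exact_mod_cast this
    have hd : (m.divisors.card : ℝ) ^ B ≤ C₀ ^ B * (X : ℝ) ^ (1 / (2 * B : ℝ)) := by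
      calc (m.divisors.card : ℝ) ^ B ≤ (C₀ * (m : ℝ) ^ (1 / (2 * B ^ 2) : ℝ)) ^ B := by
            gcongr; exact hdiv m (by omega)
        _ = C₀ ^ B * (m : ℝ) ^ (1 / (2 * B : ℝ)) := by
            rw [mul_pow, ← Real.rpow_mul_natCast (by positivity)]
            congr 2
            field_simp
        _ ≤ _ := by gcongr
    calc ∑ q ∈ Q with L q = m, (K : ℝ) / L q = ∑ q ∈ Q with L q = m, (K : ℝ) / m :=
          Finset.sum_congr rfl fun q hq => by rw [(Finset.mem_filter.1 hq).2]
      _ = (Q.filter (fun q => L q = m)).card * ((K : ℝ) / m) := by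
          rw [Finset.sum_const, nsmul_eq_mul]
      _ ≤ (C₀ ^ B * (X : ℝ) ^ (1 / (2 * B : ℝ))) * ((K : ℝ) / m) := by
          gcongr; exact hcard.trans hd
      _ = _ := by ring
  refine (Finset.sum_le_sum h2).trans ?_
  rw [← Finset.mul_sum]
  have h3 : ∑ m ∈ Finset.Icc 1 X, (1 / (m : ℝ)) ≤ (1 + 2 * B) * (X : ℝ) ^ (1 / (2 * B : ℝ)) := by
    have h4 : ∑ m ∈ Finset.Icc 1 X, (1 / (m : ℝ)) ≤ 1 + log X := by
      have := harmonic_le_one_add_log X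
      rw [harmonic_eq_sum_Icc] at this
      push_cast at this
      simpa [one_div] using this
    have h5 := Real.log_le_rpow_div (x := (X : ℝ)) (by positivity)
      (show (0 : ℝ) < 1 / (2 * B) by positivity)
    have h6 : (1 : ℝ) ≤ (X : ℝ) ^ (1 / (2 * B : ℝ)) := Real.one_le_rpow hX1 (by positivity)
    have h7 : (X : ℝ) ^ (1 / (2 * B : ℝ)) / (1 / (2 * B)) = 2 * B * (X : ℝ) ^ (1 / (2 * B : ℝ)) := by
      field_simp
    rw [h7] at h5
    linarith
  have h8 : (X : ℝ) ^ (1 / (2 * B : ℝ)) * (X : ℝ) ^ (1 / (2 * B : ℝ)) = R := by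
    rw [← Real.rpow_add (by positivity), hX]
    push_cast
    rw [← Real.rpow_natCast_mul (by positivity)]
    have : (B : ℝ) * (1 / (2 * B) + 1 / (2 * B)) = 1 := by field_simp; norm_num
    rw [this, Real.rpow_one]
  calc K * C₀ ^ B * (X : ℝ) ^ (1 / (2 * B : ℝ)) * ∑ m ∈ Finset.Icc 1 X, (1 / (m : ℝ))
      ≤ K * C₀ ^ B * (X : ℝ) ^ (1 / (2 * B : ℝ)) * ((1 + 2 * B) * (X : ℝ) ^ (1 / (2 * B : ℝ))) := by
        gcongr
    _ = C₀ ^ B * (1 + 2 * B) * K * ((X : ℝ) ^ (1 / (2 * B : ℝ)) * (X : ℝ) ^ (1 / (2 * B : ℝ))) := by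
        ring
    _ = _ := by rw [h8]

/-- Space-time Lebesgue measure on the period box. -/
noncomputable abbrev stMeas (n : ℕ) : Measure (ℝ × (Fin n → ℝ)) := timeMeas.prod (spaceMeas n)

/-- The free wave with coefficients `a` on the finite frequency set `S`. -/
noncomputable def wave {n : ℕ} (S : Finset (Fin n → ℤ)) (a : (Fin n → ℤ) → ℂ)
    (q : ℝ × (Fin n → ℝ)) : ℂ := ∑ ξ ∈ S, a ξ * stChar (sqNorm ξ, ξ) q

lemma stChar_mul {n : ℕ} (v w : ℤ × (Fin n → ℤ)) (q : ℝ × (Fin n → ℝ)) :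
    stChar v q * stChar w q = stChar (v + w) q := by
  simp only [stChar, ← cis_add]
  congr 1
  simp only [Prod.snd_add, Prod.fst_add, Pi.add_apply, Int.cast_add, mul_add, Finset.sum_add_distrib]
  ring

lemma conj_stChar {n : ℕ} (v : ℤ × (Fin n → ℤ)) (q : ℝ × (Fin n → ℝ)) :
    (starRingEnd ℂ) (stChar v q) = stChar (-v) q := by
  simp only [stChar, conj_cis]
  congr 1
  simp only [Prod.snd_neg, Prod.fst_neg, Pi.neg_apply, Int.cast_neg, mul_neg, Finset.sum_neg_distrib]
  ring

lemma exists_card_sum_two_squares_le {ε : ℝ} (hε : 0 < ε) :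
    ∃ C : ℝ, 1 ≤ C ∧ ∀ M : ℕ, 1 ≤ M → ∀ c : ℤ, c ≤ 8 * (M : ℤ) ^ 2 → ∀ t : Finset (ℤ × ℤ),
      (∀ z ∈ t, z.1 ^ 2 + z.2 ^ 2 = c) → (t.card : ℝ) ≤ C * (M : ℝ) ^ ε := by
  obtain ⟨C₀, h1, h2⟩ := exists_card_divisors_le (ε := ε / 4) (by positivity)
  have h8 : (1 : ℝ) ≤ (8 : ℝ) ^ (ε / 4) := Real.one_le_rpow (by norm_num) (by positivity)
  refine ⟨4 * (C₀ * 8 ^ (ε / 4)) ^ 2, ?_, fun M hM c hc t ht => ?_⟩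
  · have : 1 ≤ (C₀ * (8 : ℝ) ^ (ε / 4)) ^ 2 := one_le_pow₀ (by nlinarith)
    linarith
  have hM' : (1 : ℝ) ≤ M := by exact_mod_cast hM
  have hMe : (1 : ℝ) ≤ (M : ℝ) ^ ε := Real.one_le_rpow hM' hε.le
  have hA : 1 ≤ C₀ * (8 : ℝ) ^ (ε / 4) := by nlinarith
  rcases t.eq_empty_or_nonempty with rfl | ⟨z, hz⟩
  · simp; positivity
  have hc0 : 0 ≤ c := by rw [← ht z hz]; positivity
  obtain ⟨m, rfl⟩ := Int.eq_ofNat_of_zero_le hc0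
  by_cases hm : m = 0
  · subst hm
    have : t ⊆ {(0, 0)} := by
      intro y hy
      have := ht y hy
      simp only [Nat.cast_zero] at this
      rw [Finset.mem_singleton]
      have e1 : y.1 = 0 := by nlinarith [sq_nonneg y.1, sq_nonneg y.2]
      have e2 : y.2 = 0 := by nlinarith [sq_nonneg y.1, sq_nonneg y.2]
      exact Prod.ext e1 e2
    have h3 : (t.card : ℝ) ≤ 1 := by exact_mod_cast Finset.card_le_card this
    have h4 : 1 ≤ (C₀ * (8 : ℝ) ^ (ε / 4)) ^ 2 := one_le_pow₀ hA
    nlinarith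
  have h3 : (t.card : ℝ) ≤ 4 * (m.divisors.card : ℝ) ^ 2 := by
    exact_mod_cast card_sum_two_squares_le m hm t ht
  have hm8 : (m : ℝ) ≤ 8 * (M : ℝ) ^ 2 := by exact_mod_cast hc
  have h4 : (m.divisors.card : ℝ) ≤ C₀ * 8 ^ (ε / 4) * (M : ℝ) ^ (ε / 2) := by
    calc (m.divisors.card : ℝ) ≤ C₀ * (m : ℝ) ^ (ε / 4) := h2 m hm
      _ ≤ C₀ * (8 * (M : ℝ) ^ 2) ^ (ε / 4) := by gcongr
      _ = _ := by
        rw [Real.mul_rpow (by norm_num) (by positivity), ← Real.rpow_natCast_mul (by positivity), mul_assoc]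
        congr 3; push_cast; ring
  calc (t.card : ℝ) ≤ 4 * (C₀ * 8 ^ (ε / 4) * (M : ℝ) ^ (ε / 2)) ^ 2 := h3.trans (by gcongr)
    _ = _ := by
      rw [mul_pow _ ((M : ℝ) ^ (ε / 2)), ← Real.rpow_mul_natCast (by positivity), mul_assoc]
      congr 3; push_cast; ring

lemma wave_sq {n : ℕ} (S : Finset (Fin n → ℤ)) (a : (Fin n → ℤ) → ℂ) (q : ℝ × (Fin n → ℝ)) :
    wave S a q ^ 2 = ∑ k ∈ S ×ˢ S, (a k.1 * a k.2) *
      stChar ((sqNorm k.1, k.1) + (sqNorm k.2, k.2)) q := by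
  rw [sq, wave, Finset.sum_mul_sum, ← Finset.sum_product']
  refine Finset.sum_congr rfl fun k _ => ?_
  rw [← stChar_mul]; ring

/-- An `L⁴` estimate from a bound on the number of pairs with given sum and sum of squares. -/
lemma integral_wave_pow_four_le {n : ℕ} (S : Finset (Fin n → ℤ)) (a : (Fin n → ℤ) → ℂ) (K : ℝ)
    (hK : ∀ c : ℤ, ∀ v : Fin n → ℤ, ∀ t ⊆ S, (∀ ξ ∈ t, v - ξ ∈ S) →
      (∀ ξ ∈ t, sqNorm (2 • ξ - v) = c) → (t.card : ℝ) ≤ K) :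
    ∫ q, ‖wave S a q‖ ^ 4 ∂(stMeas n) ≤ (2 * π) ^ (n + 1) * (K * (∑ ξ ∈ S, ‖a ξ‖ ^ 2) ^ 2) := by
  classical
  have h := (isOrthoFamily_stChar n).integral_sq_le_of_fiber (by positivity) (S ×ˢ S)
    (fun k => a k.1 * a k.2) (fun k => (sqNorm k.1, k.1) + (sqNorm k.2, k.2)) K ?_
  · simp_rw [← wave_sq] at h
    have e : ∀ q, ‖wave S a q‖ ^ 4 = ‖wave S a q ^ 2‖ ^ 2 := fun q => by rw [norm_pow]; ring
    simp_rw [e]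
    refine h.trans (le_of_eq ?_)
    rw [sq (∑ ξ ∈ S, ‖a ξ‖ ^ 2), Finset.sum_mul_sum, ← Finset.sum_product']
    simp_rw [norm_mul, mul_pow]
  · rintro ⟨B, v⟩ t ht hφ
    have key : ∀ k ∈ t, sqNorm k.1 + sqNorm k.2 = B ∧ k.1 + k.2 = v := fun k hk => by
      have := hφ k hk
      simpa [Prod.ext_iff] using this
    have hinj : Set.InjOn Prod.fst (t : Set ((Fin n → ℤ) × (Fin n → ℤ))) := by
      intro k hk l hl hkl
      have h1 := (key k hk).2
      have h2 := (key l hl).2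
      refine Prod.ext hkl ?_
      rw [← eq_sub_iff_add_eq'] at h1 h2
      rw [h1, h2, hkl]
    rw [← Finset.card_image_of_injOn hinj]
    refine hK (2 * B - sqNorm v) v _ ?_ ?_ ?_
    · intro ξ hξ
      obtain ⟨k, hk, rfl⟩ := Finset.mem_image.1 hξ
      exact (Finset.mem_product.1 (ht hk)).1
    · intro ξ hξ
      obtain ⟨k, hk, rfl⟩ := Finset.mem_image.1 hξ
      rw [← (key k hk).2, add_sub_cancel_left]
      exact (Finset.mem_product.1 (ht hk)).2
    · intro ξ hξ
      obtain ⟨k, hk, rfl⟩ := Finset.mem_image.1 hξ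
      rw [← (key k hk).2, ← (key k hk).1]
      simp only [sqNorm, Finset.mul_sum, ← Finset.sum_add_distrib, ← Finset.sum_sub_distrib]
      refine Finset.sum_congr rfl fun i _ => ?_
      simp; ring

lemma exists_integral_wave_pow_four_le_two {ε : ℝ} (hε : 0 < ε) :
    ∃ C > 0, ∀ M : ℕ, 1 ≤ M → ∀ (S : Finset (Fin 2 → ℤ)) (a : (Fin 2 → ℤ) → ℂ),
      (∀ ξ ∈ S, ∀ i, |ξ i| ≤ M) →
      ∫ q, ‖wave S a q‖ ^ 4 ∂(stMeas 2) ≤ C * (M : ℝ) ^ ε * (∑ ξ ∈ S, ‖a ξ‖ ^ 2) ^ 2 := by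
  classical
  obtain ⟨C, hC, h⟩ := exists_card_sum_two_squares_le hε
  refine ⟨(2 * π) ^ 3 * C, by positivity, fun M hM S a hS => ?_⟩
  refine (integral_wave_pow_four_le S a (C * (M : ℝ) ^ ε) ?_).trans (le_of_eq (by ring))
  intro c v t ht hv hc
  rcases t.eq_empty_or_nonempty with rfl | ⟨ξ, hξ⟩
  · simp; positivity
  have hinj : Function.Injective (fun ξ : Fin 2 → ℤ => ((2 • ξ - v) 0, (2 • ξ - v) 1)) := by
    intro x y hxy
    simp at hxy
    ext i; fin_cases i
    · exact hxy.1
    · exact hxy.2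
  rw [← Finset.card_image_of_injective t hinj]
  refine h M hM c ?_ _ ?_
  · rw [← hc ξ hξ, sqNorm, Fin.sum_univ_two]
    have b : ∀ i, ((2 • ξ - v) i) ^ 2 ≤ 4 * (M : ℤ) ^ 2 := fun i => by
      have h1 := abs_le.1 (hS _ (ht hξ) i)
      have h2 := abs_le.1 (hS _ (hv _ hξ) i)
      simp at h2 ⊢
      nlinarith
    linarith [b 0, b 1]
  · intro z hz
    obtain ⟨y, hy, rfl⟩ := Finset.mem_image.1 hz
    rw [← hc y hy, sqNorm, Fin.sum_univ_two]

lemma exists_integral_wave_pow_four_le_three {ε : ℝ} (hε : 0 < ε) :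
    ∃ C > 0, ∀ M : ℕ, 1 ≤ M → ∀ (S : Finset (Fin 3 → ℤ)) (a : (Fin 3 → ℤ) → ℂ),
      (∀ ξ ∈ S, ∀ i, |ξ i| ≤ M) →
      ∫ q, ‖wave S a q‖ ^ 4 ∂(stMeas 3) ≤ C * (M : ℝ) ^ (1 + ε) * (∑ ξ ∈ S, ‖a ξ‖ ^ 2) ^ 2 := by
  classical
  obtain ⟨C, hC, h⟩ := exists_card_sum_two_squares_le hε
  refine ⟨(2 * π) ^ 4 * (5 * C), by positivity, fun M hM S a hS => ?_⟩
  have hM0 : (0 : ℝ) < M := by exact_mod_cast hM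
  refine (integral_wave_pow_four_le S a ((5 * M) * (C * (M : ℝ) ^ ε)) ?_).trans (le_of_eq ?_)
  swap
  · rw [Real.rpow_add hM0, Real.rpow_one]; ring
  intro c v t ht hv hc
  have b : ∀ ξ ∈ t, ∀ i, ((2 • ξ - v) i) ∈ Finset.Icc (-(2 * M : ℤ)) (2 * M) := fun ξ hξ i => by
    have h1 := abs_le.1 (hS _ (ht hξ) i)
    have h2 := abs_le.1 (hS _ (hv _ hξ) i)
    simp at h2 ⊢
    constructor <;> linarith
  rw [Finset.card_eq_sum_card_fiberwise (f := fun ξ => (2 • ξ - v) 2) fun ξ hξ => b ξ hξ 2]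
  push_cast
  have hcard : ∀ j ∈ Finset.Icc (-(2 * M : ℤ)) (2 * M),
      ((t.filter (fun ξ => (2 • ξ - v) 2 = j)).card : ℝ) ≤ C * (M : ℝ) ^ ε := by
    intro j _
    rcases (t.filter (fun ξ => (2 • ξ - v) 2 = j)).eq_empty_or_nonempty with h0 | ⟨ξ, hξ⟩
    · rw [h0]; simp; positivity
    have hinj : Set.InjOn (fun ξ : Fin 3 → ℤ => ((2 • ξ - v) 0, (2 • ξ - v) 1))
        (t.filter (fun ξ => (2 • ξ - v) 2 = j) : Finset (Fin 3 → ℤ)) := by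
      intro x hx y hy hxy
      have hx2 := (Finset.mem_filter.1 hx).2
      have hy2 := (Finset.mem_filter.1 hy).2
      rw [← hy2] at hx2
      simp at hxy hx2
      ext i; fin_cases i
      · exact hxy.1
      · exact hxy.2
      · exact hx2
    rw [← Finset.card_image_of_injOn hinj]
    have hk : ∀ y ∈ t.filter (fun ξ => (2 • ξ - v) 2 = j),
        ((2 • y - v) 0) ^ 2 + ((2 • y - v) 1) ^ 2 = c - j ^ 2 := by
      intro y hy
      rw [← hc y (Finset.mem_filter.1 hy).1, ← (Finset.mem_filter.1 hy).2, sqNorm, Fin.sum_univ_three]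
      ring
    refine h M hM (c - j ^ 2) ?_ _ ?_
    · rw [← hk ξ hξ]
      have h0 := Finset.mem_Icc.1 (b ξ (Finset.mem_filter.1 hξ).1 0)
      have h1 := Finset.mem_Icc.1 (b ξ (Finset.mem_filter.1 hξ).1 1)
      nlinarith
    · intro z hz
      obtain ⟨y, hy, rfl⟩ := Finset.mem_image.1 hz
      exact hk y hy
  refine (Finset.sum_le_sum hcard).trans ?_
  rw [Finset.sum_const, nsmul_eq_mul]
  gcongr
  rw [Int.card_Icc]
  have : (((2 * M : ℤ) + 1 - -(2 * M : ℤ)).toNat : ℝ) = 4 * M + 1 := by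
    have : ((2 * M : ℤ) + 1 - -(2 * M : ℤ)).toNat = 4 * M + 1 := by omega
    rw [this]; push_cast; ring
  rw [this]
  have : (1 : ℝ) ≤ M := by exact_mod_cast hM
  linarith

lemma card_int_dvd_le (c : ℤ) (hc : c ≠ 0) (t : Finset ℤ) (ht : ∀ z ∈ t, z ∣ c) :
    t.card ≤ 2 * c.natAbs.divisors.card := by
  classical
  have : t ⊆ c.natAbs.divisors.image (fun d : ℕ => (d : ℤ)) ∪
      c.natAbs.divisors.image (fun d : ℕ => -(d : ℤ)) := by
    intro z hz
    have hd : z.natAbs ∈ c.natAbs.divisors :=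
      Nat.mem_divisors.2 ⟨Int.natAbs_dvd_natAbs.2 (ht z hz), by simpa using hc⟩
    rw [Finset.mem_union, Finset.mem_image, Finset.mem_image]
    rcases Int.natAbs_eq z with h | h
    · exact Or.inl ⟨_, hd, h.symm⟩
    · exact Or.inr ⟨_, hd, h.symm⟩
  refine (Finset.card_le_card this).trans ((Finset.card_union_le _ _).trans ?_)
  have h1 := Finset.card_image_le (s := c.natAbs.divisors) (f := fun d : ℕ => (d : ℤ))
  have h2 := Finset.card_image_le (s := c.natAbs.divisors) (f := fun d : ℕ => -(d : ℤ))
  omega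

/-- Splitting a triple sum over `x, y, z` into the part `x ≠ y ≠ z` and the rest. -/
lemma sum_triple_split {κ : Type*} [DecidableEq κ] (S : Finset κ) (f : κ × κ × κ → ℂ) :
    ∑ k ∈ S ×ˢ S ×ˢ S, f k = ∑ k ∈ S ×ˢ S ×ˢ S with k.2.1 ≠ k.1 ∧ k.2.1 ≠ k.2.2, f k
      + ∑ x ∈ S, ∑ z ∈ S, f (x, x, z) + ∑ x ∈ S, ∑ z ∈ S, f (x, z, z) - ∑ x ∈ S, f (x, x, x) := by
  have e : ∀ k ∈ S ×ˢ S ×ˢ S, f k = (if k.2.1 ≠ k.1 ∧ k.2.1 ≠ k.2.2 then f k else 0)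
      + (if k.2.1 = k.1 then f k else 0) + (if k.2.1 = k.2.2 then f k else 0)
      - (if k.2.1 = k.1 then if k.2.1 = k.2.2 then f k else 0 else 0) := by
    intro k _
    by_cases h1 : k.2.1 = k.1 <;> by_cases h2 : k.2.1 = k.2.2 <;> simp [h1, h2]
  rw [Finset.sum_congr rfl e, Finset.sum_sub_distrib, Finset.sum_add_distrib,
    Finset.sum_add_distrib, Finset.sum_filter]
  simp only [Finset.sum_product]
  congr 1
  · congr 1
    · congr 1
      refine Finset.sum_congr rfl fun x hx => ?_
      rw [Finset.sum_comm]
      refine Finset.sum_congr rfl fun z hz => ?_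
      simp [hx]
    · refine Finset.sum_congr rfl fun x hx => ?_
      rw [Finset.sum_comm]
      refine Finset.sum_congr rfl fun z hz => ?_
      simp [hz]
  · refine Finset.sum_congr rfl fun x hx => ?_
    have : ∀ y ∈ S, (∑ z ∈ S, if y = x then if y = z then f (x, y, z) else 0 else 0)
        = if y = x then f (x, x, x) else 0 := by
      intro y hy
      by_cases h : y = x
      · subst h; simp [hy]
      · simp [h]
    rw [Finset.sum_congr rfl this]
    simp [hx]

lemma card_triple_fiber_le {ε : ℝ} (hε : 0 < ε) : ∃ C : ℝ, 0 < C ∧ ∀ M : ℕ, 1 ≤ M → ∀ A B : ℤ,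
    ∀ t : Finset (ℤ × ℤ × ℤ), (∀ k ∈ t, |k.1| ≤ M ∧ |k.2.1| ≤ M ∧ |k.2.2| ≤ M ∧
      k.2.1 ≠ k.1 ∧ k.2.1 ≠ k.2.2 ∧ k.1 - k.2.1 + k.2.2 = A ∧ k.1 ^ 2 - k.2.1 ^ 2 + k.2.2 ^ 2 = B) →
    (t.card : ℝ) ≤ C * (M : ℝ) ^ ε := by
  classical
  obtain ⟨C₀, h1, h2⟩ := exists_card_divisors_le (ε := ε / 2) (by positivity)
  refine ⟨2 * (C₀ * 8 ^ (ε / 2)), by positivity, fun M hM A B t ht => ?_⟩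
  rcases t.eq_empty_or_nonempty with rfl | ⟨k, hk⟩
  · simp; positivity
  have key : ∀ k ∈ t, (2 * (k.1 - A)) * (k.2.2 - A) = A ^ 2 - B := by
    intro k hk
    obtain ⟨-, -, -, -, -, h3, h4⟩ := ht k hk
    rw [← h3, ← h4]; ring
  have hne : A ^ 2 - B ≠ 0 := by
    rw [← key k hk]
    obtain ⟨-, -, -, h5, h6, h3, h4⟩ := ht k hk
    refine mul_ne_zero (mul_ne_zero two_ne_zero ?_) ?_
    · intro h; apply h6; linarith
    · intro h; apply h5; linarith
  have hinj : Set.InjOn (fun k : ℤ × ℤ × ℤ => 2 * (k.1 - A)) (t : Set (ℤ × ℤ × ℤ)) := by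
    intro x hx y hy hxy
    simp only at hxy
    obtain ⟨-, -, -, h5, h6, h3, h4⟩ := ht x hx
    obtain ⟨-, -, -, h5', h6', h3', h4'⟩ := ht y hy
    have e1 : x.1 = y.1 := by linarith
    have k1 := key x hx
    rw [← key y hy, hxy] at k1
    have hn : 2 * (y.1 - A) ≠ 0 := mul_ne_zero two_ne_zero (fun h => h6' (by linarith))
    have e2 := mul_left_cancel₀ hn k1
    refine Prod.ext e1 (Prod.ext ?_ ?_) <;> linarith
  rw [← Finset.card_image_of_injOn hinj]
  have h3 := card_int_dvd_le (A ^ 2 - B) hne (t.image fun k => 2 * (k.1 - A)) (by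
    intro z hz
    obtain ⟨y, hy, rfl⟩ := Finset.mem_image.1 hz
    exact ⟨_, (key y hy).symm⟩)
  have h4 : ((A ^ 2 - B).natAbs : ℝ) ≤ 8 * (M : ℝ) ^ 2 := by
    have : |A ^ 2 - B| ≤ 8 * (M : ℤ) ^ 2 := by
      rw [← key k hk]
      obtain ⟨b1, b2, b3, -, -, h5, -⟩ := ht k hk
      have e1 : |k.1 - A| ≤ 2 * M := by
        rw [← h5]; rw [abs_le] at *; constructor <;> linarith
      have e2 : |k.2.2 - A| ≤ 2 * M := by
        rw [← h5]; rw [abs_le] at *; constructor <;> linarith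
      rw [abs_mul, abs_mul, abs_two]
      nlinarith [abs_nonneg (k.1 - A), abs_nonneg (k.2.2 - A)]
    rw [Int.abs_eq_natAbs] at this
    exact_mod_cast this
  calc ((t.image fun k => 2 * (k.1 - A)).card : ℝ) ≤ 2 * (A ^ 2 - B).natAbs.divisors.card := by
        exact_mod_cast h3
    _ ≤ 2 * (C₀ * ((A ^ 2 - B).natAbs : ℝ) ^ (ε / 2)) := by
        gcongr; exact h2 _ (by simpa using hne)
    _ ≤ 2 * (C₀ * (8 * (M : ℝ) ^ 2) ^ (ε / 2)) := by gcongr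
    _ = _ := by
        rw [Real.mul_rpow (by norm_num) (by positivity), ← Real.rpow_natCast_mul (by positivity)]
        rw [show ((2 : ℕ) : ℝ) * (ε / 2) = ε by push_cast; ring]; ring

lemma wave_measurable {n : ℕ} (S : Finset (Fin n → ℤ)) (a : (Fin n → ℤ) → ℂ) :
    Measurable (wave S a) := by
  unfold wave stChar; fun_prop

lemma wave_norm_le {n : ℕ} (S : Finset (Fin n → ℤ)) (a : (Fin n → ℤ) → ℂ) (q : ℝ × (Fin n → ℝ)) :
    ‖wave S a q‖ ≤ ∑ ξ ∈ S, ‖a ξ‖ :=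
  (norm_sum_le S _).trans (Finset.sum_le_sum fun i _ => by simp [stChar, norm_cis])

lemma integral_wave_sq {n : ℕ} (S : Finset (Fin n → ℤ)) (a : (Fin n → ℤ) → ℂ) :
    ∫ q, ‖wave S a q‖ ^ 2 ∂(stMeas n) = (2 * π) ^ (n + 1) * ∑ ξ ∈ S, ‖a ξ‖ ^ 2 := by
  classical
  have h := (isOrthoFamily_stChar n).parseval (S.image fun ξ => (sqNorm ξ, ξ)) (fun v => a v.2)
  have hinj : Set.InjOn (fun ξ : Fin n → ℤ => (sqNorm ξ, ξ)) S := by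
    intro x _ y _ hxy; exact (Prod.ext_iff.1 hxy).2
  simp_rw [Finset.sum_image hinj] at h
  exact h

lemma norm_sub_add_sq_le (x y z : ℂ) :
    ‖x + y - z‖ ^ 2 ≤ 3 * (‖x‖ ^ 2 + ‖y‖ ^ 2 + ‖z‖ ^ 2) := by
  have h : ‖x + y - z‖ ≤ ‖x‖ + ‖y‖ + ‖z‖ :=
    (norm_sub_le _ _).trans (by gcongr; exact norm_add_le _ _)
  calc ‖x + y - z‖ ^ 2 ≤ (‖x‖ + ‖y‖ + ‖z‖) ^ 2 := by gcongr
    _ ≤ _ := by nlinarith [sq_nonneg (‖x‖ - ‖y‖), sq_nonneg (‖x‖ - ‖z‖), sq_nonneg (‖y‖ - ‖z‖)]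

lemma exists_integral_wave_pow_six_le {ε : ℝ} (hε : 0 < ε) :
    ∃ C > 0, ∀ M : ℕ, 1 ≤ M → ∀ (S : Finset (Fin 1 → ℤ)) (a : (Fin 1 → ℤ) → ℂ),
      (∀ ξ ∈ S, ∀ i, |ξ i| ≤ M) →
      ∫ q, ‖wave S a q‖ ^ 6 ∂(stMeas 1) ≤ C * (M : ℝ) ^ ε * (∑ ξ ∈ S, ‖a ξ‖ ^ 2) ^ 3 := by
  classical
  obtain ⟨C, hC, h⟩ := card_triple_fiber_le hε
  refine ⟨(2 * π) ^ 2 * (3 * (C + 5)), by positivity, fun M hM S a hS => ?_⟩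
  have hMe : (1 : ℝ) ≤ (M : ℝ) ^ ε := Real.one_le_rpow (by exact_mod_cast hM) hε.le
  set A : ℝ := ∑ ξ ∈ S, ‖a ξ‖ ^ 2 with hA
  have hA0 : 0 ≤ A := Finset.sum_nonneg fun _ _ => by positivity
  set T := (S ×ˢ S ×ˢ S).filter (fun k => k.2.1 ≠ k.1 ∧ k.2.1 ≠ k.2.2) with hT
  set φ : (Fin 1 → ℤ) × (Fin 1 → ℤ) × (Fin 1 → ℤ) → ℤ × (Fin 1 → ℤ) :=
    fun k => (sqNorm k.1, k.1) + -(sqNorm k.2.1, k.2.1) + (sqNorm k.2.2, k.2.2) with hφ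
  set b : (Fin 1 → ℤ) × (Fin 1 → ℤ) × (Fin 1 → ℤ) → ℂ :=
    fun k => a k.1 * (starRingEnd ℂ) (a k.2.1) * a k.2.2 with hb
  set v : ℝ × (Fin 1 → ℝ) → ℂ := fun q => ∑ k ∈ T, b k * stChar (φ k) q with hv
  set w : (Fin 1 → ℤ) → ℂ := fun ξ => (‖a ξ‖ ^ 2 : ℝ) * a ξ with hw
  have hexp : ∀ q, wave S a q * (starRingEnd ℂ) (wave S a q) * wave S a q
      = v q + (2 * A : ℝ) * wave S a q - wave S w q := by
    intro q
    have h1 : wave S a q * (starRingEnd ℂ) (wave S a q) * wave S a q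
        = ∑ k ∈ S ×ˢ S ×ˢ S, b k * stChar (φ k) q := by
      rw [wave, map_sum, mul_assoc, Finset.sum_mul_sum, ← Finset.sum_product', Finset.sum_mul_sum,
        ← Finset.sum_product']
      refine Finset.sum_congr rfl fun k _ => ?_
      simp only [hφ, hb, ← stChar_mul, map_mul, conj_stChar]
      ring
    rw [h1, sum_triple_split]
    have e3 : ∀ z : ℂ, z * (starRingEnd ℂ) z = ((‖z‖ ^ 2 : ℝ) : ℂ) := by
      intro z; rw [Complex.mul_conj, Complex.normSq_eq_norm_sq]
    have d1 : ∑ x ∈ S, ∑ z ∈ S, b (x, x, z) * stChar (φ (x, x, z)) q = A * wave S a q := by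
      rw [hA, wave, Complex.ofReal_sum, Finset.sum_mul_sum]
      refine Finset.sum_congr rfl fun x _ => Finset.sum_congr rfl fun z _ => ?_
      simp only [hb, hφ, add_neg_cancel, zero_add, e3]; ring
    have d2 : ∑ x ∈ S, ∑ z ∈ S, b (x, z, z) * stChar (φ (x, z, z)) q = A * wave S a q := by
      rw [hA, wave, Complex.ofReal_sum, Finset.sum_mul_sum, Finset.sum_comm]
      refine Finset.sum_congr rfl fun x _ => Finset.sum_congr rfl fun z _ => ?_
      simp only [hb, hφ, neg_add_cancel_right, ← e3]; ring
    have d3 : ∑ x ∈ S, b (x, x, x) * stChar (φ (x, x, x)) q = wave S w q := by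
      rw [wave]
      refine Finset.sum_congr rfl fun x _ => ?_
      simp only [hb, hφ, neg_add_cancel_right, e3, hw]
    rw [d1, d2, d3]
    simp only [hv, hT]
    push_cast; ring
  have hpt : ∀ q, ‖wave S a q‖ ^ 6 ≤ 3 * (‖v q‖ ^ 2 + (2 * A) ^ 2 * ‖wave S a q‖ ^ 2 + ‖wave S w q‖ ^ 2) := by
    intro q
    have h1 : ‖wave S a q‖ ^ 6 = ‖wave S a q * (starRingEnd ℂ) (wave S a q) * wave S a q‖ ^ 2 := by
      rw [norm_mul, norm_mul, RCLike.norm_conj]; ring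
    rw [h1, hexp]
    refine (norm_sub_add_sq_le _ _ _).trans (le_of_eq ?_)
    rw [norm_mul, Complex.norm_real, mul_pow, Real.norm_of_nonneg (by positivity)]
  have hvI : ∫ q, ‖v q‖ ^ 2 ∂(stMeas 1) ≤ (2 * π) ^ 2 * (C * (M : ℝ) ^ ε * A ^ 3) := by
    refine ((isOrthoFamily_stChar 1).integral_sq_le_of_fiber (by positivity) T b φ
      (C * (M : ℝ) ^ ε) ?_).trans ?_
    · rintro ⟨B, v⟩ t ht hφt
      have hinj : Function.Injective
          (fun k : (Fin 1 → ℤ) × (Fin 1 → ℤ) × (Fin 1 → ℤ) => (k.1 0, k.2.1 0, k.2.2 0)) := by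
        intro x y hxy
        simp only [Prod.mk.injEq] at hxy
        refine Prod.ext ?_ (Prod.ext ?_ ?_) <;> ext i <;> fin_cases i
        · exact hxy.1
        · exact hxy.2.1
        · exact hxy.2.2
      rw [← Finset.card_image_of_injective t hinj]
      refine h M hM (v 0) B _ fun z hz => ?_
      obtain ⟨k, hk, rfl⟩ := Finset.mem_image.1 hz
      have hkT := Finset.mem_filter.1 (ht hk)
      rw [Finset.mem_product, Finset.mem_product] at hkT
      have hk2 := hφt k hk
      simp only [hφ, Prod.ext_iff] at hk2
      have ext0 : ∀ x y : Fin 1 → ℤ, x ≠ y → x 0 ≠ y 0 := fun x y hxy h0 =>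
        hxy (by ext i; fin_cases i; exact h0)
      refine ⟨hS _ hkT.1.1 0, hS _ hkT.1.2.1 0, hS _ hkT.1.2.2 0, ext0 _ _ hkT.2.1,
        ext0 _ _ hkT.2.2, ?_, ?_⟩
      · rw [← hk2.2]; simp; ring
      · rw [← hk2.1]; simp [sqNorm]; ring
    · refine mul_le_mul_of_nonneg_left ?_ (by positivity)
      refine mul_le_mul_of_nonneg_left ?_ (by positivity)
      calc ∑ k ∈ T, ‖b k‖ ^ 2 ≤ ∑ k ∈ S ×ˢ S ×ˢ S, ‖b k‖ ^ 2 :=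
            Finset.sum_le_sum_of_subset_of_nonneg (Finset.filter_subset _ _) fun _ _ _ => by positivity
        _ = A ^ 3 := by
            rw [hA, show (3 : ℕ) = 1 + 2 from rfl, pow_add, pow_one, sq (∑ ξ ∈ S, ‖a ξ‖ ^ 2),
              Finset.sum_mul_sum, ← Finset.sum_product', Finset.sum_mul_sum, ← Finset.sum_product']
            refine Finset.sum_congr rfl fun k _ => ?_
            simp only [hb, norm_mul, RCLike.norm_conj, mul_pow]; ring
  have hwI : ∑ ξ ∈ S, ‖w ξ‖ ^ 2 ≤ A ^ 3 := by
    have hle : ∀ ξ ∈ S, ‖a ξ‖ ^ 2 ≤ A := fun ξ hξ =>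
      Finset.single_le_sum (f := fun ξ => ‖a ξ‖ ^ 2) (fun _ _ => by positivity) hξ
    calc ∑ ξ ∈ S, ‖w ξ‖ ^ 2 ≤ ∑ ξ ∈ S, A ^ 2 * ‖a ξ‖ ^ 2 := by
          refine Finset.sum_le_sum fun ξ hξ => ?_
          simp only [hw]
          rw [norm_mul, Complex.norm_real, mul_pow, Real.norm_of_nonneg (by positivity)]
          gcongr
          exact hle ξ hξ
      _ = A ^ 3 := by rw [← Finset.mul_sum]; ring
  have hvm : Measurable v := by
    simp only [hv]; unfold stChar; fun_prop
  have hvb : ∀ q, ‖v q‖ ≤ ∑ k ∈ T, ‖b k‖ := fun q =>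
    (norm_sum_le T _).trans (Finset.sum_le_sum fun i _ => by simp [stChar, norm_cis])
  have bd : ∀ (f : ℝ × (Fin 1 → ℝ) → ℂ) (m : ℕ) (K : ℝ), Measurable f → (∀ q, ‖f q‖ ≤ K) →
      Integrable (fun q => ‖f q‖ ^ m) (stMeas 1) := by
    intro f m K hf hK
    refine Integrable.of_bound (by fun_prop) (K ^ m) (Filter.Eventually.of_forall fun q => ?_)
    rw [Real.norm_of_nonneg (by positivity)]
    exact pow_le_pow_left₀ (norm_nonneg _) (hK q) m
  have i1 := bd v 2 _ hvm hvb
  have i2 := bd _ 2 _ (wave_measurable S a) (wave_norm_le S a)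
  have i3 := bd _ 2 _ (wave_measurable S w) (wave_norm_le S w)
  have i6 := bd _ 6 _ (wave_measurable S a) (wave_norm_le S a)
  have i4 : Integrable (fun q => ‖v q‖ ^ 2 + (2 * A) ^ 2 * ‖wave S a q‖ ^ 2) (stMeas 1) :=
    i1.add (i2.const_mul ((2 * A) ^ 2))
  have hI := integral_mono i6 ((i4.add i3).const_mul 3) hpt
  simp only [Pi.add_apply] at hI
  rw [integral_const_mul, integral_add i4 i3, integral_add i1 (i2.const_mul ((2 * A) ^ 2)),
    integral_const_mul, integral_wave_sq, integral_wave_sq] at hI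
  refine hI.trans ?_
  have hA3 : 0 ≤ A ^ 3 := by positivity
  have hpp : 0 < (2 * π) ^ 2 := by positivity
  calc 3 * ((∫ q, ‖v q‖ ^ 2 ∂(stMeas 1)) + (2 * A) ^ 2 * ((2 * π) ^ (1 + 1) * A)
        + (2 * π) ^ (1 + 1) * ∑ ξ ∈ S, ‖w ξ‖ ^ 2)
      ≤ 3 * ((2 * π) ^ 2 * (C * (M : ℝ) ^ ε * A ^ 3) + (2 * A) ^ 2 * ((2 * π) ^ 2 * A)
        + (2 * π) ^ 2 * A ^ 3) := by gcongr
    _ = (2 * π) ^ 2 * 3 * A ^ 3 * (C * (M : ℝ) ^ ε + 5) := by ring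
    _ ≤ (2 * π) ^ 2 * 3 * A ^ 3 * ((C + 5) * (M : ℝ) ^ ε) := by
        gcongr; nlinarith
    _ = _ := by ring

/-- The triangular weight `max 0 (1 - |ξ| / M)`. -/
noncomputable def triWeight (M : ℕ) (ξ : ℤ) : ℝ := ((max 0 ((M : ℤ) - |ξ|) : ℤ) : ℝ) / M

/-- Distance to the nearest integer. -/
noncomputable def intDist (x : ℝ) : ℝ := |x - round x|

/-- The majorant of the squared one-dimensional kernel. -/
noncomputable def weylMajorant (M : ℕ) (τ : ℝ) : ℝ :=
  12 * M * ∑ k ∈ Finset.range (4 * M + 1), 1 / (1 + M ^ 2 * intDist (k * (τ / (2 * π))) ^ 2)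

lemma triWeight_nonneg (M : ℕ) (ξ : ℤ) : 0 ≤ triWeight M ξ :=
  div_nonneg (by exact_mod_cast le_max_left 0 _) (by positivity)

lemma triWeight_le_one (M : ℕ) (ξ : ℤ) : triWeight M ξ ≤ 1 := by
  refine div_le_one_of_le₀ ?_ (by positivity)
  have : max 0 ((M : ℤ) - |ξ|) ≤ M := by rw [abs_eq_max_neg]; omega
  exact_mod_cast this

lemma half_le_triWeight {M : ℕ} (hM : 1 ≤ M) {ξ : ℤ} (h : 2 * |ξ| ≤ M) : 1 / 2 ≤ triWeight M ξ := by
  have hM' : (0 : ℝ) < M := by exact_mod_cast hM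
  rw [triWeight, div_le_div_iff₀ (by norm_num) hM', one_mul]
  have : (M : ℤ) ≤ max 0 ((M : ℤ) - |ξ|) * 2 := by rw [abs_eq_max_neg] at *; omega
  exact_mod_cast this

lemma triWeight_eq_zero {M : ℕ} {ξ : ℤ} (h : ξ ∉ Finset.Icc (-(M : ℤ)) M) :
    triWeight M ξ = 0 := by
  have : max 0 ((M : ℤ) - |ξ|) = 0 := by rw [Finset.mem_Icc] at h; rw [abs_eq_max_neg] at *; omega
  rw [triWeight, this]; simp

lemma abs_triWeight_sub_le (M : ℕ) (ξ : ℤ) :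
    |triWeight M (ξ + 1) - triWeight M ξ| ≤ 1 / M := by
  rw [triWeight, triWeight, ← sub_div, abs_div, Nat.abs_cast]
  gcongr
  have : |max 0 ((M : ℤ) - |ξ + 1|) - max 0 ((M : ℤ) - |ξ|)| ≤ 1 := by
    simp only [abs_eq_max_neg]; omega
  exact_mod_cast this

lemma abs_triWeight_second_diff_le (M : ℕ) (ξ : ℤ) :
    |triWeight M (ξ + 1) + triWeight M (ξ - 1) - 2 * triWeight M ξ|
      ≤ ((if ξ = M then 1 else 0) + (if ξ = -M then 1 else 0) + (if ξ = 0 then 2 else 0)) / M := by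
  rw [triWeight, triWeight, triWeight, ← add_div, mul_div, ← sub_div, abs_div, Nat.abs_cast]
  gcongr
  have : |max 0 ((M : ℤ) - |ξ + 1|) + max 0 ((M : ℤ) - |ξ - 1|) - 2 * max 0 ((M : ℤ) - |ξ|)| ≤
    ((if ξ = M then 1 else 0) + (if ξ = -M then 1 else 0) + (if ξ = 0 then 2 else 0)) := by
    simp only [abs_eq_max_neg]; split_ifs <;> omega
  exact_mod_cast this

lemma sum_abs_second_diff_le (M : ℕ) (h : ℤ) (s : Finset ℤ) :
    ∑ η ∈ s, |triWeight M (η + h + 1) + triWeight M (η + h - 1) - 2 * triWeight M (η + h)| ≤ 4 / M := by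
  refine (Finset.sum_le_sum fun η _ => abs_triWeight_second_diff_le M (η + h)).trans ?_
  rw [← Finset.sum_div, Finset.sum_add_distrib, Finset.sum_add_distrib]
  gcongr
  have e : ∀ (c : ℤ) (r : ℝ), 0 ≤ r → ∑ η ∈ s, (if η + h = c then r else 0) ≤ r := by
    intro c r hr
    simp_rw [show ∀ η, η + h = c ↔ η = c - h from fun η => by omega]
    rw [Finset.sum_ite_eq']
    split_ifs <;> simp [hr]
  linarith [e M 1 zero_le_one, e (-M) 1 zero_le_one, e 0 2 zero_le_two]

/-- The shifted product weight. -/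
noncomputable def pairWeight (M : ℕ) (h η : ℤ) : ℝ := triWeight M (η + h) * triWeight M η

lemma pairWeight_eq_zero {M : ℕ} {h η : ℤ} (hη : η ∉ Finset.Icc (-(M : ℤ)) M) :
    pairWeight M h η = 0 := by
  rw [pairWeight, triWeight_eq_zero hη, mul_zero]

lemma sum_abs_pairWeight_second_diff_le {M : ℕ} (hM : 1 ≤ M) (h : ℤ) :
    ∑ η ∈ Finset.Icc (-(M : ℤ) - 1) (M + 1),
      |pairWeight M h (η + 1) + pairWeight M h (η - 1) - 2 * pairWeight M h η| ≤ 18 / M := by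
  have hM' : (1 : ℝ) ≤ M := by exact_mod_cast hM
  have hpt : ∀ η, |pairWeight M h (η + 1) + pairWeight M h (η - 1) - 2 * pairWeight M h η|
      ≤ |triWeight M (η + h + 1) + triWeight M (η + h - 1) - 2 * triWeight M (η + h)|
        + |triWeight M (η + 0 + 1) + triWeight M (η + 0 - 1) - 2 * triWeight M (η + 0)|
        + 2 / (M : ℝ) ^ 2 := by
    intro η
    simp only [pairWeight, add_zero]
    have e1 : η + 1 + h = η + h + 1 := by ring
    have e2 : η - 1 + h = η + h - 1 := by ring
    rw [e1, e2]
    have d1 := abs_triWeight_sub_le M (η + h)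
    have d2 := abs_triWeight_sub_le M (η + h - 1)
    have d3 := abs_triWeight_sub_le M η
    have d4 := abs_triWeight_sub_le M (η - 1)
    rw [sub_add_cancel] at d2 d4
    have f0 := triWeight_nonneg M (η + h)
    have f1 := triWeight_le_one M (η + h)
    have g0 := triWeight_nonneg M η
    have g1 := triWeight_le_one M η
    generalize triWeight M (η + h + 1) = f2 at *
    generalize triWeight M (η + h - 1) = f3 at *
    generalize triWeight M (η + h) = f at *
    generalize triWeight M (η + 1) = g2 at *
    generalize triWeight M (η - 1) = g3 at *
    generalize triWeight M η = g at *
    have key : f2 * g2 + f3 * g3 - 2 * (f * g) = (f2 + f3 - 2 * f) * g + (g2 + g3 - 2 * g) * f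
      + ((f2 - f) * (g2 - g) + (f - f3) * (g - g3)) := by ring
    rw [key]
    refine (abs_add_le _ _).trans (add_le_add ((abs_add_le _ _).trans (add_le_add ?_ ?_)) ?_)
    · rw [abs_mul, abs_of_nonneg g0]; exact mul_le_of_le_one_right (abs_nonneg _) g1
    · rw [abs_mul, abs_of_nonneg f0]; exact mul_le_of_le_one_right (abs_nonneg _) f1
    · refine (abs_add_le _ _).trans ?_
      rw [abs_mul, abs_mul]
      calc _ ≤ 1 / (M : ℝ) * (1 / M) + 1 / M * (1 / M) := by gcongr
        _ = _ := by ring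
  refine (Finset.sum_le_sum fun η _ => hpt η).trans ?_
  rw [Finset.sum_add_distrib, Finset.sum_add_distrib, Finset.sum_const, nsmul_eq_mul, Int.card_Icc]
  have e1 := sum_abs_second_diff_le M h (Finset.Icc (-(M : ℤ) - 1) (M + 1))
  have e2 := sum_abs_second_diff_le M 0 (Finset.Icc (-(M : ℤ) - 1) (M + 1))
  have e3 : (((M : ℤ) + 1 + 1 - (-(M : ℤ) - 1)).toNat : ℝ) = 2 * M + 3 := by
    rw [show ((M : ℤ) + 1 + 1 - (-(M : ℤ) - 1)).toNat = 2 * M + 3 by omega]; push_cast; ring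
  rw [e3]
  have e4 : (2 * (M : ℝ) + 3) * (2 / M ^ 2) ≤ 10 / M := by
    rw [mul_div, div_le_div_iff₀ (by positivity) (by positivity)]; nlinarith
  have : (18 : ℝ) / M = 4 / M + 4 / M + 10 / M := by ring
  linarith

/-- The exponential sum of the shifted product weight. -/
noncomputable def pairSum (M : ℕ) (h : ℤ) (θ : ℝ) : ℂ :=
  ∑ η ∈ Finset.Icc (-(M : ℤ)) M, (pairWeight M h η : ℂ) * cis (η * θ)

lemma norm_pairSum_le {M : ℕ} (hM : 1 ≤ M) (h : ℤ) (θ : ℝ) : ‖pairSum M h θ‖ ≤ 3 * M := by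
  have hM' : (1 : ℝ) ≤ M := by exact_mod_cast hM
  refine (norm_sum_le _ _).trans ((Finset.sum_le_sum (g := fun _ => (1 : ℝ)) fun η _ => ?_).trans ?_)
  · rw [norm_mul, norm_cis, mul_one, Complex.norm_real, Real.norm_eq_abs, pairWeight,
      abs_of_nonneg (mul_nonneg (triWeight_nonneg _ _) (triWeight_nonneg _ _))]
    exact mul_le_one₀ (triWeight_le_one _ _) (triWeight_nonneg _ _) (triWeight_le_one _ _)
  · rw [Finset.sum_const, Int.card_Icc, nsmul_eq_mul, mul_one,
      show ((M : ℤ) + 1 - -(M : ℤ)).toNat = 2 * M + 1 by omega]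
    push_cast; linarith

lemma norm_pairSum_mul_le {M : ℕ} (hM : 1 ≤ M) (h : ℤ) (θ : ℝ) :
    |2 * cos θ - 2| * ‖pairSum M h θ‖ ≤ 18 / M := by
  set c : ℤ → ℂ := fun η => (pairWeight M h η : ℂ) * cis (η * θ) with hc
  have hc0 : ∀ η, η ∉ Finset.Icc (-(M : ℤ)) M → pairWeight M h η = 0 := fun η => pairWeight_eq_zero
  set J := Finset.Icc (-(M : ℤ) - 1) (M + 1) with hJ
  have s0 : pairSum M h θ = ∑' η, c η := by
    rw [pairSum, tsum_eq_sum]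
    intro η hη
    simp only [hc, hc0 η hη]; simp
  have s1 : pairSum M h θ = ∑ η ∈ J, c η := by
    rw [s0, tsum_eq_sum]
    intro η hη
    simp only [hc]
    rw [hc0 η (fun h => hη (by rw [hJ]; rw [Finset.mem_Icc] at *; omega))]; simp
  have s2 : pairSum M h θ = ∑ η ∈ J, c (η + 1) := by
    rw [s0, ← (Equiv.addRight (1 : ℤ)).tsum_eq, tsum_eq_sum]
    · rfl
    intro η hη
    simp only [hc, Equiv.coe_addRight]
    rw [hc0 (η + 1) (fun h => hη (by rw [hJ]; rw [Finset.mem_Icc] at *; omega))]; simp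
  have s3 : pairSum M h θ = ∑ η ∈ J, c (η - 1) := by
    rw [s0, ← (Equiv.subRight (1 : ℤ)).tsum_eq, tsum_eq_sum]
    · rfl
    intro η hη
    simp only [hc, Equiv.subRight_apply]
    rw [hc0 (η - 1) (fun h => hη (by rw [hJ]; rw [Finset.mem_Icc] at *; omega))]; simp
  have hcos : ((2 * cos θ - 2 : ℝ) : ℂ) = cis (-θ) + cis θ - 2 := by
    have : cis θ = Complex.cos θ + Complex.sin θ * Complex.I := by
      rw [cis, mul_comm, Complex.exp_mul_I]
    have h2 : cis (-θ) = Complex.cos θ - Complex.sin θ * Complex.I := by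
      rw [cis, mul_comm, Complex.exp_mul_I]; push_cast; rw [Complex.cos_neg, Complex.sin_neg]; ring
    rw [this, h2]; push_cast; ring
  have key : ((2 * cos θ - 2 : ℝ) : ℂ) * pairSum M h θ = ∑ η ∈ J,
      ((pairWeight M h (η + 1) + pairWeight M h (η - 1) - 2 * pairWeight M h η : ℝ) : ℂ) * cis (η * θ) := by
    have : ((2 * cos θ - 2 : ℝ) : ℂ) * pairSum M h θ
        = cis (-θ) * pairSum M h θ + cis θ * pairSum M h θ - 2 * pairSum M h θ := by
      rw [hcos]; ring
    rw [this]
    nth_rewrite 1 [s2]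
    nth_rewrite 1 [s3]
    rw [s1, Finset.mul_sum, Finset.mul_sum, Finset.mul_sum, ← Finset.sum_add_distrib,
      ← Finset.sum_sub_distrib]
    refine Finset.sum_congr rfl fun η _ => ?_
    have e1 : cis (-θ) * cis ((η + 1 : ℤ) * θ) = cis (η * θ) := by
      rw [← cis_add]; congr 1; push_cast; ring
    have e2 : cis θ * cis ((η - 1 : ℤ) * θ) = cis (η * θ) := by
      rw [← cis_add]; congr 1; push_cast; ring
    simp only [hc]
    rw [mul_left_comm, e1, mul_left_comm (cis θ), e2]
    push_cast; ring
  rw [← Real.norm_eq_abs, ← Complex.norm_real, ← norm_mul, key]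
  refine (norm_sum_le _ _).trans (le_trans (Finset.sum_le_sum fun η _ => ?_)
    (sum_abs_pairWeight_second_diff_le hM h))
  rw [norm_mul, norm_cis, mul_one, Complex.norm_real, Real.norm_eq_abs]

lemma intDist_neg (x : ℝ) : intDist (-x) = intDist x := by
  apply le_antisymm
  · have := round_le (-x) (-round x)
    unfold intDist
    refine this.trans (le_of_eq ?_)
    rw [← abs_neg]; push_cast; ring_nf
  · have := round_le x (-round (-x))
    unfold intDist
    refine this.trans (le_of_eq ?_)
    rw [← abs_neg]; push_cast; ring_nf

lemma sixteen_mul_intDist_sq_le (y : ℝ) : 16 * intDist y ^ 2 ≤ |2 * cos (2 * π * y) - 2| := by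
  set r := y - round y with hr
  have h1 : cos (2 * π * y) = cos (2 * π * r) := by
    rw [hr, show 2 * π * (y - round y) = 2 * π * y - (round y : ℤ) * (2 * π) by ring,
      Real.cos_sub_int_mul_two_pi]
  have h2 : 2 * |r| ≤ |sin (π * r)| := by
    have hr2 : |r| ≤ 1 / 2 := abs_sub_round y
    have h3 : |sin (π * r)| = sin (π * |r|) := by
      rcases le_total 0 r with h | h
      · rw [abs_of_nonneg h] at hr2 ⊢
        exact abs_of_nonneg (sin_nonneg_of_nonneg_of_le_pi (by positivity) (by nlinarith [pi_pos]))
      · rw [abs_of_nonpos h] at hr2 ⊢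
        rw [mul_neg, Real.sin_neg]
        refine abs_of_nonpos (Real.sin_nonpos_of_nonpos_of_neg_pi_le ?_ ?_)
        · nlinarith [pi_pos]
        · nlinarith [pi_pos]
    rw [h3]
    have := Real.mul_le_sin (x := π * |r|) (by positivity) (by nlinarith [pi_pos])
    calc 2 * |r| = 2 / π * (π * |r|) := by field_simp
      _ ≤ _ := this
  have h3 : |2 * cos (2 * π * r) - 2| = 4 * |sin (π * r)| ^ 2 := by
    rw [show 2 * π * r = 2 * (π * r) by ring, Real.cos_two_mul, sq_abs, Real.sin_sq]
    rw [abs_of_nonpos]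
    · ring
    · nlinarith [Real.cos_sq_le_one (π * r)]
  rw [h1, h3, intDist, ← hr]
  calc 16 * |r| ^ 2 = 4 * (2 * |r|) ^ 2 := by ring
    _ ≤ _ := by gcongr

lemma norm_pairSum_le_intDist {M : ℕ} (hM : 1 ≤ M) (h : ℤ) (y : ℝ) :
    ‖pairSum M h (2 * π * y)‖ ≤ 6 * M * (1 / (1 + M ^ 2 * intDist y ^ 2)) := by
  have hM' : (1 : ℝ) ≤ M := by exact_mod_cast hM
  have h1 := norm_pairSum_le hM h (2 * π * y)
  have h2 := norm_pairSum_mul_le hM h (2 * π * y)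
  have h3 := sixteen_mul_intDist_sq_le y
  set P := ‖pairSum M h (2 * π * y)‖
  have hP : 0 ≤ P := norm_nonneg _
  rw [mul_one_div, le_div_iff₀ (by positivity)]
  have h4 : 16 * intDist y ^ 2 * P ≤ 18 / M := (mul_le_mul_of_nonneg_right h3 hP).trans h2
  rw [le_div_iff₀ (by positivity)] at h4
  have h5 : (M : ℝ) * (intDist y ^ 2 * P * M) ≤ M * (18 / 16) :=
    mul_le_mul_of_nonneg_left (by linarith) (by positivity)
  nlinarith

/-- The one-dimensional weighted Weyl sum. -/
noncomputable def weylSum (M : ℕ) (τ z : ℝ) : ℂ :=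
  ∑ ξ ∈ Finset.Icc (-(M : ℤ)) M, (triWeight M ξ : ℂ) * cis (τ * ξ ^ 2 + z * ξ)

lemma norm_weylSum_sq_le_sum (M : ℕ) (τ z : ℝ) : ‖weylSum M τ z‖ ^ 2 ≤
    ∑ h ∈ Finset.Icc (-(2 * M : ℤ)) (2 * M), ‖pairSum M h (2 * τ * h)‖ := by
  set I := Finset.Icc (-(M : ℤ)) M with hI
  set J := Finset.Icc (-(2 * M : ℤ)) (2 * M) with hJ
  set c : ℤ → ℂ := fun ξ => (triWeight M ξ : ℂ) * cis (τ * ξ ^ 2 + z * ξ) with hc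
  have hc0 : ∀ ξ, ξ ∉ I → c ξ = 0 := fun ξ hξ => by
    simp only [hc]; rw [triWeight_eq_zero hξ]; simp
  have shift : ∀ η ∈ I, weylSum M τ z = ∑ h ∈ J, c (η + h) := by
    intro η hη
    have : weylSum M τ z = ∑' ξ, c ξ := by
      rw [weylSum, tsum_eq_sum (s := I)]
      exact hc0
    rw [this, ← (Equiv.addLeft η).tsum_eq, tsum_eq_sum]
    · rfl
    intro h hh
    refine hc0 _ fun h' => hh ?_
    simp only [Equiv.coe_addLeft] at h'
    rw [hI, Finset.mem_Icc] at h' hη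
    rw [hJ, Finset.mem_Icc]
    constructor <;> linarith
  have key : weylSum M τ z * (starRingEnd ℂ) (weylSum M τ z)
      = ∑ h ∈ J, cis (τ * h ^ 2 + z * h) * pairSum M h (2 * τ * h) := by
    nth_rewrite 2 [weylSum]
    rw [map_sum, Finset.mul_sum]
    rw [Finset.sum_congr rfl fun η hη => by rw [shift η hη, Finset.sum_mul]]
    rw [Finset.sum_comm]
    refine Finset.sum_congr rfl fun h _ => ?_
    rw [pairSum, Finset.mul_sum]
    refine Finset.sum_congr rfl fun η _ => ?_
    simp only [hc, map_mul, conj_cis, Complex.conj_ofReal, pairWeight]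
    have : cis (τ * ((η + h : ℤ) : ℝ) ^ 2 + z * ((η + h : ℤ) : ℝ)) * cis (-(τ * (η : ℝ) ^ 2 + z * η))
        = cis (τ * h ^ 2 + z * h) * cis (η * (2 * τ * h)) := by
      rw [← cis_add, ← cis_add]; congr 1; push_cast; ring
    push_cast
    calc _ = (triWeight M (η + h) : ℂ) * triWeight M η *
          (cis (τ * ((η + h : ℤ) : ℝ) ^ 2 + z * ((η + h : ℤ) : ℝ)) * cis (-(τ * (η : ℝ) ^ 2 + z * η))) := by
            push_cast; ring
      _ = _ := by rw [this]; ring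
  calc ‖weylSum M τ z‖ ^ 2 = ‖weylSum M τ z * (starRingEnd ℂ) (weylSum M τ z)‖ := by
        rw [norm_mul, RCLike.norm_conj, sq]
    _ ≤ _ := by
        rw [key]
        refine (norm_sum_le _ _).trans (Finset.sum_le_sum fun h _ => ?_)
        rw [norm_mul, norm_cis, one_mul]

lemma norm_weylSum_sq_le {M : ℕ} (hM : 1 ≤ M) (τ z : ℝ) :
    ‖weylSum M τ z‖ ^ 2 ≤ weylMajorant M τ := by
  classical
  refine (norm_weylSum_sq_le_sum M τ z).trans ?_
  set f : ℕ → ℝ := fun k => 1 / (1 + M ^ 2 * intDist (k * (τ / (2 * π))) ^ 2) with hf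
  have hf0 : ∀ k, 0 ≤ f k := fun k => by simp only [hf]; positivity
  have h1 : ∀ h ∈ Finset.Icc (-(2 * M : ℤ)) (2 * M),
      ‖pairSum M h (2 * τ * h)‖ ≤ 6 * M * f (2 * h.natAbs) := by
    intro h _
    have e : 2 * τ * h = 2 * π * (2 * h * (τ / (2 * π))) := by field_simp
    rw [e]
    refine (norm_pairSum_le_intDist hM h _).trans (le_of_eq ?_)
    simp only [hf]
    congr 4
    push_cast
    rcases abs_choice (h : ℝ) with hh | hh
    · rw [Nat.cast_natAbs, Int.cast_abs, hh]
    · rw [Nat.cast_natAbs, Int.cast_abs, hh, ← intDist_neg]; congr 1; ring_nf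
  refine (Finset.sum_le_sum h1).trans ?_
  rw [← Finset.mul_sum, weylMajorant]
  have h2 : ∑ h ∈ Finset.Icc (-(2 * M : ℤ)) (2 * M), f (2 * h.natAbs)
      ≤ 2 * ∑ k ∈ Finset.range (4 * M + 1), f k := by
    have hmap : ∀ h ∈ Finset.Icc (-(2 * M : ℤ)) (2 * M), 2 * h.natAbs ∈ Finset.range (4 * M + 1) := by
      intro h hh; rw [Finset.mem_Icc] at hh; rw [Finset.mem_range]; omega
    rw [← Finset.sum_fiberwise_of_maps_to hmap, Finset.mul_sum]
    refine Finset.sum_le_sum fun k _ => ?_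
    rw [Finset.sum_congr rfl (g := fun _ => f k) fun h hh => by rw [(Finset.mem_filter.1 hh).2],
      Finset.sum_const, nsmul_eq_mul]
    refine mul_le_mul_of_nonneg_right ?_ (hf0 k)
    have : (Finset.Icc (-(2 * M : ℤ)) (2 * M)).filter (fun h => 2 * h.natAbs = k)
        ⊆ {((k / 2 : ℕ) : ℤ), -((k / 2 : ℕ) : ℤ)} := by
      intro h hh
      have := (Finset.mem_filter.1 hh).2
      rw [Finset.mem_insert, Finset.mem_singleton]
      omega
    exact_mod_cast (Finset.card_le_card this).trans Finset.card_le_two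
  calc 6 * M * ∑ h ∈ Finset.Icc (-(2 * M : ℤ)) (2 * M), f (2 * h.natAbs)
      ≤ 6 * M * (2 * ∑ k ∈ Finset.range (4 * M + 1), f k) := by gcongr
    _ = _ := by ring

lemma sum_one_div_one_add_sq_le {c : ℝ} (hc : 0 ≤ c) (L : ℕ) :
    ∑ l ∈ Finset.range (L + 1), 1 / (1 + (c * l) ^ 2) ≤ 1 + 2 * (L / (1 + c * L)) := by
  induction L with
  | zero => simp
  | succ L ih =>
    rw [Finset.sum_range_succ]
    have h1 : 1 / (1 + (c * ((L + 1 : ℕ) : ℝ)) ^ 2) ≤ 2 * (1 / ((1 + c * L) * (1 + c * (L + 1)))) := by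
      rw [mul_one_div, div_le_div_iff₀ (by positivity) (by positivity)]
      push_cast
      have : 0 ≤ c * L := by positivity
      nlinarith [sq_nonneg (c * (L + 1) - 1)]
    have h2 : (L : ℝ) / (1 + c * L) + 1 / ((1 + c * L) * (1 + c * (L + 1)))
        = (L + 1) / (1 + c * (L + 1)) := by
      have : 1 + c * L ≠ 0 := by positivity
      have : 1 + c * (L + 1) ≠ 0 := by positivity
      field_simp; ring
    push_cast at *
    rw [← h2]
    linarith

lemma sum_residue_le (q : ℕ) :
    ∑ r ∈ Finset.Ioo 0 q, (((r : ℝ) ^ 2)⁻¹ + (((q : ℝ) - r) ^ 2)⁻¹) ≤ 4 := by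
  rw [Finset.sum_add_distrib]
  have h1 := sum_Ioo_inv_sq_le (α := ℝ) 0 q
  have h2 : ∑ r ∈ Finset.Ioo 0 q, (((q : ℝ) - r) ^ 2)⁻¹ = ∑ r ∈ Finset.Ioo 0 q, ((r : ℝ) ^ 2)⁻¹ := by
    refine Finset.sum_nbij' (fun r => q - r) (fun r => q - r) ?_ ?_ ?_ ?_ ?_
    · intro r hr; rw [Finset.mem_Ioo] at *; omega
    · intro r hr; rw [Finset.mem_Ioo] at *; omega
    · intro r hr; rw [Finset.mem_Ioo] at *; omega
    · intro r hr; rw [Finset.mem_Ioo] at *; omega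
    · intro r hr; rw [Finset.mem_Ioo] at *; rw [Nat.cast_sub (by omega)]
  rw [h2]
  norm_num at h1 ⊢
  linarith

section
variable {M q : ℕ} {a : ℤ} {β : ℝ}

lemma le_intDist_of_dvd (hM : 1 ≤ M) (hq : 1 ≤ q) (hβ : |β| ≤ 1 / (8 * M * q)) {k : ℕ}
    (hk : k ≤ 4 * M) (hd : q ∣ k) : k * |β| ≤ intDist (k * (a / q + β)) := by
  obtain ⟨l, rfl⟩ := hd
  have hM' : (0 : ℝ) < M := by exact_mod_cast hM
  have hq' : (0 : ℝ) < q := by exact_mod_cast hq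
  have hq1 : (1 : ℝ) ≤ q := by exact_mod_cast hq
  have hk' : ((q * l : ℕ) : ℝ) ≤ 4 * M := by exact_mod_cast hk
  have hsm : ((q * l : ℕ) : ℝ) * |β| ≤ 1 / 2 := by
    calc ((q * l : ℕ) : ℝ) * |β| ≤ (4 * M) * (1 / (8 * M * q)) := by gcongr
      _ = 1 / (2 * q) := by field_simp; norm_num
      _ ≤ 1 / 2 := by gcongr; linarith
  set m := round (((q * l : ℕ) : ℝ) * (a / q + β)) with hm
  have e : ((q * l : ℕ) : ℝ) * (a / q + β) - m = ((q * l : ℕ) : ℝ) * β + ((l * a - m : ℤ) : ℝ) := by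
    push_cast; field_simp; ring
  rw [intDist, ← hm, e]
  have e2 : ((q * l : ℕ) : ℝ) * |β| = |((q * l : ℕ) : ℝ) * β| := by rw [abs_mul, Nat.abs_cast]
  rw [e2] at hsm ⊢
  by_cases h : (l : ℤ) * a - m = 0
  · rw [h]; simp
  · have h1 : (1 : ℝ) ≤ |((l * a - m : ℤ) : ℝ)| := by exact_mod_cast Int.one_le_abs h
    have h2 := abs_sub_abs_le_abs_sub ((l * a - m : ℤ) : ℝ) (-(((q * l : ℕ) : ℝ) * β))
    rw [abs_neg, sub_neg_eq_add, add_comm] at h2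
    linarith

/-- The residue of `k a` modulo `q`. -/
def residue (a : ℤ) (q k : ℕ) : ℕ := (((k : ℤ) * a) % q).toNat

lemma residue_mem (hq : 1 ≤ q) (hc : IsCoprime a q) {k : ℕ} (hd : ¬ q ∣ k) :
    residue a q k ∈ Finset.Ioo 0 q := by
  have h1 := Int.emod_nonneg ((k : ℤ) * a) (show (q : ℤ) ≠ 0 by omega)
  have h2 := Int.emod_lt_of_pos ((k : ℤ) * a) (show 0 < (q : ℤ) by omega)
  have h3 : ((k : ℤ) * a) % q ≠ 0 := by
    intro h
    have := Int.dvd_of_emod_eq_zero h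
    exact hd (by exact_mod_cast hc.symm.dvd_of_dvd_mul_right this)
  rw [Finset.mem_Ioo, residue]
  omega

lemma inv_intDist_le (hM : 1 ≤ M) (hq : 1 ≤ q) (hc : IsCoprime a q) (hβ : |β| ≤ 1 / (8 * M * q))
    {k : ℕ} (hk : k ≤ 4 * M) (hd : ¬ q ∣ k) :
    1 / (1 + M ^ 2 * intDist (k * (a / q + β)) ^ 2) ≤ 4 * q ^ 2 / M ^ 2 *
      (((residue a q k : ℝ) ^ 2)⁻¹ + (((q : ℝ) - residue a q k) ^ 2)⁻¹) := by
  have hM' : (0 : ℝ) < M := by exact_mod_cast hM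
  have hq' : (0 : ℝ) < q := by exact_mod_cast hq
  have hr := Finset.mem_Ioo.1 (residue_mem hq hc hd)
  have hmod : (k : ℤ) * a = residue a q k + q * ((k : ℤ) * a / q) := by
    have h1 := Int.emod_nonneg ((k : ℤ) * a) (show (q : ℤ) ≠ 0 by omega)
    have h2 := Int.emod_add_mul_ediv ((k : ℤ) * a) q
    rw [residue, Int.toNat_of_nonneg h1, h2]
  set r := residue a q k
  set d := (k : ℤ) * a / q
  set m := round ((k : ℝ) * (a / q + β)) with hm
  have hrq : (r : ℝ) < q := by exact_mod_cast hr.2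
  have hr0 : (0 : ℝ) < r := by exact_mod_cast hr.1
  have hk' : (k : ℝ) ≤ 4 * M := by exact_mod_cast hk
  have hsm : (k : ℝ) * |β| ≤ 1 / (2 * q) := by
    calc (k : ℝ) * |β| ≤ (4 * M) * (1 / (8 * M * q)) := by gcongr
      _ = 1 / (2 * q) := by field_simp; norm_num
  have e : (k : ℝ) * (a / q + β) - m = ((r + q * (d - m) : ℤ) : ℝ) / q + k * β := by
    have : (k : ℝ) * a = r + q * d := by exact_mod_cast hmod
    rw [mul_add, ← mul_div_assoc, this]
    push_cast; field_simp; ring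
  have key : ∀ s : ℕ, 1 ≤ s → (s : ℤ) ≤ |(r + q * (d - m) : ℤ)| →
      (s : ℝ) / (2 * q) ≤ intDist (k * (a / q + β)) := by
    intro s hs1 hs
    have hs' : (s : ℝ) ≤ |((r + q * (d - m) : ℤ) : ℝ)| := by exact_mod_cast hs
    have hs1' : (1 : ℝ) ≤ s := by exact_mod_cast hs1
    rw [intDist, ← hm, e]
    have h2 := abs_sub_abs_le_abs_sub (((r + q * (d - m) : ℤ) : ℝ) / q) (-((k : ℝ) * β))
    rw [abs_neg, sub_neg_eq_add, abs_div, Nat.abs_cast, abs_mul, Nat.abs_cast] at h2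
    have h3 : (s : ℝ) / q ≤ |((r + q * (d - m) : ℤ) : ℝ)| / q := by gcongr
    have h4 : (s : ℝ) / (2 * q) + 1 / (2 * q) ≤ s / q := by
      rw [← add_div, div_le_div_iff₀ (by positivity) hq']; nlinarith
    linarith
  have fin : ∀ x : ℝ, 0 < x → x / (2 * q) ≤ intDist (k * (a / q + β)) →
      1 / (1 + M ^ 2 * intDist (k * (a / q + β)) ^ 2) ≤ 4 * q ^ 2 / M ^ 2 * (x ^ 2)⁻¹ := by
    intro x hx h
    calc 1 / (1 + M ^ 2 * intDist (k * (a / q + β)) ^ 2) ≤ 1 / (M ^ 2 * (x / (2 * q)) ^ 2) := by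
          have : 0 < (M : ℝ) ^ 2 * (x / (2 * q)) ^ 2 := by positivity
          apply one_div_le_one_div_of_le this
          have : (M : ℝ) ^ 2 * (x / (2 * q)) ^ 2 ≤ M ^ 2 * intDist (k * (a / q + β)) ^ 2 := by gcongr
          linarith
      _ = _ := by field_simp; norm_num
  have hcase : ((r : ℤ) ≤ |(r + q * (d - m) : ℤ)|) ∨ ((q - r : ℕ) : ℤ) ≤ |(r + q * (d - m) : ℤ)| := by
    rcases le_or_gt 0 (d - m) with h | h
    · left
      have : 0 ≤ (q : ℤ) * (d - m) := by positivity
      exact le_trans (by linarith) (le_abs_self _)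
    · right
      have : (q : ℤ) * (d - m) ≤ q * (-1) := by
        apply mul_le_mul_of_nonneg_left _ (by positivity); omega
      refine le_trans ?_ (neg_le_abs _)
      rw [Nat.cast_sub hr.2.le]; linarith
  have p1 : 0 ≤ (((r : ℝ)) ^ 2)⁻¹ := by positivity
  have p2 : 0 ≤ ((((q : ℝ) - r)) ^ 2)⁻¹ := by positivity
  rcases hcase with h | h
  · refine (fin r hr0 (key r hr.1 h)).trans ?_
    gcongr; linarith
  · have := key (q - r) (by omega) h
    rw [Nat.cast_sub hr.2.le] at this
    refine (fin (q - r) (by linarith) this).trans ?_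
    gcongr; linarith

lemma card_residue_le (hq : 1 ≤ q) (hc : IsCoprime a q) (r : ℕ) :
    ((Finset.range (4 * M + 1)).filter (fun k => residue a q k = r)).card ≤ 4 * M / q + 1 := by
  rw [← Finset.card_range (4 * M / q + 1)]
  refine Finset.card_le_card_of_injOn (fun k => k / q) ?_ ?_
  · intro k hk
    have := Finset.mem_range.1 (Finset.mem_filter.1 hk).1
    rw [Finset.coe_range, Set.mem_Iio, Nat.lt_succ_iff]
    exact Nat.div_le_div_right (by omega)
  · intro k hk l hl hkl
    have h1 := (Finset.mem_filter.1 hk).2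
    have h2 := (Finset.mem_filter.1 hl).2
    rw [← h2, residue, residue] at h1
    have n1 := Int.emod_nonneg ((k : ℤ) * a) (show (q : ℤ) ≠ 0 by omega)
    have n2 := Int.emod_nonneg ((l : ℤ) * a) (show (q : ℤ) ≠ 0 by omega)
    have h3 : ((k : ℤ) * a) % q = ((l : ℤ) * a) % q := by omega
    have h4 := Int.emod_emod_of_dvd ((k : ℤ) * a) (dvd_refl (q : ℤ))
    have h5 : (q : ℤ) ∣ ((k : ℤ) - l) * a := by
      rw [sub_mul]; exact Int.ModEq.dvd (n := q) h3.symm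
    have h6 : (q : ℤ) ∣ (k : ℤ) - l := hc.symm.dvd_of_dvd_mul_right h5
    have h7 : k % q = l % q := (Nat.modEq_iff_dvd.2 (by exact_mod_cast h6)).symm
    simp only at hkl
    rw [← Nat.div_add_mod k q, ← Nat.div_add_mod l q, hkl, h7]

/-- The major arc estimate for the Weyl majorant. -/
lemma weylMajorant_le (hM : 1 ≤ M) (hq : 1 ≤ q) (hqM : q ≤ 8 * M) (hc : IsCoprime a q)
    (hβ : |β| ≤ 1 / (8 * M * q)) {τ : ℝ} (hτ : τ / (2 * π) = a / q + β) :
    weylMajorant M τ ≤ 150000 * M ^ 2 / (q * (1 + M ^ 2 * |β|)) := by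
  classical
  have hM' : (1 : ℝ) ≤ M := by exact_mod_cast hM
  have hM0 : (0 : ℝ) < M := by linarith
  have hq' : (1 : ℝ) ≤ q := by exact_mod_cast hq
  have hq0 : (0 : ℝ) < q := by linarith
  have hqM' : (q : ℝ) ≤ 8 * M := by exact_mod_cast hqM
  rw [weylMajorant, hτ]
  set f : ℕ → ℝ := fun k => 1 / (1 + M ^ 2 * intDist (k * (a / q + β)) ^ 2) with hf
  set L := 4 * M / q with hL
  have hLr : (L : ℝ) ≤ 4 * M / q := by rw [hL]; exact_mod_cast Nat.cast_div_le (α := ℝ) (m := 4 * M) (n := q)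
  rw [← Finset.sum_filter_add_sum_filter_not _ (fun k => q ∣ k)]
  have hA : ∑ k ∈ (Finset.range (4 * M + 1)).filter (fun k => q ∣ k), f k
      ≤ 1 + 2 * (L / (1 + (M * q * |β|) * L)) := by
    refine le_trans ?_ (sum_one_div_one_add_sq_le (c := M * q * |β|) (by positivity) L)
    set g : ℕ → ℝ := fun l => 1 / (1 + (M * q * |β| * l) ^ 2) with hg
    calc ∑ k ∈ (Finset.range (4 * M + 1)).filter (fun k => q ∣ k), f k
        ≤ ∑ k ∈ (Finset.range (4 * M + 1)).filter (fun k => q ∣ k), g (k / q) := by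
          refine Finset.sum_le_sum fun k hk => ?_
          rw [Finset.mem_filter, Finset.mem_range] at hk
          have := le_intDist_of_dvd (a := a) hM hq hβ (by omega) hk.2
          have e : ((k / q : ℕ) : ℝ) = k / q := Nat.cast_div hk.2 hq0.ne'
          simp only [hf, hg, e]
          have e2 : M * q * |β| * (k / q) = M * (k * |β|) := by field_simp
          rw [e2, mul_pow]
          gcongr
      _ = ∑ l ∈ ((Finset.range (4 * M + 1)).filter (fun k => q ∣ k)).image (fun k => k / q), g l := by
          rw [Finset.sum_image]
          intro k hk l hl hkl
          have h1 := (Finset.mem_filter.1 hk).2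
          have h2 := (Finset.mem_filter.1 hl).2
          simp only at hkl
          rw [← Nat.div_mul_cancel h1, ← Nat.div_mul_cancel h2, hkl]
      _ ≤ _ := by
          refine Finset.sum_le_sum_of_subset_of_nonneg ?_ fun _ _ _ => by positivity
          intro l hl
          obtain ⟨k, hk, rfl⟩ := Finset.mem_image.1 hl
          have := Finset.mem_range.1 (Finset.mem_filter.1 hk).1
          rw [Finset.mem_range, Nat.lt_succ_iff]
          exact Nat.div_le_div_right (by omega)
  have hB : ∑ k ∈ (Finset.range (4 * M + 1)).filter (fun k => ¬ q ∣ k), f k ≤ 192 * q / M := by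
    set g : ℕ → ℝ := fun r => (((r : ℝ) ^ 2)⁻¹ + (((q : ℝ) - r) ^ 2)⁻¹) with hg
    have hg0 : ∀ r, 0 ≤ g r := fun r => by simp only [hg]; positivity
    calc ∑ k ∈ (Finset.range (4 * M + 1)).filter (fun k => ¬ q ∣ k), f k
        ≤ ∑ k ∈ (Finset.range (4 * M + 1)).filter (fun k => ¬ q ∣ k),
            4 * q ^ 2 / M ^ 2 * g (residue a q k) := by
          refine Finset.sum_le_sum fun k hk => ?_
          rw [Finset.mem_filter, Finset.mem_range] at hk
          exact inv_intDist_le hM hq hc hβ (by omega) hk.2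
      _ = 4 * q ^ 2 / M ^ 2 * ∑ r ∈ Finset.Ioo 0 q,
            ∑ k ∈ (Finset.range (4 * M + 1)).filter (fun k => ¬ q ∣ k) with residue a q k = r, g r := by
          rw [← Finset.mul_sum, ← Finset.sum_fiberwise_of_maps_to (g := residue a q) (t := Finset.Ioo 0 q)]
          · congr 1
            refine Finset.sum_congr rfl fun r _ => Finset.sum_congr rfl fun k hk => ?_
            rw [(Finset.mem_filter.1 hk).2]
          · intro k hk; exact residue_mem hq hc (Finset.mem_filter.1 hk).2
      _ ≤ 4 * q ^ 2 / M ^ 2 * ∑ r ∈ Finset.Ioo 0 q, (12 * M / q) * g r := by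
          gcongr with r _
          rw [Finset.sum_const, nsmul_eq_mul]
          refine mul_le_mul_of_nonneg_right ?_ (hg0 r)
          have h1 : (((Finset.range (4 * M + 1)).filter (fun k => ¬ q ∣ k)).filter
              (fun k => residue a q k = r)).card ≤ L + 1 :=
            (Finset.card_le_card (Finset.filter_subset_filter _ (Finset.filter_subset _ _))).trans
              (card_residue_le hq hc r)
          have h2 : ((L + 1 : ℕ) : ℝ) ≤ 12 * M / q := by
            push_cast
            have : 1 ≤ 8 * M / (q : ℝ) := by rw [le_div_iff₀ hq0]; linarith
            have e : 12 * (M : ℝ) / q = 4 * M / q + 8 * M / q := by ring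
            linarith
          exact le_trans (by exact_mod_cast h1) h2
      _ ≤ 4 * q ^ 2 / M ^ 2 * ((12 * M / q) * 4) := by
          rw [← Finset.mul_sum]; gcongr; exact sum_residue_le q
      _ = _ := by field_simp; norm_num
  set b := |β| with hb
  have hb0 : 0 ≤ b := abs_nonneg _
  rw [le_div_iff₀ (by positivity)] at hβ
  rw [le_div_iff₀ (by positivity)]
  have hMb : q * (M ^ 2 * b) ≤ M / 8 := by nlinarith
  have hD : q * (1 + M ^ 2 * b) ≤ 9 * M := by nlinarith
  have t1 : 192 * q / M * (q * (1 + M ^ 2 * b)) ≤ 12480 * M := by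
    rw [div_mul_eq_mul_div, div_le_iff₀ hM0]
    have : q * (q * (1 + (M : ℝ) ^ 2 * b)) ≤ 65 * (M * M) := by
      have : q * (q * (M ^ 2 * b)) ≤ (8 * M) * (M / 8) := by gcongr
      nlinarith
    nlinarith
  have t2 : 2 * ((L : ℝ) / (1 + (M * q * b) * L)) * (q * (1 + M ^ 2 * b)) ≤ 8 * (M : ℝ) := by
    have h1 : (L : ℝ) / (1 + (M * q * b) * L) ≤ (4 * M / q) / (1 + (M * q * b) * (4 * M / q)) := by
      rw [div_le_div_iff₀ (by positivity) (by positivity)]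
      nlinarith
    have h2 : (4 * M / q : ℝ) / (1 + (M * q * b) * (4 * M / q)) = 4 * M / (q * (1 + 4 * (M ^ 2 * b))) := by
      field_simp
    rw [h2] at h1
    calc 2 * ((L : ℝ) / (1 + (M * q * b) * L)) * (q * (1 + M ^ 2 * b))
        ≤ 2 * (4 * (M : ℝ) / (q * (1 + 4 * (M ^ 2 * b)))) * (q * (1 + 4 * (M ^ 2 * b))) := by
          have : (q : ℝ) * (1 + M ^ 2 * b) ≤ q * (1 + 4 * (M ^ 2 * b)) := by
            have : 0 ≤ (M : ℝ) ^ 2 * b := by positivity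
            exact mul_le_mul_of_nonneg_left (by linarith) hq0.le
          exact mul_le_mul (by linarith) this (by positivity) (by positivity)
      _ = 8 * (M : ℝ) := by field_simp; norm_num
  calc 12 * M * (∑ k ∈ (Finset.range (4 * M + 1)).filter (fun k => q ∣ k), f k
        + ∑ k ∈ (Finset.range (4 * M + 1)).filter (fun k => ¬ q ∣ k), f k) * (q * (1 + M ^ 2 * b))
      ≤ 12 * M * ((1 + 2 * (L / (1 + (M * q * b) * L))) + 192 * q / M) * (q * (1 + M ^ 2 * b)) := by
        gcongr
    _ = 12 * M * (q * (1 + M ^ 2 * b) + 2 * (L / (1 + (M * q * b) * L)) * (q * (1 + M ^ 2 * b))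
        + 192 * q / M * (q * (1 + M ^ 2 * b))) := by ring
    _ ≤ 12 * M * (9 * M + 8 * M + 12480 * M) := by gcongr
    _ ≤ _ := by nlinarith

end

lemma measurable_intDist : Measurable intDist := by
  unfold intDist
  simp only [round_eq]
  fun_prop

lemma measurable_weylMajorant (M : ℕ) : Measurable (weylMajorant M) := by
  unfold weylMajorant
  have := measurable_intDist
  refine Measurable.const_mul (Finset.measurable_sum _ fun k _ => ?_) _
  exact measurable_const.div (measurable_const.add
    (measurable_const.mul ((this.comp (by fun_prop)).pow_const 2)))

lemma weylMajorant_nonneg (M : ℕ) (τ : ℝ) : 0 ≤ weylMajorant M τ := by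
  unfold weylMajorant; positivity

lemma weylMajorant_le_sq (M : ℕ) (τ : ℝ) : weylMajorant M τ ≤ 12 * M * (4 * M + 1) := by
  unfold weylMajorant
  refine mul_le_mul_of_nonneg_left ?_ (by positivity)
  refine (Finset.sum_le_sum (g := fun _ => (1 : ℝ)) fun k _ => ?_).trans (by simp)
  rw [div_le_one (by positivity)]
  nlinarith [sq_nonneg ((M : ℝ) * intDist (k * (τ / (2 * π))))]

/-- Weyl bound on `[-2π, 2π]` in terms of a Dirichlet approximation. -/
lemma exists_weylMajorant_le {M : ℕ} (hM : 1 ≤ M) {τ : ℝ} (hτ : |τ| ≤ 2 * π) :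
    ∃ (q : ℕ) (a : ℤ), 1 ≤ q ∧ |a| ≤ q ∧
      weylMajorant M τ ≤ 150000 * M ^ 2 / (q * (1 + M ^ 2 * |τ / (2 * π) - a / q|)) := by
  have hM' : (1 : ℝ) ≤ M := by exact_mod_cast hM
  obtain ⟨r, h1, h2⟩ := Real.exists_rat_abs_sub_le_and_den_le (τ / (2 * π)) (n := 8 * M) (by omega)
  have hq : 1 ≤ r.den := r.pos
  have hq' : (1 : ℝ) ≤ r.den := by exact_mod_cast hq
  have hr : (r : ℝ) = r.num / r.den := by exact_mod_cast (Rat.num_div_den r).symm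
  rw [hr] at h1
  have h3 : |τ / (2 * π) - r.num / r.den| ≤ 1 / (8 * M * r.den) := by
    refine h1.trans ?_
    push_cast
    gcongr
    linarith
  refine ⟨r.den, r.num, hq, ?_, ?_⟩
  · have h4 : |τ / (2 * π)| ≤ 1 := by
      rw [abs_div, abs_of_pos (by positivity : (0 : ℝ) < 2 * π)]
      rw [div_le_one (by positivity)]; exact hτ
    have h5 : |(r.num : ℝ) / r.den| ≤ 1 + 1 / (8 * M * r.den) := by
      calc |(r.num : ℝ) / r.den| = |τ / (2 * π) - (τ / (2 * π) - r.num / r.den)| := by congr 1; ring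
        _ ≤ _ := (abs_sub _ _).trans (add_le_add h4 h3)
    rw [abs_div, abs_of_pos (by linarith : (0 : ℝ) < r.den), div_le_iff₀ (by linarith)] at h5
    have h6 : (1 + 1 / (8 * M * r.den)) * (r.den : ℝ) = r.den + 1 / (8 * M) := by field_simp
    have h7 : 1 / (8 * (M : ℝ)) < 1 := by rw [div_lt_one (by positivity)]; linarith
    have h8 : |(r.num : ℝ)| < r.den + 1 := by linarith
    have h9 : |r.num| < (r.den : ℤ) + 1 := by exact_mod_cast h8
    omega
  · exact weylMajorant_le hM hq h2 (Int.isCoprime_iff_nat_coprime.2 r.reduced) h3 (by ring)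

lemma volume_weylMajorant_gt_le {M : ℕ} (hM : 1 ≤ M) {y : ℝ} (hy : 0 < y) {t : ℝ}
    (ht : t ∈ Set.Icc 0 (2 * π)) :
    timeMeas.real {s | y < weylMajorant M (t - s)} ≤ 2000000000000 * M ^ 2 / y ^ 2 := by
  have hM' : (1 : ℝ) ≤ M := by exact_mod_cast hM
  set Z : ℝ := 150000 * M ^ 2 / y with hZ
  have hZ0 : 0 < Z := by positivity
  have hsub : {s | y < weylMajorant M (t - s)} ∩ Set.Icc 0 (2 * π) ⊆
      ⋃ q ∈ Finset.Icc 1 ⌊Z⌋₊, ⋃ a ∈ Finset.Icc (-(q : ℤ)) q,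
        Metric.closedBall (t - 2 * π * (a / q)) (2 * π * (Z / (q * M ^ 2))) := by
    rintro s ⟨hs, hs'⟩
    obtain ⟨q, a, hq, ha, hW⟩ := exists_weylMajorant_le hM (τ := t - s)
      (abs_le.2 ⟨by linarith [ht.1, hs'.2], by linarith [ht.2, hs'.1]⟩)
    have hq' : (1 : ℝ) ≤ q := by exact_mod_cast hq
    set b := |(t - s) / (2 * π) - a / q| with hb
    have hb0 : 0 ≤ b := abs_nonneg _
    have h1 : (q : ℝ) * (1 + M ^ 2 * b) ≤ Z := by
      have := (show y < _ from hs).trans_le hW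
      rw [lt_div_iff₀ (by positivity)] at this
      rw [hZ, le_div_iff₀ hy]; linarith
    have h2 : (q : ℝ) ≤ Z := by
      have : 0 ≤ (q : ℝ) * (M ^ 2 * b) := by positivity
      linarith
    have h3 : b ≤ Z / (q * M ^ 2) := by
      rw [le_div_iff₀ (by positivity)]; linarith
    simp only [Set.mem_iUnion]
    refine ⟨q, Finset.mem_Icc.2 ⟨hq, Nat.le_floor h2⟩, a, Finset.mem_Icc.2 (abs_le.1 ha), ?_⟩
    rw [Metric.mem_closedBall, Real.dist_eq]
    have : s - (t - 2 * π * (a / q)) = -(2 * π * ((t - s) / (2 * π) - a / q)) := by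
      field_simp; ring
    rw [this, abs_neg, abs_mul, abs_of_pos (by positivity : (0 : ℝ) < 2 * π), ← hb]
    gcongr
  have h1 : timeMeas.real {s | y < weylMajorant M (t - s)} =
      volume.real ({s | y < weylMajorant M (t - s)} ∩ Set.Icc 0 (2 * π)) := by
    rw [measureReal_restrict_apply]
    exact measurableSet_lt measurable_const ((measurable_weylMajorant M).comp (by fun_prop))
  rw [h1]
  have hfin : ∀ q : ℕ, volume (⋃ a ∈ Finset.Icc (-(q : ℤ)) q,
        Metric.closedBall (t - 2 * π * (a / q)) (2 * π * (Z / (q * M ^ 2)))) ≠ ⊤ := fun q =>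
    ((measure_biUnion_finset_le _ _).trans_lt
      (ENNReal.sum_lt_top.2 fun a _ => measure_closedBall_lt_top)).ne
  refine (measureReal_mono hsub ((measure_biUnion_finset_le _ _).trans_lt
    (ENNReal.sum_lt_top.2 fun q _ => (hfin q).lt_top)).ne).trans ?_
  refine (measureReal_biUnion_finset_le _ _).trans ?_
  have h2 : ∀ q ∈ Finset.Icc 1 ⌊Z⌋₊, volume.real (⋃ a ∈ Finset.Icc (-(q : ℤ)) q,
        Metric.closedBall (t - 2 * π * (a / q)) (2 * π * (Z / (q * M ^ 2)))) ≤ 48 * Z / M ^ 2 := by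
    intro q hq
    have hq' : (1 : ℝ) ≤ q := by exact_mod_cast (Finset.mem_Icc.1 hq).1
    refine (measureReal_biUnion_finset_le _ _).trans ?_
    have : ∀ a : ℤ, volume.real (Metric.closedBall (t - 2 * π * ((a : ℝ) / q))
        (2 * π * (Z / (q * M ^ 2)))) = 2 * (2 * π * (Z / (q * M ^ 2))) := by
      intro a
      rw [measureReal_def, Real.volume_closedBall, ENNReal.toReal_ofReal (by positivity)]
    simp only [this, Finset.sum_const, Int.card_Icc, nsmul_eq_mul]
    have hc : (((q : ℤ) + 1 - -(q : ℤ)).toNat : ℝ) ≤ 3 * q := by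
      have : ((q : ℤ) + 1 - -(q : ℤ)).toNat = 2 * q + 1 := by omega
      rw [this]; push_cast; linarith
    calc _ ≤ (3 * q : ℝ) * (2 * (2 * π * (Z / (q * M ^ 2)))) := by gcongr
      _ = 12 * π * Z / M ^ 2 := by field_simp; norm_num
      _ ≤ 48 * Z / M ^ 2 := by
        gcongr; linarith [Real.pi_le_four]
  refine (Finset.sum_le_sum h2).trans ?_
  rw [Finset.sum_const, nsmul_eq_mul, Nat.card_Icc, Nat.add_sub_cancel]
  calc (⌊Z⌋₊ : ℝ) * (48 * Z / M ^ 2) ≤ Z * (48 * Z / M ^ 2) := by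
        gcongr; exact Nat.floor_le hZ0.le
    _ = 48 * 150000 ^ 2 * M ^ 2 / y ^ 2 := by rw [hZ]; field_simp
    _ ≤ _ := by gcongr; norm_num

lemma cis_eq (θ : ℝ) : cis θ = cos θ + sin θ * Complex.I := by
  rw [cis, mul_comm, Complex.exp_mul_I]; push_cast; rfl

lemma cis_re (θ : ℝ) : (cis θ).re = cos θ := by
  rw [cis_eq]; simp [Complex.cos_ofReal_re]

lemma half_le_norm_sum_cis {L : ℕ} {θ : ℝ} (h : L * |θ| ≤ 1) :
    (L : ℝ) / 2 ≤ ‖∑ j ∈ Finset.range L, cis (j * θ)‖ := by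
  refine le_trans ?_ (Complex.re_le_norm _)
  rw [Complex.re_sum]
  have : ∑ j ∈ Finset.range L, (1 / 2 : ℝ) ≤ ∑ j ∈ Finset.range L, (cis (j * θ)).re := by
    refine Finset.sum_le_sum fun j hj => ?_
    rw [cis_re]
    have hj' : (j : ℝ) ≤ L := by exact_mod_cast (Finset.mem_range.1 hj).le
    have h1 : |j * θ| ≤ 1 := by
      rw [abs_mul, Nat.abs_cast]
      exact le_trans (by gcongr) h
    have h2 := Real.one_sub_sq_div_two_le_cos (x := j * θ)
    have h3 : (j * θ) ^ 2 ≤ 1 := by rw [← sq_abs]; exact pow_le_one₀ (abs_nonneg _) h1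
    linarith
  refine le_trans ?_ this
  simp [div_eq_mul_inv]

/-- The number of harmonics used near rationals with denominator `q`. -/
def blockLen (M R q : ℕ) : ℕ := q * M ^ 2 / (7 * R)

/-- A sum of Fejér kernels centred at the rationals with denominators at most `R`. -/
noncomputable def majorArc (M R : ℕ) (τ : ℝ) : ℝ :=
  ∑ q ∈ Finset.Icc 1 R, ((blockLen M R q : ℝ) ^ 2)⁻¹ * ∑ a ∈ Finset.range q,
    ‖∑ j ∈ Finset.range (blockLen M R q), cis (j * (τ - 2 * π * (a / q)))‖ ^ 2

lemma majorArc_nonneg (M R : ℕ) (τ : ℝ) : 0 ≤ majorArc M R τ := by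
  unfold majorArc; positivity

lemma blockLen_le {M R q : ℕ} (hq : q ≤ R) : blockLen M R q ≤ M ^ 2 := by
  unfold blockLen
  rcases Nat.eq_zero_or_pos R with h | h
  · simp [h]
  · refine Nat.div_le_of_le_mul ?_
    nlinarith [Nat.mul_le_mul_right (M ^ 2) hq, Nat.zero_le (R * M ^ 2)]

lemma le_blockLen {M R q : ℕ} (hq : 1 ≤ q) (hR : 1 ≤ R) (h : 7 * R ≤ M ^ 2) :
    1 ≤ blockLen M R q ∧ (q : ℝ) * M ^ 2 / (14 * R) ≤ blockLen M R q := by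
  have h1 : 1 ≤ blockLen M R q := by
    unfold blockLen
    rw [Nat.one_le_div_iff (by omega)]
    nlinarith
  refine ⟨h1, ?_⟩
  have h2 : (q : ℝ) * M ^ 2 / (7 * R) < blockLen M R q + 1 := by
    rw [div_lt_iff₀ (by positivity)]
    have : q * M ^ 2 < (blockLen M R q + 1) * (7 * R) :=
      (Nat.lt_mul_of_div_lt (Nat.lt_succ_self _) (by omega))
    exact_mod_cast this
  have h3 : (1 : ℝ) ≤ blockLen M R q := by exact_mod_cast h1
  have h4 : (q : ℝ) * M ^ 2 / (14 * R) = (q : ℝ) * M ^ 2 / (7 * R) / 2 := by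
    rw [div_div]; congr 1; ring
  rw [h4]; linarith

set_option maxHeartbeats 1000000 in
lemma one_le_four_mul_majorArc {M R q : ℕ} {a : ℤ} {τ : ℝ} (hq : 1 ≤ q) (hqR : q ≤ R)
    (h : 7 * R ≤ M ^ 2) (hβ : |τ / (2 * π) - a / q| * (q * M ^ 2) ≤ R) :
    1 ≤ 4 * majorArc M R τ := by
  have hR : 1 ≤ R := hq.trans hqR
  have hq0 : (0 : ℝ) < q := by exact_mod_cast hq
  have hR0 : (0 : ℝ) < R := by exact_mod_cast hR
  obtain ⟨hL1, -⟩ := le_blockLen hq hR h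
  have hL : (blockLen M R q : ℝ) ≤ q * M ^ 2 / (7 * R) := by
    have := Nat.cast_div_le (α := ℝ) (m := q * M ^ 2) (n := 7 * R)
    unfold blockLen
    exact_mod_cast this
  set L := blockLen M R q with hLdef
  have hL0 : (0 : ℝ) < L := by exact_mod_cast hL1
  have hqz : (0 : ℤ) < q := by exact_mod_cast hq
  set b : ℕ := (a % q).toNat with hb
  have hbz : (b : ℤ) = a % q := Int.toNat_of_nonneg (Int.emod_nonneg _ hqz.ne')
  have hbq : b < q := by
    have := Int.emod_lt_of_pos a hqz
    omega
  have haq : (a : ℝ) / q = b / q + ((a / q : ℤ) : ℝ) := by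
    have : a = b + q * (a / q) := by rw [hbz, Int.emod_add_mul_ediv]
    have h' : (a : ℝ) = b + q * ((a / q : ℤ) : ℝ) := by exact_mod_cast this
    conv_lhs => rw [h']
    field_simp
  set θ : ℝ := 2 * π * (τ / (2 * π) - a / q) with hθ
  have hcis : ∀ j : ℕ, cis (j * (τ - 2 * π * (b / q))) = cis (j * θ) := by
    intro j
    have : (j : ℝ) * (τ - 2 * π * (b / q)) = j * θ + 2 * π * ((j * (a / q) : ℤ) : ℝ) := by
      rw [hθ, haq]; push_cast; field_simp; ring
    rw [this, cis_add, cis_two_pi_int, mul_one]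
  have hθL : (L : ℝ) * |θ| ≤ 1 := by
    rw [hθ, abs_mul, abs_of_pos (by positivity : (0 : ℝ) < 2 * π)]
    set β := |τ / (2 * π) - a / q|
    have hβ0 : 0 ≤ β := abs_nonneg _
    calc (L : ℝ) * (2 * π * β) ≤ (q * M ^ 2 / (7 * R)) * (7 * β) := by
          gcongr; linarith [Real.pi_lt_d2]
      _ = (β * (q * M ^ 2)) / R := by field_simp
      _ ≤ 1 := by rw [div_le_one hR0]; exact hβ
  have h1 := half_le_norm_sum_cis hθL
  have h2 : ((L : ℝ) / 2) ^ 2 ≤ ∑ a ∈ Finset.range q,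
      ‖∑ j ∈ Finset.range L, cis (j * (τ - 2 * π * (a / q)))‖ ^ 2 := by
    refine le_trans ?_ (Finset.single_le_sum (f := fun a : ℕ =>
      ‖∑ j ∈ Finset.range L, cis (j * (τ - 2 * π * (a / q)))‖ ^ 2)
      (fun _ _ => by positivity) (Finset.mem_range.2 hbq))
    simp only [hcis]
    exact pow_le_pow_left₀ (by positivity) h1 2
  have h3 : ((L : ℝ) ^ 2)⁻¹ * ((L : ℝ) / 2) ^ 2 ≤ majorArc M R τ := by
    refine le_trans ?_ (Finset.single_le_sum (f := fun q : ℕ =>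
      ((blockLen M R q : ℝ) ^ 2)⁻¹ * ∑ a ∈ Finset.range q,
        ‖∑ j ∈ Finset.range (blockLen M R q), cis (j * (τ - 2 * π * (a / q)))‖ ^ 2)
      (fun _ _ => by positivity) (Finset.mem_Icc.2 ⟨hq, hqR⟩))
    exact mul_le_mul_of_nonneg_left h2 (by positivity)
  have h4 : ((L : ℝ) ^ 2)⁻¹ * ((L : ℝ) / 2) ^ 2 = 1 / 4 := by field_simp; norm_num
  linarith

lemma weylMajorant_rpow_le {M i₀ : ℕ} (hM : 1 ≤ M) (hi : 7 * 2 ^ i₀ ≤ M ^ 2) {τ : ℝ}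
    (hτ : |τ| ≤ 2 * π) {h : ℝ} (hh : 0 ≤ h) :
    weylMajorant M τ ^ h ≤ (150000 * M ^ 2 / 2 ^ i₀) ^ h
      + ∑ i ∈ Finset.range i₀, (150000 * M ^ 2 / 2 ^ i) ^ h * (4 * majorArc M (2 ^ (i + 1)) τ) := by
  obtain ⟨q, a, hq, -, hW⟩ := exists_weylMajorant_le hM hτ
  have hq0 : (1 : ℝ) ≤ q := by exact_mod_cast hq
  set β := |τ / (2 * π) - a / q| with hβ
  have hβ0 : 0 ≤ β := abs_nonneg _
  set Q : ℝ := q * (1 + M ^ 2 * β) with hQ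
  have hQ1 : 1 ≤ Q := by
    have : 0 ≤ (q : ℝ) * (M ^ 2 * β) := by positivity
    rw [hQ]; linarith
  have hsum : 0 ≤ ∑ i ∈ Finset.range i₀,
      (150000 * (M : ℝ) ^ 2 / 2 ^ i) ^ h * (4 * majorArc M (2 ^ (i + 1)) τ) :=
    Finset.sum_nonneg fun i _ => mul_nonneg (by positivity)
      (mul_nonneg (by norm_num) (majorArc_nonneg _ _ _))
  have hG := weylMajorant_nonneg M τ
  rcases le_or_gt ((2 : ℝ) ^ i₀) Q with hc | hc
  · have : weylMajorant M τ ^ h ≤ (150000 * (M : ℝ) ^ 2 / 2 ^ i₀) ^ h :=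
      Real.rpow_le_rpow hG (hW.trans (by gcongr)) hh
    linarith
  · obtain ⟨i, hi1, hi2⟩ := exists_nat_pow_near hQ1 (by norm_num : (1 : ℝ) < 2)
    have hii : i < i₀ := by
      have := hi1.trans_lt hc
      exact (pow_lt_pow_iff_right₀ (by norm_num : (1 : ℝ) < 2)).1 this
    have h1 : weylMajorant M τ ^ h ≤ (150000 * (M : ℝ) ^ 2 / 2 ^ i) ^ h :=
      Real.rpow_le_rpow hG (hW.trans (by gcongr)) hh
    have h2 : 1 ≤ 4 * majorArc M (2 ^ (i + 1)) τ := by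
      refine one_le_four_mul_majorArc (q := q) (a := a) hq ?_ ?_ ?_
      · have : (q : ℝ) ≤ 2 ^ (i + 1) := by
          have : 0 ≤ (q : ℝ) * (M ^ 2 * β) := by positivity
          linarith
        exact_mod_cast this
      · refine le_trans (Nat.mul_le_mul_left 7 (Nat.pow_le_pow_right (by norm_num) hii)) hi
      · rw [← hβ]; push_cast; linarith
    have h3 := Finset.single_le_sum (f := fun i =>
      (150000 * (M : ℝ) ^ 2 / 2 ^ i) ^ h * (4 * majorArc M (2 ^ (i + 1)) τ))
      (fun i _ => mul_nonneg (by positivity) (mul_nonneg (by norm_num) (majorArc_nonneg _ _ _)))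
      (Finset.mem_range.2 hii)
    have h4 : (150000 * (M : ℝ) ^ 2 / 2 ^ i) ^ h
        ≤ (150000 * (M : ℝ) ^ 2 / 2 ^ i) ^ h * (4 * majorArc M (2 ^ (i + 1)) τ) :=
      le_mul_of_one_le_right (by positivity) h2
    have h5 : 0 ≤ (150000 * (M : ℝ) ^ 2 / 2 ^ i₀) ^ h := by positivity
    linarith

lemma sum_range_cis_div {q : ℕ} (hq : 1 ≤ q) (m : ℤ) :
    ∑ a ∈ Finset.range q, cis (a * (-(2 * π * m / q))) = if (q : ℤ) ∣ m then (q : ℂ) else 0 := by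
  have hq0 : (q : ℝ) ≠ 0 := by positivity
  simp_rw [cis_nat_mul]
  split_ifs with h
  · obtain ⟨k, rfl⟩ := h
    have : cis (-(2 * π * ((q * k : ℤ) : ℝ) / q)) = 1 := by
      have e : -(2 * π * ((q * k : ℤ) : ℝ) / q) = 2 * π * ((-k : ℤ) : ℝ) := by
        push_cast; field_simp
      rw [e, cis_two_pi_int]
    simp only [this, one_pow]
    simp
  · have h1 : cis (-(2 * π * m / q)) ≠ 1 := by
      intro h1
      rw [cis, Complex.exp_eq_one_iff] at h1
      obtain ⟨k, hk⟩ := h1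
      apply h
      have hk' : ((-(2 * π * m / q) : ℝ) : ℂ) = ((k * (2 * π) : ℝ) : ℂ) := by
        apply mul_left_cancel₀ Complex.I_ne_zero
        rw [hk]; push_cast; ring
      have hk2 : -(2 * π * m / q) = (k * (2 * π) : ℝ) := by exact_mod_cast hk'
      have hk3 : (m : ℝ) = q * (-k : ℤ) := by
        push_cast
        field_simp at hk2
        linarith
      exact ⟨-k, by exact_mod_cast hk3⟩
    have h2 : cis (-(2 * π * m / q)) ^ q = 1 := by
      rw [← cis_nat_mul]
      have e : (q : ℝ) * -(2 * π * m / q) = 2 * π * ((-m : ℤ) : ℝ) := by push_cast; field_simp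
      rw [e, cis_two_pi_int]
    rw [geom_sum_eq h1, h2]; simp

lemma sum_norm_sq_shifted {q : ℕ} (hq : 1 ≤ q) (L : ℕ) (τ : ℝ) :
    ∑ a ∈ Finset.range q, ‖∑ j ∈ Finset.range L, cis (j * (τ - 2 * π * (a / q)))‖ ^ 2
      = ∑ j ∈ Finset.range L, ∑ l ∈ Finset.range L,
        if (q : ℤ) ∣ (j : ℤ) - l then q * cos (τ * ((j : ℤ) - l : ℤ)) else 0 := by
  have h1 : ∀ a : ℕ, ((‖∑ j ∈ Finset.range L, cis (j * (τ - 2 * π * (a / q)))‖ ^ 2 : ℝ) : ℂ)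
      = ∑ j ∈ Finset.range L, ∑ l ∈ Finset.range L,
        cis (τ * ((j : ℤ) - l : ℤ)) * cis (a * (-(2 * π * ((j : ℤ) - l : ℤ) / q))) := by
    intro a
    push_cast
    rw [← Complex.mul_conj', map_sum, Finset.sum_mul_sum]
    refine Finset.sum_congr rfl fun j _ => Finset.sum_congr rfl fun l _ => ?_
    rw [conj_cis, ← cis_add, ← cis_add]
    congr 1; ring
  have h2 : ((∑ a ∈ Finset.range q,
      ‖∑ j ∈ Finset.range L, cis (j * (τ - 2 * π * (a / q)))‖ ^ 2 : ℝ) : ℂ)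
      = ∑ j ∈ Finset.range L, ∑ l ∈ Finset.range L,
        cis (τ * ((j : ℤ) - l : ℤ)) * if (q : ℤ) ∣ (j : ℤ) - l then (q : ℂ) else 0 := by
    rw [Complex.ofReal_sum]
    simp_rw [h1]
    rw [Finset.sum_comm]
    refine Finset.sum_congr rfl fun j _ => ?_
    rw [Finset.sum_comm]
    refine Finset.sum_congr rfl fun l _ => ?_
    rw [← Finset.mul_sum, sum_range_cis_div hq]
  have h3 := congrArg Complex.re h2
  rw [Complex.ofReal_re, Complex.re_sum] at h3
  rw [h3]
  refine Finset.sum_congr rfl fun j _ => ?_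
  rw [Complex.re_sum]
  refine Finset.sum_congr rfl fun l _ => ?_
  split_ifs
  · have : (q : ℂ) = ((q : ℝ) : ℂ) := by simp
    rw [this, Complex.re_mul_ofReal, cis_re]; ring
  · simp

/-- The squared modulus of the `k`-th Fourier coefficient of a real function. -/
noncomputable def specSq (F : ℝ → ℝ) (k : ℤ) : ℝ :=
  (∫ t, F t * cos (t * k) ∂timeMeas) ^ 2 + (∫ t, F t * sin (t * k) ∂timeMeas) ^ 2

lemma specSq_nonneg (F : ℝ → ℝ) (k : ℤ) : 0 ≤ specSq F k := by unfold specSq; positivity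

lemma specSq_zero (F : ℝ → ℝ) : specSq F 0 = (∫ t, F t ∂timeMeas) ^ 2 := by simp [specSq]

section
variable {F : ℝ → ℝ} {A : ℝ}

lemma integrable_mul_of_bound (hF : Measurable F) (hA : ∀ t, |F t| ≤ A) {g : ℝ → ℝ}
    (hg : Measurable g) (hg1 : ∀ t, |g t| ≤ 1) : Integrable (fun t => F t * g t) timeMeas := by
  refine Integrable.of_bound (hF.mul hg).aestronglyMeasurable A (Filter.Eventually.of_forall fun t => ?_)
  rw [Real.norm_eq_abs, abs_mul]
  calc |F t| * |g t| ≤ |F t| * 1 := by gcongr; exact hg1 t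
    _ ≤ A := by simpa using hA t

lemma specSq_eq_norm_sq (hF : Measurable F) (hA : ∀ t, |F t| ≤ A) (k : ℤ) :
    specSq F k = ‖∫ t, (F t : ℂ) * (starRingEnd ℂ) (cis (t * k)) ∂timeMeas‖ ^ 2 := by
  have h1 : ∀ t, (F t : ℂ) * (starRingEnd ℂ) (cis (t * k))
      = ((F t * cos (t * k) : ℝ) : ℂ) - ((F t * sin (t * k) : ℝ) : ℂ) * Complex.I := by
    intro t
    rw [cis_eq]
    simp only [map_add, map_mul, Complex.conj_ofReal, Complex.conj_I]
    push_cast; ring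
  have i1 := integrable_mul_of_bound hF hA (g := fun t => cos (t * k)) (by fun_prop)
    (fun t => abs_cos_le_one _)
  have i2 := integrable_mul_of_bound hF hA (g := fun t => sin (t * k)) (by fun_prop)
    (fun t => abs_sin_le_one _)
  simp_rw [h1]
  rw [integral_sub i1.ofReal (i2.ofReal.mul_const _), integral_mul_const,
    integral_complex_ofReal, integral_complex_ofReal]
  rw [← Complex.normSq_eq_norm_sq, Complex.normSq_apply, specSq]
  simp
  ring

lemma specSq_le (hF : Measurable F) (hA : ∀ t, |F t| ≤ A) (h0 : ∀ t, 0 ≤ F t) (k : ℤ) :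
    specSq F k ≤ (∫ t, F t ∂timeMeas) ^ 2 := by
  rw [specSq_eq_norm_sq hF hA]
  gcongr
  refine (norm_integral_le_integral_norm _).trans (le_of_eq ?_)
  congr 1; ext t
  simp [norm_cis, abs_of_nonneg (h0 t)]

lemma sum_specSq_le (hF : Measurable F) (hA : ∀ t, |F t| ≤ A) (s : Finset ℤ) :
    ∑ k ∈ s, specSq F k ≤ 2 * π * ∫ t, F t ^ 2 ∂timeMeas := by
  have := isOrthoFamily_time.bessel (by positivity) s (f := fun t => (F t : ℂ))
    (by fun_prop) A (fun t => by simpa using hA t)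
  simpa [specSq_eq_norm_sq hF hA] using this

lemma integral_cos_quadratic (hF : Measurable F) (hA : ∀ t, |F t| ≤ A) (k : ℤ) :
    Integrable (fun z : ℝ × ℝ => F z.1 * F z.2 * cos ((z.1 - z.2) * k)) (timeMeas.prod timeMeas) ∧
    ∫ z : ℝ × ℝ, F z.1 * F z.2 * cos ((z.1 - z.2) * k) ∂(timeMeas.prod timeMeas) = specSq F k := by
  have i1 := integrable_mul_of_bound hF hA (g := fun t => cos (t * k)) (by fun_prop)
    (fun t => abs_cos_le_one _)
  have i2 := integrable_mul_of_bound hF hA (g := fun t => sin (t * k)) (by fun_prop)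
    (fun t => abs_sin_le_one _)
  have h : ∀ z : ℝ × ℝ, F z.1 * F z.2 * cos ((z.1 - z.2) * k)
      = (F z.1 * cos (z.1 * k)) * (F z.2 * cos (z.2 * k))
        + (F z.1 * sin (z.1 * k)) * (F z.2 * sin (z.2 * k)) := by
    intro z; rw [sub_mul, cos_sub]; ring
  simp_rw [h]
  refine ⟨(i1.mul_prod i1).add (i2.mul_prod i2), ?_⟩
  rw [integral_add (i1.mul_prod i1) (i2.mul_prod i2),
    integral_prod_mul (fun t => F t * cos (t * k)) (fun t => F t * cos (t * k)),
    integral_prod_mul (fun t => F t * sin (t * k)) (fun t => F t * sin (t * k)), specSq]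
  ring

lemma integral_block_quadratic (hF : Measurable F) (hA : ∀ t, |F t| ≤ A) {q : ℕ} (hq : 1 ≤ q) (L : ℕ) :
    Integrable (fun z : ℝ × ℝ => F z.1 * F z.2 * ∑ a ∈ Finset.range q,
      ‖∑ j ∈ Finset.range L, cis (j * ((z.1 - z.2) - 2 * π * (a / q)))‖ ^ 2) (timeMeas.prod timeMeas) ∧
    ∫ z : ℝ × ℝ, F z.1 * F z.2 * ∑ a ∈ Finset.range q,
      ‖∑ j ∈ Finset.range L, cis (j * ((z.1 - z.2) - 2 * π * (a / q)))‖ ^ 2 ∂(timeMeas.prod timeMeas)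
      = ∑ j ∈ Finset.range L, ∑ l ∈ Finset.range L,
        if (q : ℤ) ∣ (j : ℤ) - l then q * specSq F ((j : ℤ) - l) else 0 := by
  simp_rw [sum_norm_sq_shifted hq, Finset.mul_sum]
  have h : ∀ j l : ℕ, Integrable (fun z : ℝ × ℝ => F z.1 * F z.2 *
      if (q : ℤ) ∣ (j : ℤ) - l then q * cos ((z.1 - z.2) * ((j : ℤ) - l : ℤ)) else 0)
        (timeMeas.prod timeMeas) ∧
      ∫ z : ℝ × ℝ, F z.1 * F z.2 *
      (if (q : ℤ) ∣ (j : ℤ) - l then q * cos ((z.1 - z.2) * ((j : ℤ) - l : ℤ)) else 0)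
        ∂(timeMeas.prod timeMeas) = if (q : ℤ) ∣ (j : ℤ) - l then q * specSq F ((j : ℤ) - l) else 0 := by
    intro j l
    obtain ⟨h1, h2⟩ := integral_cos_quadratic hF hA ((j : ℤ) - l)
    split_ifs
    · have e : ∀ z : ℝ × ℝ, F z.1 * F z.2 * (q * cos ((z.1 - z.2) * ((j : ℤ) - l : ℤ)))
          = q * (F z.1 * F z.2 * cos ((z.1 - z.2) * ((j : ℤ) - l : ℤ))) := fun z => by ring
      simp_rw [e]
      exact ⟨h1.const_mul _, by rw [integral_const_mul, h2]⟩
    · simp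
  refine ⟨integrable_finsetSum _ fun j _ => integrable_finsetSum _ fun l _ => (h j l).1, ?_⟩
  rw [integral_finsetSum _ fun j _ => integrable_finsetSum _ fun l _ => (h j l).1]
  refine Finset.sum_congr rfl fun j _ => ?_
  rw [integral_finsetSum _ fun l _ => (h j l).1]
  exact Finset.sum_congr rfl fun l _ => (h j l).2

lemma sum_range_sub_le (F : ℝ → ℝ) (q : ℕ) {L K : ℕ} (hL : L ≤ K) :
    ∑ j ∈ Finset.range L, ∑ l ∈ Finset.range L,
        (if (q : ℤ) ∣ (j : ℤ) - l then q * specSq F ((j : ℤ) - l) else 0)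
      ≤ L * (q * ∑ k ∈ Finset.Icc (-(K : ℤ)) K, if (q : ℤ) ∣ k then specSq F k else 0) := by
  have h : ∀ j ∈ Finset.range L, ∑ l ∈ Finset.range L,
        (if (q : ℤ) ∣ (j : ℤ) - l then q * specSq F ((j : ℤ) - l) else 0)
      ≤ q * ∑ k ∈ Finset.Icc (-(K : ℤ)) K, if (q : ℤ) ∣ k then specSq F k else 0 := by
    intro j hj
    have hj := Finset.mem_range.1 hj
    have e : ∑ l ∈ Finset.range L,
        (if (q : ℤ) ∣ (j : ℤ) - l then q * specSq F ((j : ℤ) - l) else 0)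
        = q * ∑ k ∈ (Finset.range L).image (fun l : ℕ => (j : ℤ) - l),
          if (q : ℤ) ∣ k then specSq F k else 0 := by
      rw [Finset.sum_image (by intro x _ y _ hxy; simpa using hxy), Finset.mul_sum]
      simp
    rw [e]
    refine mul_le_mul_of_nonneg_left ?_ (by positivity)
    refine Finset.sum_le_sum_of_subset_of_nonneg ?_ fun k _ _ => ?_
    · intro k hk
      obtain ⟨l, hl, rfl⟩ := Finset.mem_image.1 hk
      have hl := Finset.mem_range.1 hl
      rw [Finset.mem_Icc]; omega
    · split_ifs
      · exact specSq_nonneg _ _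
      · exact le_rfl
  refine (Finset.sum_le_sum h).trans (by simp)

lemma integral_majorArc_le (hF : Measurable F) (hA : ∀ t, |F t| ≤ A) {M R : ℕ} (hR : 1 ≤ R)
    (h : 7 * R ≤ M ^ 2) :
    Integrable (fun z : ℝ × ℝ => F z.1 * F z.2 * majorArc M R (z.1 - z.2)) (timeMeas.prod timeMeas) ∧
    ∫ z : ℝ × ℝ, F z.1 * F z.2 * majorArc M R (z.1 - z.2) ∂(timeMeas.prod timeMeas)
      ≤ 14 * R / M ^ 2 * ∑ k ∈ Finset.Icc (-(M ^ 2 : ℕ) : ℤ) (M ^ 2 : ℕ),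
        truncDivisors R k.natAbs * specSq F k := by
  have hM0 : (0 : ℝ) < M := by
    have : M ≠ 0 := by rintro rfl; simp at h; omega
    positivity
  have e : ∀ z : ℝ × ℝ, F z.1 * F z.2 * majorArc M R (z.1 - z.2)
      = ∑ q ∈ Finset.Icc 1 R, ((blockLen M R q : ℝ) ^ 2)⁻¹ * (F z.1 * F z.2 * ∑ a ∈ Finset.range q,
      ‖∑ j ∈ Finset.range (blockLen M R q), cis (j * ((z.1 - z.2) - 2 * π * (a / q)))‖ ^ 2) := by
    intro z
    rw [majorArc, Finset.mul_sum]
    exact Finset.sum_congr rfl fun q _ => by ring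
  simp_rw [e]
  have hI : ∀ q ∈ Finset.Icc 1 R, Integrable (fun z : ℝ × ℝ => ((blockLen M R q : ℝ) ^ 2)⁻¹ *
      (F z.1 * F z.2 * ∑ a ∈ Finset.range q,
      ‖∑ j ∈ Finset.range (blockLen M R q), cis (j * ((z.1 - z.2) - 2 * π * (a / q)))‖ ^ 2))
      (timeMeas.prod timeMeas) := fun q hq =>
    (integral_block_quadratic hF hA (Finset.mem_Icc.1 hq).1 _).1.const_mul _
  refine ⟨integrable_finsetSum _ hI, ?_⟩
  rw [integral_finsetSum _ hI]
  have hq : ∀ q ∈ Finset.Icc 1 R, ∫ z : ℝ × ℝ, ((blockLen M R q : ℝ) ^ 2)⁻¹ *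
      (F z.1 * F z.2 * ∑ a ∈ Finset.range q,
      ‖∑ j ∈ Finset.range (blockLen M R q), cis (j * ((z.1 - z.2) - 2 * π * (a / q)))‖ ^ 2)
      ∂(timeMeas.prod timeMeas) ≤ 14 * R / M ^ 2 * ∑ k ∈ Finset.Icc (-(M ^ 2 : ℕ) : ℤ) (M ^ 2 : ℕ),
        if (q : ℤ) ∣ k then specSq F k else 0 := by
    intro q hq
    obtain ⟨hq1, hq2⟩ := Finset.mem_Icc.1 hq
    obtain ⟨hL1, hL2⟩ := le_blockLen hq1 hR h
    have hb := sum_range_sub_le F q (blockLen_le (M := M) hq2)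
    rw [integral_const_mul, (integral_block_quadratic hF hA hq1 _).2]
    set L := blockLen M R q
    have hL0 : (0 : ℝ) < L := by exact_mod_cast hL1
    set S := ∑ k ∈ Finset.Icc (-(M ^ 2 : ℕ) : ℤ) (M ^ 2 : ℕ), if (q : ℤ) ∣ k then specSq F k else 0
    have hS : 0 ≤ S := Finset.sum_nonneg fun k _ => by
      split_ifs
      · exact specSq_nonneg _ _
      · exact le_rfl
    calc _ ≤ ((L : ℝ) ^ 2)⁻¹ * (L * (q * S)) := by gcongr
      _ = (q / L) * S := by field_simp
      _ ≤ _ := by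
        refine mul_le_mul_of_nonneg_right ?_ hS
        rw [div_le_div_iff₀ hL0 (by positivity)]
        rw [div_le_iff₀ (by positivity)] at hL2
        linarith
  refine (Finset.sum_le_sum hq).trans (le_of_eq ?_)
  rw [← Finset.mul_sum, Finset.sum_comm]
  congr 1
  refine Finset.sum_congr rfl fun k _ => ?_
  rw [← Finset.sum_filter, Finset.sum_const, nsmul_eq_mul, truncDivisors]
  congr 3
  ext q
  simp only [Finset.mem_filter, Int.natCast_dvd]

end

lemma sum_natAbs_le (K : ℕ) (f : ℕ → ℝ) (hf : ∀ k, 0 ≤ f k) :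
    ∑ k ∈ (Finset.Icc (-(K : ℤ)) K).erase 0, f k.natAbs ≤ 2 * ∑ k ∈ Finset.Icc 1 K, f k := by
  classical
  have hsub : (Finset.Icc (-(K : ℤ)) K).erase 0 ⊆
      (Finset.Icc 1 K).image (fun k : ℕ => (k : ℤ)) ∪ (Finset.Icc 1 K).image (fun k : ℕ => -(k : ℤ)) := by
    intro k hk
    rw [Finset.mem_erase, Finset.mem_Icc] at hk
    rw [Finset.mem_union, Finset.mem_image, Finset.mem_image]
    rcases le_or_gt 0 k with h | h
    · exact Or.inl ⟨k.natAbs, by rw [Finset.mem_Icc]; omega, by omega⟩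
    · exact Or.inr ⟨k.natAbs, by rw [Finset.mem_Icc]; omega, by omega⟩
  refine (Finset.sum_le_sum_of_subset_of_nonneg hsub fun _ _ _ => hf _).trans ?_
  refine (le_add_of_nonneg_right (Finset.sum_nonneg (f := fun k : ℤ => f k.natAbs)
    fun _ _ => hf _)).trans (Finset.sum_union_inter.le.trans ?_)
  rw [Finset.sum_image (by intro x _ y _ h; simpa using h),
    Finset.sum_image (by intro x _ y _ h; simpa using h)]
  simp [two_mul]

section
variable {F : ℝ → ℝ} {A : ℝ}

lemma exists_sum_truncDivisors_specSq_le (b : ℕ) :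
    ∃ C : ℝ, 0 < C ∧ ∀ (F : ℝ → ℝ) (A : ℝ), Measurable F → (∀ t, |F t| ≤ A) → (∀ t, 0 ≤ F t) →
      ∀ (R K : ℕ) (Y : ℝ), 1 ≤ R → 0 < Y →
      ∑ k ∈ Finset.Icc (-(K : ℤ)) K, truncDivisors R k.natAbs * specSq F k
        ≤ R * (∫ t, F t ∂timeMeas) ^ 2 + 2 * π * Y * ∫ t, F t ^ 2 ∂timeMeas
          + C * K * R / Y ^ b * (∫ t, F t ∂timeMeas) ^ 2 := by
  obtain ⟨C, hC, hB⟩ := exists_sum_truncDivisors_pow_le (b + 1) (by omega)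
  refine ⟨2 * C, by positivity, fun F A hF hA h0 R K Y hR hY => ?_⟩
  set m := ∫ t, F t ∂timeMeas
  have hz : (0 : ℤ) ∈ Finset.Icc (-(K : ℤ)) K := by rw [Finset.mem_Icc]; omega
  have hz2 : truncDivisors R (0 : ℤ).natAbs = R := by simp [truncDivisors]
  rw [← Finset.add_sum_erase _ _ hz, specSq_zero, hz2, add_assoc]
  gcongr
  have hd : ∀ d : ℕ, (d : ℝ) ≤ Y + (d : ℝ) ^ (b + 1) / Y ^ b := by
    intro d
    rcases le_or_gt (d : ℝ) Y with h | h
    · have : 0 ≤ (d : ℝ) ^ (b + 1) / Y ^ b := by positivity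
      linarith
    · have : (d : ℝ) ≤ (d : ℝ) ^ (b + 1) / Y ^ b := by
        rw [le_div_iff₀ (by positivity), pow_succ, mul_comm]
        gcongr
      linarith
  have h1 : ∀ k : ℤ, truncDivisors R k.natAbs * specSq F k
      ≤ Y * specSq F k + m ^ 2 / Y ^ b * (truncDivisors R k.natAbs : ℝ) ^ (b + 1) := by
    intro k
    have hs := specSq_nonneg F k
    calc _ ≤ (Y + (truncDivisors R k.natAbs : ℝ) ^ (b + 1) / Y ^ b) * specSq F k := by
          gcongr; exact hd _
      _ = Y * specSq F k + (truncDivisors R k.natAbs : ℝ) ^ (b + 1) / Y ^ b * specSq F k := by ring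
      _ ≤ Y * specSq F k + (truncDivisors R k.natAbs : ℝ) ^ (b + 1) / Y ^ b * m ^ 2 := by
          gcongr; exact specSq_le hF hA h0 k
      _ = _ := by ring
  refine (Finset.sum_le_sum fun k _ => h1 k).trans ?_
  rw [Finset.sum_add_distrib, ← Finset.mul_sum, ← Finset.mul_sum]
  have h2 := sum_specSq_le hF hA ((Finset.Icc (-(K : ℤ)) K).erase 0)
  have h3 := (sum_natAbs_le K (fun k => (truncDivisors R k : ℝ) ^ (b + 1)) fun _ => by positivity).trans
    (mul_le_mul_of_nonneg_left (hB R K hR) zero_le_two)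
  have h4 := mul_le_mul_of_nonneg_left h2 hY.le
  have h5 := mul_le_mul_of_nonneg_left h3 (by positivity : 0 ≤ m ^ 2 / Y ^ b)
  refine (add_le_add h4 h5).trans (le_of_eq ?_)
  ring

lemma ae_prod_timeMeas : ∀ᵐ z : ℝ × ℝ ∂(timeMeas.prod timeMeas),
    z.1 ∈ Set.Icc 0 (2 * π) ∧ z.2 ∈ Set.Icc 0 (2 * π) := by
  rw [Measure.prod_restrict]
  filter_upwards [ae_restrict_mem (measurableSet_Icc.prod measurableSet_Icc)] with z hz using hz

lemma abs_sub_le_of_mem {a b : ℝ} (ha : a ∈ Set.Icc 0 (2 * π)) (hb : b ∈ Set.Icc 0 (2 * π)) :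
    |a - b| ≤ 2 * π :=
  abs_le.2 ⟨by linarith [ha.1, hb.2], by linarith [ha.2, hb.1]⟩

lemma integrable_mul_weylMajorant (hF : Measurable F) (hA : ∀ t, |F t| ≤ A) (M : ℕ) {h : ℝ}
    (hh : 0 ≤ h) :
    Integrable (fun z : ℝ × ℝ => F z.1 * F z.2 * weylMajorant M (z.1 - z.2) ^ h)
      (timeMeas.prod timeMeas) := by
  have hm : Measurable fun z : ℝ × ℝ => F z.1 * F z.2 * weylMajorant M (z.1 - z.2) ^ h :=
    ((hF.comp measurable_fst).mul (hF.comp measurable_snd)).mul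
      (((measurable_weylMajorant M).comp (by fun_prop)).pow_const h)
  refine Integrable.of_bound hm.aestronglyMeasurable (A * A * (12 * M * (4 * M + 1)) ^ h)
    (Filter.Eventually.of_forall fun z => ?_)
  have hA0 : 0 ≤ A := (abs_nonneg _).trans (hA 0)
  have hG := weylMajorant_nonneg M (z.1 - z.2)
  rw [Real.norm_eq_abs, abs_mul, abs_mul, abs_of_nonneg (Real.rpow_nonneg hG h)]
  have := Real.rpow_le_rpow hG (weylMajorant_le_sq M (z.1 - z.2)) hh
  gcongr
  · exact hA _
  · exact hA _

lemma exists_integral_weylMajorant_le (b : ℕ) {h σ : ℝ} (hh : 0 ≤ h) (hσ : 0 ≤ σ) (hσ1 : σ ≤ 1)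
    (hhσ : 1 - h ≤ σ) :
    ∃ C : ℝ, 0 < C ∧ ∀ (F : ℝ → ℝ) (A : ℝ), Measurable F → (∀ t, |F t| ≤ A) → (∀ t, 0 ≤ F t) →
      ∀ (M i₀ : ℕ) (Y : ℝ), 1 ≤ M → 7 * 2 ^ i₀ ≤ M ^ 2 → 0 < Y →
      ∫ z : ℝ × ℝ, F z.1 * F z.2 * weylMajorant M (z.1 - z.2) ^ h ∂(timeMeas.prod timeMeas)
        ≤ (150000 * M ^ 2 / 2 ^ i₀) ^ h * (∫ t, F t ∂timeMeas) ^ 2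
          + C * i₀ * ((M : ℝ) ^ 2) ^ (h - 1) *
            ((2 ^ i₀) ^ 2 * (∫ t, F t ∂timeMeas) ^ 2
              + ((2 : ℝ) ^ i₀) ^ σ * Y * (∫ t, F t ^ 2 ∂timeMeas)
              + (2 ^ i₀) ^ 2 * M ^ 2 / Y ^ b * (∫ t, F t ∂timeMeas) ^ 2) := by
  obtain ⟨C, hC, hS⟩ := exists_sum_truncDivisors_specSq_le b
  refine ⟨(112 * 150000 ^ h) * (7 + C), by positivity, fun F A hF hA h0 M i₀ Y hM hi hY => ?_⟩
  have hM0 : (0 : ℝ) < M := by exact_mod_cast hM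
  set m := ∫ t, F t ∂timeMeas with hm
  set V := ∫ t, F t ^ 2 ∂timeMeas with hV
  have hV0 : 0 ≤ V := integral_nonneg fun t => sq_nonneg _
  have hR : ∀ i ∈ Finset.range i₀, 7 * 2 ^ (i + 1) ≤ M ^ 2 := fun i hi' =>
    le_trans (Nat.mul_le_mul_left 7 (Nat.pow_le_pow_right (by norm_num)
      (Finset.mem_range.1 hi'))) hi
  have hJ : ∀ i ∈ Finset.range i₀, _ := fun i hi' =>
    integral_majorArc_le hF hA (M := M) (R := 2 ^ (i + 1)) Nat.one_le_two_pow (hR i hi')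
  have hFF : Integrable (fun z : ℝ × ℝ => F z.1 * F z.2) (timeMeas.prod timeMeas) := by
    simpa using integrable_mul_weylMajorant hF hA M le_rfl
  have hI1 : Integrable (fun z : ℝ × ℝ => F z.1 * F z.2 * (150000 * M ^ 2 / 2 ^ i₀ : ℝ) ^ h)
      (timeMeas.prod timeMeas) := hFF.mul_const _
  have hI2 : ∀ i ∈ Finset.range i₀, Integrable (fun z : ℝ × ℝ => ((150000 * M ^ 2 / 2 ^ i : ℝ) ^ h * 4) *
      (F z.1 * F z.2 * majorArc M (2 ^ (i + 1)) (z.1 - z.2))) (timeMeas.prod timeMeas) :=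
    fun i hi' => (hJ i hi').1.const_mul _
  have step1 : ∫ z : ℝ × ℝ, F z.1 * F z.2 * weylMajorant M (z.1 - z.2) ^ h ∂(timeMeas.prod timeMeas)
      ≤ ∫ z : ℝ × ℝ, (F z.1 * F z.2 * (150000 * M ^ 2 / 2 ^ i₀ : ℝ) ^ h
        + ∑ i ∈ Finset.range i₀, ((150000 * M ^ 2 / 2 ^ i : ℝ) ^ h * 4) *
      (F z.1 * F z.2 * majorArc M (2 ^ (i + 1)) (z.1 - z.2))) ∂(timeMeas.prod timeMeas) := by
    refine integral_mono_ae (integrable_mul_weylMajorant hF hA M hh)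
      (hI1.add (integrable_finsetSum _ hI2)) ?_
    filter_upwards [ae_prod_timeMeas] with z hz
    have := mul_le_mul_of_nonneg_left (weylMajorant_rpow_le hM hi (abs_sub_le_of_mem hz.1 hz.2) hh)
      (mul_nonneg (h0 z.1) (h0 z.2))
    refine this.trans (le_of_eq ?_)
    rw [mul_add, Finset.mul_sum]
    congr 1
    exact Finset.sum_congr rfl fun i _ => by ring
  refine step1.trans ?_
  rw [integral_add hI1 (integrable_finsetSum _ hI2), integral_finsetSum _ hI2, integral_mul_const,
    integral_prod_mul, ← hm]
  refine add_le_add (le_of_eq (by ring)) ?_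
  have hterm : ∀ i ∈ Finset.range i₀, ∫ z : ℝ × ℝ, ((150000 * M ^ 2 / 2 ^ i : ℝ) ^ h * 4) *
      (F z.1 * F z.2 * majorArc M (2 ^ (i + 1)) (z.1 - z.2)) ∂(timeMeas.prod timeMeas)
      ≤ (112 * 150000 ^ h) * (7 + C) * ((M : ℝ) ^ 2) ^ (h - 1) *
            ((2 ^ i₀) ^ 2 * m ^ 2 + ((2 : ℝ) ^ i₀) ^ σ * Y * V
              + (2 ^ i₀) ^ 2 * M ^ 2 / Y ^ b * m ^ 2) := by
    intro i hi'
    have hlt := Finset.mem_range.1 hi'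
    rw [integral_const_mul]
    have h1 := (hJ i hi').2
    have h2 := hS F A hF hA h0 (2 ^ (i + 1)) (M ^ 2) Y Nat.one_le_two_pow hY
    rw [← hm, ← hV] at h2
    set T := ∑ k ∈ Finset.Icc (-(M ^ 2 : ℕ) : ℤ) (M ^ 2 : ℕ),
        truncDivisors (2 ^ (i + 1)) k.natAbs * specSq F k
    have e1 : ((150000 * M ^ 2 / 2 ^ i : ℝ) ^ h * 4) * (14 * ((2 ^ (i + 1) : ℕ) : ℝ) / M ^ 2)
        = (112 * 150000 ^ h) * ((M : ℝ) ^ 2) ^ (h - 1) * ((2 : ℝ) ^ i) ^ (1 - h) := by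
      rw [Real.div_rpow (by positivity) (by positivity), Real.mul_rpow (by positivity) (by positivity),
        Real.rpow_sub_one (by positivity), Real.rpow_sub (by positivity), Real.rpow_one]
      push_cast
      rw [pow_succ]
      field_simp
      ring
    have h3 : ((2 : ℝ) ^ i) ^ (1 - h) ≤ ((2 : ℝ) ^ i₀) ^ σ := by
      calc ((2 : ℝ) ^ i) ^ (1 - h) ≤ ((2 : ℝ) ^ i) ^ σ :=
            Real.rpow_le_rpow_of_exponent_le (one_le_pow₀ (by norm_num)) hhσ
        _ ≤ _ := Real.rpow_le_rpow (by positivity)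
            (pow_le_pow_right₀ (by norm_num) hlt.le) hσ
    have h4 : ((2 : ℝ) ^ i₀) ^ σ ≤ 2 ^ i₀ := by
      calc ((2 : ℝ) ^ i₀) ^ σ ≤ ((2 : ℝ) ^ i₀) ^ (1 : ℝ) :=
            Real.rpow_le_rpow_of_exponent_le (one_le_pow₀ (by norm_num)) hσ1
        _ = _ := Real.rpow_one _
    have h5 : (((2 ^ (i + 1) : ℕ) : ℝ)) ≤ 2 ^ i₀ := by
      push_cast
      exact pow_le_pow_right₀ (by norm_num) hlt
    have hT0 : 0 ≤ T := Finset.sum_nonneg fun k _ => mul_nonneg (by positivity) (specSq_nonneg _ _)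
    set P := (2 : ℝ) ^ i₀
    have hP : 0 < P := by positivity
    have h6 : ((2 : ℝ) ^ i) ^ (1 - h) * T
        ≤ (7 + C) * (P ^ 2 * m ^ 2 + P ^ σ * Y * V + P ^ 2 * M ^ 2 / Y ^ b * m ^ 2) := by
      have hT : T ≤ P * m ^ 2 + 7 * Y * V + C * M ^ 2 * P / Y ^ b * m ^ 2 := by
        refine h2.trans ?_
        push_cast at h5 ⊢
        gcongr
        linarith [Real.pi_lt_d2]
      have hPσ : 0 ≤ P ^ σ := by positivity
      calc _ ≤ P ^ σ * (P * m ^ 2 + 7 * Y * V + C * M ^ 2 * P / Y ^ b * m ^ 2) := by gcongr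
        _ = P ^ σ * (P * m ^ 2) + 7 * (P ^ σ * Y * V) + P ^ σ * (C * M ^ 2 * P / Y ^ b * m ^ 2) := by ring
        _ ≤ P * (P * m ^ 2) + 7 * (P ^ σ * Y * V) + P * (C * M ^ 2 * P / Y ^ b * m ^ 2) := by gcongr
        _ = 1 * (P ^ 2 * m ^ 2) + 7 * (P ^ σ * Y * V) + C * (P ^ 2 * M ^ 2 / Y ^ b * m ^ 2) := by ring
        _ ≤ (7 + C) * (P ^ 2 * m ^ 2) + (7 + C) * (P ^ σ * Y * V)
            + (7 + C) * (P ^ 2 * M ^ 2 / Y ^ b * m ^ 2) := by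
          gcongr <;> linarith
        _ = _ := by ring
    calc _ ≤ ((150000 * M ^ 2 / 2 ^ i : ℝ) ^ h * 4) * ((14 * ((2 ^ (i + 1) : ℕ) : ℝ) / M ^ 2) * T) := by
          gcongr
      _ = ((112 * 150000 ^ h) * ((M : ℝ) ^ 2) ^ (h - 1)) * (((2 : ℝ) ^ i) ^ (1 - h) * T) := by
          rw [← mul_assoc, e1]; ring
      _ ≤ _ := by
          refine (mul_le_mul_of_nonneg_left h6 (by positivity)).trans (le_of_eq ?_)
          ring
  refine (Finset.sum_le_sum hterm).trans (le_of_eq ?_)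
  rw [Finset.sum_const, Finset.card_range, nsmul_eq_mul]
  ring

end

/-- The cube of lattice points with coordinates bounded by `M`. -/
noncomputable def latticeBox (n M : ℕ) : Finset (Fin n → ℤ) :=
  Fintype.piFinset fun _ => Finset.Icc (-(M : ℤ)) M

/-- The product of triangular weights. -/
noncomputable def boxWeight {n : ℕ} (M : ℕ) (ξ : Fin n → ℤ) : ℝ := ∏ i, triWeight M (ξ i)

/-- Fourier coefficients in the space variables. -/
noncomputable def spaceCoeff {n : ℕ} (f : (Fin n → ℝ) → ℂ) (ξ : Fin n → ℤ) : ℂ :=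
  ∫ x, f x * (starRingEnd ℂ) (spaceChar ξ x) ∂(spaceMeas n)

/-- The weighted propagator as a sesquilinear form. -/
noncomputable def propForm {n : ℕ} (M : ℕ) (τ : ℝ) (f h : (Fin n → ℝ) → ℂ) : ℂ :=
  ∑ ξ ∈ latticeBox n M, (boxWeight M ξ : ℂ) * cis (τ * sqNorm ξ) *
    (spaceCoeff f ξ * (starRingEnd ℂ) (spaceCoeff h ξ))

section
variable {n : ℕ}

lemma boxWeight_nonneg (M : ℕ) (ξ : Fin n → ℤ) : 0 ≤ boxWeight M ξ :=
  Finset.prod_nonneg fun _ _ => triWeight_nonneg _ _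

lemma boxWeight_le_one (M : ℕ) (ξ : Fin n → ℤ) : boxWeight M ξ ≤ 1 :=
  Finset.prod_le_one (fun _ _ => triWeight_nonneg _ _) fun _ _ => triWeight_le_one _ _

@[fun_prop] lemma measurable_spaceChar (ξ : Fin n → ℤ) : Measurable (spaceChar ξ) := by
  unfold spaceChar; fun_prop

lemma norm_spaceChar (ξ : Fin n → ℤ) (x : Fin n → ℝ) : ‖spaceChar ξ x‖ = 1 := norm_cis _

lemma sum_boxWeight_mul (M : ℕ) (τ : ℝ) (x y : Fin n → ℝ) :
    ∑ ξ ∈ latticeBox n M, (boxWeight M ξ : ℂ) * cis (τ * sqNorm ξ) *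
      ((starRingEnd ℂ) (spaceChar ξ x) * spaceChar ξ y) = ∏ i, weylSum M τ (y i - x i) := by
  unfold weylSum
  rw [Finset.prod_univ_sum]
  refine Finset.sum_congr rfl fun ξ _ => ?_
  rw [Finset.prod_mul_distrib, ← cis_sum, boxWeight, Complex.ofReal_prod, mul_assoc]
  congr 1
  rw [spaceChar, spaceChar, conj_cis, ← cis_add, ← cis_add]
  congr 1
  rw [sqNorm]; push_cast
  rw [Finset.mul_sum, ← Finset.sum_neg_distrib, ← Finset.sum_add_distrib, ← Finset.sum_add_distrib]
  exact Finset.sum_congr rfl fun i _ => by ring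

lemma norm_prod_weylSum_le {M : ℕ} (hM : 1 ≤ M) (τ : ℝ) (z : Fin n → ℝ) :
    ‖∏ i, weylSum M τ (z i)‖ ≤ weylMajorant M τ ^ ((n : ℝ) / 2) := by
  have hG := weylMajorant_nonneg M τ
  rw [norm_prod]
  have h : ∀ i, ‖weylSum M τ (z i)‖ ≤ weylMajorant M τ ^ (1 / 2 : ℝ) := by
    intro i
    rw [← Real.sqrt_eq_rpow]
    exact Real.le_sqrt_of_sq_le (norm_weylSum_sq_le hM τ (z i))
  refine (Finset.prod_le_prod (fun _ _ => norm_nonneg _) fun i _ => h i).trans (le_of_eq ?_)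
  rw [Finset.prod_const, Finset.card_univ, Fintype.card_fin, ← Real.rpow_natCast, ← Real.rpow_mul hG]
  congr 1; ring

lemma integrable_mul_conj_spaceChar {f : (Fin n → ℝ) → ℂ} (hf : Measurable f) {A : ℝ}
    (hA : ∀ x, ‖f x‖ ≤ A) (ξ : Fin n → ℤ) :
    Integrable (fun x => f x * (starRingEnd ℂ) (spaceChar ξ x)) (spaceMeas n) := by
  refine integrable_of_bound (hf.mul ?_) A fun x => ?_
  · exact Complex.continuous_conj.measurable.comp (measurable_spaceChar ξ)
  · simpa [norm_spaceChar] using hA x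

lemma norm_propForm_le_one {M : ℕ} (hM : 1 ≤ M) (τ : ℝ) {f h : (Fin n → ℝ) → ℂ} (hf : Measurable f)
    (hh : Measurable h) {A : ℝ} (hA : ∀ x, ‖f x‖ ≤ A) (hB : ∀ x, ‖h x‖ ≤ A) :
    ‖propForm M τ f h‖ ≤ weylMajorant M τ ^ ((n : ℝ) / 2) *
      ((∫ x, ‖f x‖ ∂(spaceMeas n)) * ∫ x, ‖h x‖ ∂(spaceMeas n)) := by
  have hG := weylMajorant_nonneg M τ
  have hfi := (integrable_of_bound (μ := spaceMeas n) hf A hA).norm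
  have hhi := (integrable_of_bound (μ := spaceMeas n) hh A hB).norm
  have key : propForm M τ f h = ∫ z : (Fin n → ℝ) × (Fin n → ℝ),
      f z.1 * (starRingEnd ℂ) (h z.2) * ∏ i, weylSum M τ (z.2 i - z.1 i)
        ∂((spaceMeas n).prod (spaceMeas n)) := by
    simp_rw [← sum_boxWeight_mul, Finset.mul_sum]
    have e : ∀ (ξ : Fin n → ℤ) (z : (Fin n → ℝ) × (Fin n → ℝ)),
        f z.1 * (starRingEnd ℂ) (h z.2) * ((boxWeight M ξ : ℂ) * cis (τ * sqNorm ξ) *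
          ((starRingEnd ℂ) (spaceChar ξ z.1) * spaceChar ξ z.2))
        = ((boxWeight M ξ : ℂ) * cis (τ * sqNorm ξ)) *
          ((f z.1 * (starRingEnd ℂ) (spaceChar ξ z.1)) *
            (starRingEnd ℂ) (h z.2 * (starRingEnd ℂ) (spaceChar ξ z.2))) := by
      intro ξ z
      rw [map_mul, Complex.conj_conj]; ring
    simp_rw [e]
    have hc : ∀ ξ : Fin n → ℤ, Integrable (fun x => (starRingEnd ℂ) (h x * (starRingEnd ℂ) (spaceChar ξ x)))
        (spaceMeas n) := fun ξ => by
      refine integrable_of_bound (A := A) ?_ fun x => ?_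
      · exact Complex.continuous_conj.measurable.comp
          (hh.mul (Complex.continuous_conj.measurable.comp (measurable_spaceChar ξ)))
      · simpa [norm_spaceChar] using hB x
    rw [integral_finsetSum _ fun ξ _ =>
      ((integrable_mul_conj_spaceChar hf hA ξ).mul_prod (hc ξ)).const_mul _]
    refine Finset.sum_congr rfl fun ξ _ => ?_
    rw [integral_const_mul, integral_prod_mul (fun x => f x * (starRingEnd ℂ) (spaceChar ξ x))
      (fun x => (starRingEnd ℂ) (h x * (starRingEnd ℂ) (spaceChar ξ x))), integral_conj]
    rfl
  rw [key]
  refine (norm_integral_le_integral_norm _).trans ?_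
  rw [← integral_prod_mul, ← integral_const_mul]
  refine integral_mono_of_nonneg (Filter.Eventually.of_forall fun _ => norm_nonneg _)
    ((hfi.mul_prod hhi).const_mul _) (Filter.Eventually.of_forall fun z => ?_)
  simp only [norm_mul, RCLike.norm_conj]
  have := norm_prod_weylSum_le hM τ (fun i => z.2 i - z.1 i)
  rw [mul_comm]
  gcongr

lemma sum_norm_spaceCoeff_sq_le {f : (Fin n → ℝ) → ℂ} (hf : Measurable f) {A : ℝ}
    (hA : ∀ x, ‖f x‖ ≤ A) (S : Finset (Fin n → ℤ)) :
    ∑ ξ ∈ S, ‖spaceCoeff f ξ‖ ^ 2 ≤ (2 * π) ^ n * ∫ x, ‖f x‖ ^ 2 ∂(spaceMeas n) :=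
  (isOrthoFamily_spaceChar n).bessel (by positivity) S hf A hA

lemma norm_propForm_le_two (M : ℕ) (τ : ℝ) {f h : (Fin n → ℝ) → ℂ} (hf : Measurable f)
    (hh : Measurable h) {A : ℝ} (hA : ∀ x, ‖f x‖ ≤ A) (hB : ∀ x, ‖h x‖ ≤ A) :
    ‖propForm M τ f h‖ ≤ (2 * π) ^ n *
      (√(∫ x, ‖f x‖ ^ 2 ∂(spaceMeas n)) * √(∫ x, ‖h x‖ ^ 2 ∂(spaceMeas n))) := by
  have h1 : ‖propForm M τ f h‖ ≤ ∑ ξ ∈ latticeBox n M, ‖spaceCoeff f ξ‖ * ‖spaceCoeff h ξ‖ := by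
    refine (norm_sum_le _ _).trans (Finset.sum_le_sum fun ξ _ => ?_)
    rw [norm_mul, norm_mul, norm_mul, norm_cis, RCLike.norm_conj, Complex.norm_real, Real.norm_eq_abs,
      abs_of_nonneg (boxWeight_nonneg _ _), mul_one]
    exact mul_le_of_le_one_left (by positivity) (boxWeight_le_one _ _)
  refine h1.trans ((Real.sum_mul_le_sqrt_mul_sqrt _ _ _).trans ?_)
  have h2 := Real.sqrt_le_sqrt (sum_norm_spaceCoeff_sq_le hf hA (latticeBox n M))
  have h3 := Real.sqrt_le_sqrt (sum_norm_spaceCoeff_sq_le hh hB (latticeBox n M))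
  refine (mul_le_mul h2 h3 (by positivity) (by positivity)).trans (le_of_eq ?_)
  rw [Real.sqrt_mul (by positivity), Real.sqrt_mul (by positivity)]
  have := Real.mul_self_sqrt (by positivity : (0 : ℝ) ≤ (2 * π) ^ n)
  linear_combination (√(∫ x, ‖f x‖ ^ 2 ∂(spaceMeas n)) * √(∫ x, ‖h x‖ ^ 2 ∂(spaceMeas n))) * this

section
variable {g : ℝ × (Fin n → ℝ) → ℂ} {A : ℝ}

lemma measurable_spaceCoeff (hg : Measurable g) (ξ : Fin n → ℤ) :
    Measurable fun t => spaceCoeff (fun x => g (t, x)) ξ := by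
  have hm : Measurable (fun q : ℝ × (Fin n → ℝ) => g q * (starRingEnd ℂ) (spaceChar ξ q.2)) :=
    hg.mul (Complex.continuous_conj.measurable.comp ((measurable_spaceChar ξ).comp measurable_snd))
  exact (hm.stronglyMeasurable.integral_prod_right (ν := spaceMeas n)).measurable

lemma norm_spaceCoeff_le_const (hA : ∀ q, ‖g q‖ ≤ A) (ξ : Fin n → ℤ) (t : ℝ) :
    ‖spaceCoeff (fun x => g (t, x)) ξ‖ ≤ A * (spaceMeas n).real Set.univ := by
  refine (norm_integral_le_of_norm_le_const (C := A) (Filter.Eventually.of_forall fun x => ?_))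
  simpa [norm_spaceChar] using hA (t, x)

lemma measurable_propForm (hg : Measurable g) (M : ℕ) :
    Measurable fun z : ℝ × ℝ =>
      propForm M (z.1 - z.2) (fun x => g (z.1, x)) (fun x => g (z.2, x)) := by
  unfold propForm
  refine Finset.measurable_sum _ fun ξ _ => ?_
  exact (measurable_const.mul (by fun_prop)).mul (((measurable_spaceCoeff hg ξ).comp measurable_fst).mul
    (Complex.continuous_conj.measurable.comp ((measurable_spaceCoeff hg ξ).comp measurable_snd)))

lemma integrable_propForm (hg : Measurable g) (hA : ∀ q, ‖g q‖ ≤ A) (M : ℕ) :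
    Integrable (fun z : ℝ × ℝ =>
      propForm M (z.1 - z.2) (fun x => g (z.1, x)) (fun x => g (z.2, x))) (timeMeas.prod timeMeas) := by
  refine integrable_of_bound (measurable_propForm hg M)
    (∑ ξ ∈ latticeBox n M, (A * (spaceMeas n).real Set.univ) * (A * (spaceMeas n).real Set.univ)) fun z => ?_
  refine (norm_sum_le _ _).trans (Finset.sum_le_sum fun ξ _ => ?_)
  rw [norm_mul, norm_mul, norm_mul, norm_cis, RCLike.norm_conj, Complex.norm_real, Real.norm_eq_abs,
    abs_of_nonneg (boxWeight_nonneg _ _), mul_one]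
  refine (mul_le_of_le_one_left (by positivity) (boxWeight_le_one _ _)).trans ?_
  have h1 := norm_spaceCoeff_le_const hA ξ z.1
  have h2 := norm_spaceCoeff_le_const hA ξ z.2
  exact mul_le_mul h1 h2 (norm_nonneg _) ((norm_nonneg _).trans h1)

lemma stCoeff_eq (hg : Measurable g) (hA : ∀ q, ‖g q‖ ≤ A) (ξ : Fin n → ℤ) :
    ∫ q, g q * (starRingEnd ℂ) (stChar (sqNorm ξ, ξ) q) ∂(stMeas n)
      = ∫ t, cis (t * sqNorm ξ) * spaceCoeff (fun x => g (t, x)) ξ ∂timeMeas := by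
  have hm : Measurable fun q : ℝ × (Fin n → ℝ) => g q * (starRingEnd ℂ) (stChar (sqNorm ξ, ξ) q) :=
    hg.mul (Complex.continuous_conj.measurable.comp (by unfold stChar; fun_prop))
  rw [integral_prod _ (integrable_of_bound hm A fun q => by simpa [stChar, norm_cis] using hA q)]
  congr 1; ext t
  rw [spaceCoeff, ← integral_const_mul]
  congr 1; ext x
  have : (starRingEnd ℂ) (stChar (sqNorm ξ, ξ) (t, x))
      = cis (t * sqNorm ξ) * (starRingEnd ℂ) (spaceChar ξ x) := by
    rw [stChar, spaceChar, conj_cis, conj_cis, ← cis_add]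
    congr 1; ring
  rw [this]; ring

lemma sum_boxWeight_mul_stCoeff_sq (hg : Measurable g) (hA : ∀ q, ‖g q‖ ≤ A) (M : ℕ) :
    ((∑ ξ ∈ latticeBox n M, boxWeight M ξ *
      ‖∫ q, g q * (starRingEnd ℂ) (stChar (sqNorm ξ, ξ) q) ∂(stMeas n)‖ ^ 2 : ℝ) : ℂ)
      = ∫ z : ℝ × ℝ, propForm M (z.1 - z.2) (fun x => g (z.1, x)) (fun x => g (z.2, x))
        ∂(timeMeas.prod timeMeas) := by
  unfold propForm
  have hi : ∀ ξ : Fin n → ℤ, Integrable (fun t => cis (t * sqNorm ξ) *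
      spaceCoeff (fun x => g (t, x)) ξ) timeMeas := fun ξ =>
    integrable_of_bound (Measurable.mul (by fun_prop) (measurable_spaceCoeff hg ξ)) _ fun t => by
      rw [norm_mul, norm_cis, one_mul]; exact norm_spaceCoeff_le_const hA ξ t
  have hi' : ∀ ξ : Fin n → ℤ, Integrable (fun t => (starRingEnd ℂ) (cis (t * sqNorm ξ) *
      spaceCoeff (fun x => g (t, x)) ξ)) timeMeas := fun ξ =>
    integrable_of_bound (Complex.continuous_conj.measurable.comp
      (Measurable.mul (by fun_prop) (measurable_spaceCoeff hg ξ))) _ fun t => by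
      rw [RCLike.norm_conj, norm_mul, norm_cis, one_mul]; exact norm_spaceCoeff_le_const hA ξ t
  have e : ∀ (ξ : Fin n → ℤ) (z : ℝ × ℝ), (boxWeight M ξ : ℂ) * cis ((z.1 - z.2) * sqNorm ξ) *
      (spaceCoeff (fun x => g (z.1, x)) ξ * (starRingEnd ℂ) (spaceCoeff (fun x => g (z.2, x)) ξ))
      = (boxWeight M ξ : ℂ) * ((cis (z.1 * sqNorm ξ) * spaceCoeff (fun x => g (z.1, x)) ξ) *
        (starRingEnd ℂ) (cis (z.2 * sqNorm ξ) * spaceCoeff (fun x => g (z.2, x)) ξ)) := by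
    intro ξ z
    rw [map_mul, conj_cis, sub_mul, sub_eq_add_neg, cis_add]; ring
  simp_rw [e]
  rw [integral_finsetSum _ fun ξ _ => ((hi ξ).mul_prod (hi' ξ)).const_mul _, Complex.ofReal_sum]
  refine Finset.sum_congr rfl fun ξ _ => ?_
  rw [integral_const_mul, integral_prod_mul (fun t => cis (t * sqNorm ξ) *
      spaceCoeff (fun x => g (t, x)) ξ) (fun t => (starRingEnd ℂ) (cis (t * sqNorm ξ) *
      spaceCoeff (fun x => g (t, x)) ξ)), integral_conj, ← stCoeff_eq hg hA, Complex.mul_conj']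
  push_cast; rfl

lemma norm_integral_wave_sq_le {M : ℕ} (hM : 1 ≤ M) (hg : Measurable g) (hA : ∀ q, ‖g q‖ ≤ A)
    (S : Finset (Fin n → ℤ)) (a : (Fin n → ℤ) → ℂ) (hS : ∀ ξ ∈ S, ∀ i, 2 * |ξ i| ≤ M) :
    ‖∫ q, g q * (starRingEnd ℂ) (wave S a q) ∂(stMeas n)‖ ^ 2 ≤
      2 ^ n * (∑ ξ ∈ S, ‖a ξ‖ ^ 2) *
        ∫ z : ℝ × ℝ, ‖propForm M (z.1 - z.2) (fun x => g (z.1, x)) (fun x => g (z.2, x))‖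
          ∂(timeMeas.prod timeMeas) := by
  classical
  set c : (Fin n → ℤ) → ℂ := fun ξ => ∫ q, g q * (starRingEnd ℂ) (stChar (sqNorm ξ, ξ) q) ∂(stMeas n) with hc
  have h1 : ∫ q, g q * (starRingEnd ℂ) (wave S a q) ∂(stMeas n)
      = ∑ ξ ∈ S, (starRingEnd ℂ) (a ξ) * c ξ := by
    unfold wave
    simp_rw [map_sum, map_mul, Finset.mul_sum]
    have hm : ∀ ξ : Fin n → ℤ, Integrable (fun q : ℝ × (Fin n → ℝ) =>
        g q * (starRingEnd ℂ) (stChar (sqNorm ξ, ξ) q)) (stMeas n) := fun ξ =>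
      integrable_of_bound (hg.mul (Complex.continuous_conj.measurable.comp
        (by unfold stChar; fun_prop))) A fun q => by simpa [stChar, norm_cis] using hA q
    have e : ∀ (ξ : Fin n → ℤ) (q : ℝ × (Fin n → ℝ)),
        g q * ((starRingEnd ℂ) (a ξ) * (starRingEnd ℂ) (stChar (sqNorm ξ, ξ) q))
        = (starRingEnd ℂ) (a ξ) * (g q * (starRingEnd ℂ) (stChar (sqNorm ξ, ξ) q)) := fun ξ q => by ring
    simp_rw [e]
    rw [integral_finsetSum _ fun ξ _ => (hm ξ).const_mul _]
    exact Finset.sum_congr rfl fun ξ _ => integral_const_mul _ _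
  have h2 : ‖∑ ξ ∈ S, (starRingEnd ℂ) (a ξ) * c ξ‖ ^ 2 ≤ (∑ ξ ∈ S, ‖a ξ‖ ^ 2) * ∑ ξ ∈ S, ‖c ξ‖ ^ 2 := by
    refine le_trans ?_ (Finset.sum_mul_sq_le_sq_mul_sq _ _ _)
    gcongr
    refine (norm_sum_le _ _).trans (le_of_eq ?_)
    simp
  have h3 : ∑ ξ ∈ S, ‖c ξ‖ ^ 2 ≤ 2 ^ n * ∑ ξ ∈ latticeBox n M, boxWeight M ξ * ‖c ξ‖ ^ 2 := by
    have hsub : S ⊆ latticeBox n M := fun ξ hξ => by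
      refine Fintype.mem_piFinset.2 fun i => ?_
      have := hS ξ hξ i
      rw [abs_eq_max_neg] at this
      rw [Finset.mem_Icc]; omega
    have hw : ∀ ξ ∈ S, 1 ≤ 2 ^ n * boxWeight M ξ := by
      intro ξ hξ
      have : ∏ _i : Fin n, (1 / 2 : ℝ) ≤ boxWeight M ξ :=
        Finset.prod_le_prod (fun _ _ => by norm_num) fun i _ => half_le_triWeight hM (hS ξ hξ i)
      rw [Finset.prod_const, Finset.card_univ, Fintype.card_fin] at this
      calc (1 : ℝ) = 2 ^ n * (1 / 2) ^ n := by rw [← mul_pow]; norm_num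
        _ ≤ _ := by gcongr
    calc ∑ ξ ∈ S, ‖c ξ‖ ^ 2 ≤ ∑ ξ ∈ S, 2 ^ n * (boxWeight M ξ * ‖c ξ‖ ^ 2) := by
          refine Finset.sum_le_sum fun ξ hξ => ?_
          rw [← mul_assoc]
          exact le_mul_of_one_le_left (by positivity) (hw ξ hξ)
      _ ≤ _ := by
          rw [Finset.mul_sum]
          exact Finset.sum_le_sum_of_subset_of_nonneg hsub fun ξ _ _ =>
            mul_nonneg (by positivity) (mul_nonneg (boxWeight_nonneg _ _) (by positivity))
  have h4 : ∑ ξ ∈ latticeBox n M, boxWeight M ξ * ‖c ξ‖ ^ 2 ≤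
      ∫ z : ℝ × ℝ, ‖propForm M (z.1 - z.2) (fun x => g (z.1, x)) (fun x => g (z.2, x))‖
          ∂(timeMeas.prod timeMeas) := by
    refine le_trans (le_abs_self _) ?_
    rw [← Real.norm_eq_abs, ← Complex.norm_real, sum_boxWeight_mul_stCoeff_sq hg hA]
    exact norm_integral_le_integral_norm _
  rw [h1]
  refine h2.trans ((mul_le_mul_of_nonneg_left (h3.trans (mul_le_mul_of_nonneg_left h4 (by positivity)))
    (by positivity)).trans (le_of_eq ?_))
  ring

end

end

lemma nat_le_rpow_two_pow {η : ℝ} (hη : 0 < η) (i : ℕ) :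
    (i : ℝ) ≤ 1 / (η * log 2) * ((2 : ℝ) ^ i) ^ η := by
  have hl : 0 < log 2 := Real.log_pos (by norm_num)
  have h := Real.add_one_le_exp (η * log 2 * i)
  have e : exp (η * log 2 * i) = ((2 : ℝ) ^ i) ^ η := by
    rw [Real.rpow_def_of_pos (by positivity), Real.log_pow]; congr 1; ring
  rw [e] at h
  rw [one_div, inv_mul_eq_div, le_div_iff₀ (by positivity)]
  linarith

section
variable {n : ℕ}

lemma integral_space_wave_sq (S : Finset (Fin n → ℤ)) (a : (Fin n → ℤ) → ℂ) (t : ℝ) :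
    ∫ x, ‖wave S a (t, x)‖ ^ 2 ∂(spaceMeas n) = (2 * π) ^ n * ∑ ξ ∈ S, ‖a ξ‖ ^ 2 := by
  have h := (isOrthoFamily_spaceChar n).parseval S (fun ξ => a ξ * cis (-(t * sqNorm ξ)))
  simp only [norm_mul, norm_cis, mul_one] at h
  rw [← h]
  congr 1; ext x
  congr 2
  refine Finset.sum_congr rfl fun ξ _ => ?_
  rw [mul_assoc, stChar, spaceChar, ← cis_add]
  congr 2; ring

/-- The normalised wave on a superlevel set. -/
noncomputable def levelPhase (S : Finset (Fin n → ℤ)) (a : (Fin n → ℤ) → ℂ) (lam : ℝ)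
    (q : ℝ × (Fin n → ℝ)) : ℂ :=
  {q | lam < ‖wave S a q‖}.indicator (fun q => wave S a q / (‖wave S a q‖ : ℂ)) q

lemma measurableSet_level (S : Finset (Fin n → ℤ)) (a : (Fin n → ℤ) → ℂ) (lam : ℝ) :
    MeasurableSet {q | lam < ‖wave S a q‖} :=
  measurableSet_lt measurable_const (wave_measurable S a).norm

lemma measurable_levelPhase (S : Finset (Fin n → ℤ)) (a : (Fin n → ℤ) → ℂ) (lam : ℝ) :
    Measurable (levelPhase S a lam) := by
  unfold levelPhase
  exact ((wave_measurable S a).div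
    (Complex.measurable_ofReal.comp (wave_measurable S a).norm)).indicator (measurableSet_level S a lam)

lemma norm_levelPhase {lam : ℝ} (hl : 0 < lam) (S : Finset (Fin n → ℤ)) (a : (Fin n → ℤ) → ℂ)
    (q : ℝ × (Fin n → ℝ)) :
    ‖levelPhase S a lam q‖ = {q | lam < ‖wave S a q‖}.indicator (fun _ => (1 : ℝ)) q := by
  unfold levelPhase
  by_cases h : q ∈ {q | lam < ‖wave S a q‖}
  · have h0 : ‖wave S a q‖ ≠ 0 := (hl.trans h).ne'
    rw [Set.indicator_of_mem h, Set.indicator_of_mem h, norm_div, Complex.norm_real, norm_norm,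
      div_self h0]
  · rw [Set.indicator_of_notMem h, Set.indicator_of_notMem h, norm_zero]

lemma norm_levelPhase_le {lam : ℝ} (hl : 0 < lam) (S : Finset (Fin n → ℤ)) (a : (Fin n → ℤ) → ℂ)
    (q : ℝ × (Fin n → ℝ)) : ‖levelPhase S a lam q‖ ≤ 1 := by
  rw [norm_levelPhase hl]
  exact Set.indicator_le_self' (fun _ _ => zero_le_one) q |>.trans le_rfl

lemma level_le_norm_integral {lam : ℝ} (hl : 0 < lam) (S : Finset (Fin n → ℤ)) (a : (Fin n → ℤ) → ℂ) :
    lam * (stMeas n).real {q | lam < ‖wave S a q‖} ≤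
      ‖∫ q, levelPhase S a lam q * (starRingEnd ℂ) (wave S a q) ∂(stMeas n)‖ := by
  set E := {q | lam < ‖wave S a q‖} with hE
  have hEm := measurableSet_level S a lam
  have e : ∀ q, levelPhase S a lam q * (starRingEnd ℂ) (wave S a q)
      = ((E.indicator (fun q => ‖wave S a q‖) q : ℝ) : ℂ) := by
    intro q
    unfold levelPhase
    by_cases h : q ∈ E
    · have h0 : (‖wave S a q‖ : ℂ) ≠ 0 := by exact_mod_cast (hl.trans h).ne'
      rw [Set.indicator_of_mem h, Set.indicator_of_mem h, div_mul_eq_mul_div, Complex.mul_conj',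
        sq, mul_div_cancel_right₀ _ h0]
    · rw [Set.indicator_of_notMem h, Set.indicator_of_notMem h]; simp
  simp_rw [e]
  rw [integral_complex_ofReal, Complex.norm_real]
  refine le_trans ?_ (le_abs_self _)
  have hi : Integrable (fun q => E.indicator (fun q => ‖wave S a q‖) q) (stMeas n) :=
    ((integrable_of_bound (wave_measurable S a) _ (wave_norm_le S a)).norm).indicator hEm
  have hc : Integrable (fun q => E.indicator (fun _ => lam) q) (stMeas n) :=
    (integrable_const lam).indicator hEm
  have := integral_mono hc hi fun q => Set.indicator_le_indicator' (fun h => le_of_lt h)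
  rw [integral_indicator_const _ hEm, smul_eq_mul] at this
  linarith

lemma measurable_slice_norm {g : ℝ × (Fin n → ℝ) → ℂ} (hg : Measurable g) :
    Measurable fun t => ∫ x, ‖g (t, x)‖ ∂(spaceMeas n) :=
  (hg.norm.stronglyMeasurable.integral_prod_right (ν := spaceMeas n)).measurable

lemma level_sq_le {M : ℕ} (hM : 1 ≤ M) {lam : ℝ} (hl : 0 < lam) (S : Finset (Fin n → ℤ))
    (a : (Fin n → ℤ) → ℂ) (hS : ∀ ξ ∈ S, ∀ i, 2 * |ξ i| ≤ M) (ha : ∑ ξ ∈ S, ‖a ξ‖ ^ 2 ≤ 1) :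
    ∃ F : ℝ → ℝ, Measurable F ∧ (∀ t, 0 ≤ F t) ∧ (∀ t, F t ≤ (2 * π) ^ n / lam ^ 2) ∧
      ∫ t, F t ∂timeMeas = (stMeas n).real {q | lam < ‖wave S a q‖} ∧
      (lam * ∫ t, F t ∂timeMeas) ^ 2 ≤ 2 ^ n * ∫ z : ℝ × ℝ,
        F z.1 * F z.2 * weylMajorant M (z.1 - z.2) ^ ((n : ℝ) / 2) ∂(timeMeas.prod timeMeas) := by
  set g := levelPhase S a lam with hgdef
  have hg : Measurable g := measurable_levelPhase S a lam
  have hg1 := norm_levelPhase_le hl S a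
  set E := {q | lam < ‖wave S a q‖} with hE
  have hEm : MeasurableSet E := measurableSet_level S a lam
  have hgi : Integrable (fun q => ‖g q‖) (stMeas n) := (integrable_of_bound hg 1 hg1).norm
  have h0 : ∀ t, 0 ≤ ∫ x, ‖g (t, x)‖ ∂(spaceMeas n) := fun t => integral_nonneg fun _ => norm_nonneg _
  have hb : ∀ t, ∫ x, ‖g (t, x)‖ ∂(spaceMeas n) ≤ (2 * π) ^ n / lam ^ 2 := by
    intro t
    rw [le_div_iff₀ (by positivity), mul_comm, ← integral_const_mul]
    have hwi : Integrable (fun x => ‖wave S a (t, x)‖ ^ 2) (spaceMeas n) := by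
      refine Integrable.of_bound (((wave_measurable S a).comp measurable_prodMk_left).norm.pow_const
        2).aestronglyMeasurable ((∑ ξ ∈ S, ‖a ξ‖) ^ 2) (Filter.Eventually.of_forall fun x => ?_)
      rw [Real.norm_eq_abs, abs_of_nonneg (by positivity)]
      have := wave_norm_le S a (t, x)
      gcongr
    refine (integral_mono_of_nonneg (Filter.Eventually.of_forall fun x => by positivity) hwi
      (Filter.Eventually.of_forall fun x => ?_)).trans ?_
    · change lam ^ 2 * ‖g (t, x)‖ ≤ ‖wave S a (t, x)‖ ^ 2
      rw [hgdef, norm_levelPhase hl]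
      by_cases h : (t, x) ∈ E
      · rw [Set.indicator_of_mem h, mul_one]
        have h : lam < ‖wave S a (t, x)‖ := h
        gcongr
      · rw [Set.indicator_of_notMem h, mul_zero]; positivity
    · rw [integral_space_wave_sq]
      exact mul_le_of_le_one_right (by positivity) ha
  have hm : ∫ t, ∫ x, ‖g (t, x)‖ ∂(spaceMeas n) ∂timeMeas = (stMeas n).real E := by
    rw [← integral_prod _ hgi]
    simp_rw [hgdef, norm_levelPhase hl]
    rw [integral_indicator_const _ hEm]; simp
  refine ⟨fun t => ∫ x, ‖g (t, x)‖ ∂(spaceMeas n), measurable_slice_norm hg, h0, hb, hm, ?_⟩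
  rw [hm]
  calc _ ≤ ‖∫ q, g q * (starRingEnd ℂ) (wave S a q) ∂(stMeas n)‖ ^ 2 := by
        gcongr; exact level_le_norm_integral hl S a
    _ ≤ _ := norm_integral_wave_sq_le hM hg hg1 S a hS
    _ ≤ 2 ^ n * 1 * ∫ z : ℝ × ℝ, ‖propForm M (z.1 - z.2) (fun x => g (z.1, x)) (fun x => g (z.2, x))‖
          ∂(timeMeas.prod timeMeas) := by
        gcongr
    _ ≤ _ := by
        rw [mul_one]
        gcongr
        · exact (integrable_propForm hg hg1 M).norm
        · refine integrable_mul_weylMajorant (measurable_slice_norm hg)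
            (A := (2 * π) ^ n / lam ^ 2) (fun t => ?_) M (by positivity)
          rw [abs_of_nonneg (h0 t)]; exact hb t
        · intro z
          have := norm_propForm_le_one hM (z.1 - z.2) (f := fun x => g (z.1, x))
            (h := fun x => g (z.2, x)) (hg.comp measurable_prodMk_left)
            (hg.comp measurable_prodMk_left) (fun x => hg1 _) (fun x => hg1 _)
          simpa [mul_comm] using this

end

lemma level_ineq_absorb {X Q d m a t : ℝ} (hd : 1 ≤ d) (hX : 0 < X) (hm : 0 ≤ m)
    (hQ : X / d * m ^ 2 ≤ Q + a + t * m + a) (h1 : Q ≤ X * m ^ 2 / (16 * d))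
    (h2 : a ≤ X * m ^ 2 / (8 * d)) (ht : 0 ≤ t) : m ≤ 2 * d * t / X := by
  rcases hm.eq_or_lt with rfl | hm
  · positivity
  have e : X / d * m ^ 2 = X * m ^ 2 / d := by ring
  have e1 : X * m ^ 2 / (16 * d) = X * m ^ 2 / d / 16 := by field_simp
  have e2 : X * m ^ 2 / (8 * d) = X * m ^ 2 / d / 8 := by field_simp
  rw [e] at hQ; rw [e1] at h1; rw [e2] at h2
  have h0 : 0 ≤ X * m ^ 2 / d := by positivity
  have h3 : X * m ^ 2 / d ≤ 2 * (t * m) := by linarith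
  rw [div_le_iff₀ (by positivity)] at h3
  rw [le_div_iff₀ hX]
  refine le_of_mul_le_mul_right ?_ hm
  nlinarith

lemma exists_dyadic_near {A D : ℝ} (hA : 1 ≤ A) (hD : 1 ≤ D) :
    ∃ i : ℕ, A * D ^ 4 < (2 : ℝ) ^ i ∧ (2 : ℝ) ^ i ≤ 2 * A * D ^ 4 := by
  obtain ⟨k, h1, h2⟩ := exists_nat_pow_near (x := A * D ^ 4) (y := 2)
    (one_le_mul_of_one_le_of_one_le hA (one_le_pow₀ hD)) (by norm_num)
  exact ⟨k + 1, h2, by rw [pow_succ]; linarith⟩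

set_option maxHeartbeats 1000000 in
lemma exists_volume_level_le {n : ℕ} (hn : 1 ≤ n) {σ ε : ℝ} (hσ : 0 ≤ σ) (hσ1 : σ ≤ 1)
    (hnσ : 1 - (n : ℝ) / 2 ≤ σ) (hε : 0 < ε) :
    ∃ C K : ℝ, 0 < C ∧ 1 ≤ K ∧ ∀ (M : ℕ) (D : ℝ) (S : Finset (Fin n → ℤ)) (a : (Fin n → ℤ) → ℂ),
      1 ≤ M → 1 ≤ D → K * D ^ 11 ≤ (M : ℝ) ^ 2 → (∀ ξ ∈ S, ∀ i, 2 * |ξ i| ≤ M) →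
      ∑ ξ ∈ S, ‖a ξ‖ ^ 2 ≤ 1 →
      (stMeas n).real {q | (M : ℝ) ^ ((n : ℝ) / 2) / D < ‖wave S a q‖}
        ≤ C * D ^ (4 + 4 * σ + ε) / (M : ℝ) ^ (n + 2) := by
  obtain ⟨b, hb⟩ := exists_nat_ge (22 / ε)
  have hb11 : 11 ≤ ε / 2 * b := by
    rw [div_le_iff₀ hε] at hb; linarith
  have hb1 : 1 ≤ b := by
    rcases Nat.eq_zero_or_pos b with rfl | h
    · norm_num at hb11
    · exact h
  obtain ⟨C, hC, hmain⟩ := exists_integral_weylMajorant_le b (h := (n : ℝ) / 2) (by positivity)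
    hσ hσ1 hnσ
  obtain ⟨A, hA⟩ : ∃ A : ℝ, A = 150000 * 1024 := ⟨_, rfl⟩
  have hA1 : 1 ≤ A := by norm_num [hA]
  set c₁ : ℝ := 1 / (1 / 4 * log 2) * (2 * A) with hc₁
  set c₂ : ℝ := 1 / (ε / 8 * log 2) * (2 * A) ^ (ε / 8) with hc₂
  have hl : 0 < log 2 := Real.log_pos (by norm_num)
  have hc₁0 : 0 < c₁ := by positivity
  have hc₂0 : 0 < c₂ := by positivity
  set K : ℝ := max (14 * A) (2 ^ n * C * c₁ * (4 * A ^ 2) * 8) with hK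
  have hK1 : 1 ≤ K := le_trans (by linarith) (le_max_left _ _)
  refine ⟨2 * (2 ^ n * C * c₂ * (2 * A) * K * (2 * π) ^ n), K, by positivity, hK1, ?_⟩
  intro M D S a hM hD hKD hS ha
  have hM0 : (0 : ℝ) < M := by exact_mod_cast hM
  have hD0 : 0 < D := by linarith
  obtain ⟨i, hi1, hi2⟩ := exists_dyadic_near hA1 hD
  set P : ℝ := (2 : ℝ) ^ i with hP
  have hP0 : 0 < P := by positivity
  have hP1 : 1 ≤ P := one_le_pow₀ (by norm_num)
  set X : ℝ := (M : ℝ) ^ n with hX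
  have hX0 : 0 < X := by positivity
  have hXr : ((M : ℝ) ^ 2) ^ ((n : ℝ) / 2) = X := by
    rw [← Real.rpow_natCast (M : ℝ) 2, ← Real.rpow_mul hM0.le, hX, ← Real.rpow_natCast]
    congr 1; push_cast; ring
  have hsq : ((M : ℝ) ^ ((n : ℝ) / 2)) ^ 2 = X := by
    rw [← hXr, ← Real.rpow_natCast, ← Real.rpow_natCast, ← Real.rpow_mul hM0.le,
      ← Real.rpow_mul hM0.le]
    congr 1; ring
  have hi₁ : (i : ℝ) ≤ c₁ * D := by
    refine (nat_le_rpow_two_pow (η := 1 / 4) (by norm_num) i).trans ?_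
    rw [hc₁, mul_assoc]
    refine mul_le_mul_of_nonneg_left ?_ (by positivity)
    calc P ^ (1 / 4 : ℝ) ≤ (2 * A * D ^ 4) ^ (1 / 4 : ℝ) := Real.rpow_le_rpow hP0.le hi2 (by norm_num)
      _ = (2 * A) ^ (1 / 4 : ℝ) * D := by
        rw [Real.mul_rpow (by positivity) (by positivity), ← Real.rpow_natCast, ← Real.rpow_mul hD0.le]
        norm_num
      _ ≤ 2 * A * D := by
        refine mul_le_mul_of_nonneg_right ?_ hD0.le
        exact (Real.rpow_le_rpow_of_exponent_le (by linarith) (by norm_num)).trans_eq (Real.rpow_one _)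
  have hi₂ : (i : ℝ) ≤ c₂ * D ^ (ε / 2) := by
    refine (nat_le_rpow_two_pow (η := ε / 8) (by positivity) i).trans ?_
    rw [hc₂, mul_assoc]
    refine mul_le_mul_of_nonneg_left ?_ (by positivity)
    calc P ^ (ε / 8) ≤ (2 * A * D ^ 4) ^ (ε / 8) := Real.rpow_le_rpow hP0.le hi2 (by positivity)
      _ = (2 * A) ^ (ε / 8) * D ^ (ε / 2) := by
        rw [Real.mul_rpow (by positivity) (by positivity), ← Real.rpow_natCast, ← Real.rpow_mul hD0.le]
        congr 2; push_cast; ring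
  have hPσ : P ^ σ ≤ 2 * A * D ^ (4 * σ) := by
    calc P ^ σ ≤ (2 * A * D ^ 4) ^ σ := Real.rpow_le_rpow hP0.le hi2 hσ
      _ = (2 * A) ^ σ * D ^ (4 * σ) := by
        rw [Real.mul_rpow (by positivity) (by positivity), ← Real.rpow_natCast, ← Real.rpow_mul hD0.le]
        norm_num
      _ ≤ _ := by
        refine mul_le_mul_of_nonneg_right ?_ (by positivity)
        exact (Real.rpow_le_rpow_of_exponent_le (by linarith) hσ1).trans_eq (Real.rpow_one _)
  have hPM : 7 * 2 ^ i ≤ M ^ 2 := by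
    have : 7 * P ≤ (M : ℝ) ^ 2 := by
      calc 7 * P ≤ 14 * A * D ^ 4 := by linarith
        _ ≤ K * D ^ 11 := by
          refine mul_le_mul (le_max_left _ _) (pow_le_pow_right₀ hD (by norm_num)) (by positivity)
            (by positivity)
        _ ≤ _ := hKD
    rw [hP] at this
    exact_mod_cast this
  set Y : ℝ := K * D ^ (ε / 2) with hY
  have hY0 : 0 < Y := by positivity
  have hYb : K * D ^ 11 ≤ Y ^ b := by
    rw [hY, mul_pow]
    refine mul_le_mul (le_self_pow₀ hK1 (by omega)) ?_ (by positivity) (by positivity)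
    rw [← Real.rpow_natCast (D ^ (ε / 2)) b, ← Real.rpow_mul hD0.le, ← Real.rpow_natCast D 11]
    exact Real.rpow_le_rpow_of_exponent_le hD (by exact_mod_cast hb11)
  set lam := (M : ℝ) ^ ((n : ℝ) / 2) / D with hlam
  have hlam0 : 0 < lam := by positivity
  have hlam2 : lam ^ 2 = X / D ^ 2 := by rw [hlam, div_pow, hsq]
  obtain ⟨F, hF, h0, hFb, hFm, hFE⟩ := level_sq_le hM hlam0 S a hS ha
  rw [← hFm]
  have hFa : ∀ t, |F t| ≤ (2 * π) ^ n / lam ^ 2 := fun t => by rw [abs_of_nonneg (h0 t)]; exact hFb t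
  have hW := hmain F _ hF hFa h0 M i Y hM hPM hY0
  set m := ∫ t, F t ∂timeMeas with hm
  have hm0 : 0 ≤ m := integral_nonneg h0
  have hFi : Integrable F timeMeas :=
    Integrable.of_bound hF.aestronglyMeasurable _ (Filter.Eventually.of_forall hFa)
  have hF2 : ∫ t, F t ^ 2 ∂timeMeas ≤ (2 * π) ^ n * D ^ 2 / X * m := by
    rw [hm, ← integral_const_mul]
    refine integral_mono_of_nonneg (Filter.Eventually.of_forall fun t => by positivity)
      (hFi.const_mul _) (Filter.Eventually.of_forall fun t => ?_)
    have := hFb t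
    rw [hlam2, div_div_eq_mul_div] at this
    change F t ^ 2 ≤ _
    rw [sq]
    exact mul_le_mul_of_nonneg_right this (h0 t)
  have hXh : ((M : ℝ) ^ 2) ^ ((n : ℝ) / 2 - 1) = X / M ^ 2 := by
    rw [Real.rpow_sub_one (by positivity), hXr]
  rw [hXh] at hW
  set Q : ℝ := 2 ^ n * ((150000 * M ^ 2 / P) ^ ((n : ℝ) / 2) * m ^ 2) with hQ
  set t : ℝ := 2 ^ n * C * c₂ * (2 * A) * K * (2 * π) ^ n * D ^ (2 + 4 * σ + ε) / M ^ 2 with ht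
  set e : ℝ := X * m ^ 2 / (8 * D ^ 2) with he
  have hR : 2 ^ n * C * i * P ^ 2 * (8 * D ^ 2) ≤ K * D ^ 11 := by
    calc 2 ^ n * C * i * P ^ 2 * (8 * D ^ 2)
        ≤ 2 ^ n * C * (c₁ * D) * (2 * A * D ^ 4) ^ 2 * (8 * D ^ 2) := by gcongr
      _ = (2 ^ n * C * c₁ * (4 * A ^ 2) * 8) * D ^ 11 := by ring
      _ ≤ _ := mul_le_mul_of_nonneg_right (le_max_right _ _) (by positivity)
  have hT1 : 2 ^ n * (C * i * (X / M ^ 2) * (P ^ 2 * m ^ 2)) ≤ e := by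
    rw [he, le_div_iff₀ (by positivity)]
    have h1 := div_le_one_of_le₀ (hR.trans hKD) (by positivity)
    calc _ = (2 ^ n * C * i * P ^ 2 * (8 * D ^ 2) / M ^ 2) * (X * m ^ 2) := by ring
      _ ≤ 1 * (X * m ^ 2) := mul_le_mul_of_nonneg_right h1 (by positivity)
      _ = _ := one_mul _
  have hT3 : 2 ^ n * (C * i * (X / M ^ 2) * (P ^ 2 * M ^ 2 / Y ^ b * m ^ 2)) ≤ e := by
    rw [he, le_div_iff₀ (by positivity)]
    have h1 := div_le_one_of_le₀ (hR.trans hYb) (by positivity)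
    calc _ = (2 ^ n * C * i * P ^ 2 * (8 * D ^ 2) / Y ^ b) * (X * m ^ 2) := by field_simp
      _ ≤ 1 * (X * m ^ 2) := mul_le_mul_of_nonneg_right h1 (by positivity)
      _ = _ := one_mul _
  have hT2 : 2 ^ n * (C * i * (X / M ^ 2) * (P ^ σ * Y * ∫ t, F t ^ 2 ∂timeMeas)) ≤ t * m := by
    calc _ ≤ 2 ^ n * (C * (c₂ * D ^ (ε / 2)) * (X / M ^ 2)
          * ((2 * A * D ^ (4 * σ)) * (K * D ^ (ε / 2)) * ((2 * π) ^ n * D ^ 2 / X * m))) := by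
          have : 0 ≤ ∫ t, F t ^ 2 ∂timeMeas := integral_nonneg fun _ => sq_nonneg _
          gcongr
      _ = 2 ^ n * C * c₂ * (2 * A) * K * (2 * π) ^ n * (D ^ (ε / 2) * D ^ (ε / 2) * D ^ 2 * D ^ (4 * σ))
          / M ^ 2 * m := by field_simp
      _ = _ := by
        rw [ht]
        congr 3
        rw [← Real.rpow_natCast D 2, ← Real.rpow_add hD0, ← Real.rpow_add hD0, ← Real.rpow_add hD0]
        congr 1; push_cast; ring
  have hQ1 : Q ≤ X * m ^ 2 / (16 * D ^ 2) := by
    have h1 : (150000 * M ^ 2 / P) ^ ((n : ℝ) / 2) ≤ (1 / (32 * D ^ 2)) ^ n * X := by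
      calc (150000 * M ^ 2 / P : ℝ) ^ ((n : ℝ) / 2)
          ≤ ((1 / (32 * D ^ 2)) ^ 2 * M ^ 2) ^ ((n : ℝ) / 2) := by
            refine Real.rpow_le_rpow (by positivity) ?_ (by positivity)
            rw [div_le_iff₀ hP0]
            have : (1 / (32 * D ^ 2)) ^ 2 * M ^ 2 * (A * D ^ 4) = 150000 * M ^ 2 := by
              rw [hA]; field_simp; norm_num
            rw [← this]
            exact mul_le_mul_of_nonneg_left hi1.le (by positivity)
        _ = _ := by
          rw [Real.mul_rpow (by positivity) (by positivity), hXr, ← Real.rpow_natCast _ 2,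
            ← Real.rpow_mul (by positivity), ← Real.rpow_natCast _ n]
          congr 2; push_cast; ring
    calc Q ≤ 2 ^ n * ((1 / (32 * D ^ 2)) ^ n * X * m ^ 2) := by rw [hQ]; gcongr
      _ = (1 / (16 * D ^ 2)) ^ n * (X * m ^ 2) := by
        rw [← mul_assoc, ← mul_assoc, ← mul_pow, mul_assoc]; congr 2; field_simp; norm_num
      _ ≤ 1 / (16 * D ^ 2) * (X * m ^ 2) := by
        refine mul_le_mul_of_nonneg_right ?_ (by positivity)
        refine pow_le_of_le_one (by positivity) ?_ (by omega)
        rw [div_le_one (by positivity)]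
        nlinarith
      _ = _ := by ring
  have hfin : X / D ^ 2 * m ^ 2 ≤ Q + e + t * m + e := by
    rw [← hlam2, ← mul_pow]
    refine hFE.trans ?_
    refine (mul_le_mul_of_nonneg_left hW (by positivity)).trans ?_
    rw [mul_add, mul_add (C * i * (X / M ^ 2)), mul_add (C * i * (X / M ^ 2)), mul_add, mul_add]
    linarith
  have ht0 : 0 ≤ t := by rw [ht]; positivity
  have := level_ineq_absorb (one_le_pow₀ hD) hX0 hm0 hfin hQ1 le_rfl ht0
  refine this.trans_eq ?_
  have e1 : D ^ (4 + 4 * σ + ε) = D ^ 2 * D ^ (2 + 4 * σ + ε) := by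
    rw [← Real.rpow_natCast D 2, ← Real.rpow_add hD0]; congr 1; push_cast; ring
  rw [e1, ht, pow_add, ← hX]
  field_simp

section
variable {n : ℕ}

lemma norm_wave_le {M : ℕ} (hM : 1 ≤ M) (S : Finset (Fin n → ℤ)) (a : (Fin n → ℤ) → ℂ)
    (hS : ∀ ξ ∈ S, ∀ i, 2 * |ξ i| ≤ M) (ha : ∑ ξ ∈ S, ‖a ξ‖ ^ 2 ≤ 1) (q : ℝ × (Fin n → ℝ)) :
    ‖wave S a q‖ ≤ 3 ^ n * (M : ℝ) ^ ((n : ℝ) / 2) := by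
  have hM0 : (0 : ℝ) < M := by exact_mod_cast hM
  refine (wave_norm_le S a q).trans (abs_le_of_sq_le_sq' ?_ (by positivity)).2
  have hc : (S.card : ℝ) ≤ (3 * M) ^ n := by
    have hsub : S ⊆ latticeBox n M := fun ξ hξ => by
      refine Fintype.mem_piFinset.2 fun i => Finset.mem_Icc.2 (abs_le.1 ?_)
      have := hS ξ hξ i
      have := abs_nonneg (ξ i)
      omega
    have h1 := Finset.card_le_card hsub
    rw [latticeBox, Fintype.card_piFinset] at h1
    simp only [Int.card_Icc, prod_const, card_univ, Fintype.card_fin] at h1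
    have h2 : ((M : ℤ) + 1 - -(M : ℤ)).toNat ≤ 3 * M := by omega
    exact_mod_cast h1.trans (Nat.pow_le_pow_left h2 n)
  calc (∑ ξ ∈ S, ‖a ξ‖) ^ 2 ≤ S.card * ∑ ξ ∈ S, ‖a ξ‖ ^ 2 := sq_sum_le_card_mul_sum_sq
    _ ≤ (3 * M) ^ n * 1 := by gcongr
    _ = 3 ^ n * ((M : ℝ) ^ ((n : ℝ) / 2)) ^ 2 := by
      rw [← Real.rpow_natCast ((M : ℝ) ^ ((n : ℝ) / 2)), ← Real.rpow_mul hM0.le, mul_one, mul_pow,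
        ← Real.rpow_natCast (M : ℝ) n]
      congr 2; push_cast; ring
    _ ≤ (3 ^ n * (M : ℝ) ^ ((n : ℝ) / 2)) ^ 2 := by
      rw [mul_pow]
      refine mul_le_mul_of_nonneg_right ?_ (by positivity)
      exact le_self_pow₀ (one_le_pow₀ (by norm_num)) (by norm_num)

end

/-- Dyadic layer decomposition of a power of a bounded number, down to the height `2⁻ᴶ`. -/
lemma rpow_le_sum_dyadic {B p f : ℝ} (hB : 1 ≤ B) (hp : 0 ≤ p) (hf : 0 ≤ f) (hfB : f ≤ B) (J : ℕ)
    (hJ : 1 / 2 ^ J < f) :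
    f ^ p ≤ (2 * B) ^ p * ∑ j ∈ Finset.range (J + 1),
      ((2 : ℝ) ^ (-p)) ^ j * (if 1 / 2 ^ j < f then 1 else 0) := by
  induction J with
  | zero =>
    simp only [pow_zero, div_one] at hJ
    simp only [zero_add, Finset.range_one, Finset.sum_singleton, pow_zero, div_one, hJ, if_true,
      mul_one]
    exact Real.rpow_le_rpow hf (by linarith) hp
  | succ J ih =>
    rw [Finset.sum_range_succ, mul_add]
    by_cases h : 1 / 2 ^ J < f
    · refine (ih h).trans (le_add_of_nonneg_right ?_)
      split_ifs <;> positivity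
    · refine le_add_of_nonneg_of_le (mul_nonneg (by positivity) (Finset.sum_nonneg fun j _ => ?_)) ?_
      · split_ifs <;> positivity
      rw [if_pos hJ, mul_one, ← Real.rpow_natCast, ← Real.rpow_mul (by norm_num), mul_comm (-p),
        Real.rpow_mul (by norm_num), Real.rpow_neg (by positivity), Real.rpow_natCast,
        ← Real.inv_rpow (by positivity), ← Real.mul_rpow (by positivity) (by positivity)]
      refine Real.rpow_le_rpow hf ((not_lt.1 h).trans ?_) hp
      rw [pow_succ]
      field_simp
      linarith

lemma exists_integral_wave_rpow_le {n k : ℕ} {σ p : ℝ} (hn : 1 ≤ n) (hσ : 0 ≤ σ) (hσ1 : σ ≤ 1)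
    (hnσ : 1 - (n : ℝ) / 2 ≤ σ) (hk : (k : ℝ) = 4 + 4 * σ) (hp : k < p)
    (H : ∀ ε > 0, ∃ C > 0, ∀ M : ℕ, 1 ≤ M → ∀ (S : Finset (Fin n → ℤ)) (a : (Fin n → ℤ) → ℂ),
      (∀ ξ ∈ S, ∀ i, 2 * |ξ i| ≤ M) → ∑ ξ ∈ S, ‖a ξ‖ ^ 2 ≤ 1 →
      ∫ q, ‖wave S a q‖ ^ k ∂(stMeas n) ≤ C * (M : ℝ) ^ ((n : ℝ) / 2 * k - (n + 2) + ε)) :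
    ∃ C > 0, ∀ M : ℕ, 1 ≤ M → ∀ (S : Finset (Fin n → ℤ)) (a : (Fin n → ℤ) → ℂ),
      (∀ ξ ∈ S, ∀ i, 2 * |ξ i| ≤ M) → ∑ ξ ∈ S, ‖a ξ‖ ^ 2 ≤ 1 →
      ∫ q, ‖wave S a q‖ ^ p ∂(stMeas n) ≤ C * (M : ℝ) ^ ((n : ℝ) / 2 * p - (n + 2)) := by
  have hpk : 0 < p - k := by linarith
  have hk0 : (0 : ℝ) ≤ k := by positivity
  have hp0 : 0 < p := by linarith
  obtain ⟨C₁, K, hC₁, hK, h1⟩ := exists_volume_level_le hn hσ hσ1 hnσ (half_pos hpk)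
  obtain ⟨C₂, hC₂, h2⟩ := H (2 * (p - k) / 11) (by positivity)
  set r : ℝ := 2 ^ (-((p - k) / 2)) with hr
  have hr0 : 0 < r := by positivity
  have hr1 : r < 1 := Real.rpow_lt_one_of_one_lt_of_neg (by norm_num) (by linarith)
  have hr1' : 0 < 1 - r := by linarith
  set A₁ : ℝ := (2 * 3 ^ n) ^ p * (C₁ * (1 - r)⁻¹) with hA₁
  set A₂ : ℝ := (2 * K ^ (1 / 11 : ℝ)) ^ (p - k) * C₂ with hA₂
  set A₃ : ℝ := (3 ^ n) ^ p * (stMeas n).real Set.univ * K ^ (((n : ℝ) + 2) / 2) with hA₃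
  have hK0 : 0 < K := by linarith
  have hA₃0 : 0 ≤ A₃ := by positivity
  refine ⟨A₁ + A₂ + A₃, by positivity, fun M hM S a hS ha => ?_⟩
  have hM0 : (0 : ℝ) < M := by exact_mod_cast hM
  set B : ℝ := (M : ℝ) ^ ((n : ℝ) / 2) with hB
  have hB0 : 0 < B := by positivity
  set f : ℝ × (Fin n → ℝ) → ℝ := fun q => ‖wave S a q‖ / B with hf
  have hf0 : ∀ q, 0 ≤ f q := fun q => by positivity
  have hfB : ∀ q, f q ≤ 3 ^ n := fun q => by
    rw [hf, div_le_iff₀ hB0]; exact norm_wave_le hM S a hS ha q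
  have hfm : Measurable f := (wave_measurable S a).norm.div_const _
  have hwf : ∀ q, ‖wave S a q‖ ^ p = B ^ p * f q ^ p := fun q => by
    rw [← Real.mul_rpow hB0.le (hf0 q), hf, mul_div_cancel₀ _ hB0.ne']
  have hBp : B ^ p * ((M : ℝ) ^ (n + 2))⁻¹ = (M : ℝ) ^ ((n : ℝ) / 2 * p - (n + 2)) := by
    rw [hB, ← Real.rpow_mul hM0.le, Real.rpow_sub hM0, ← div_eq_mul_inv]
    congr 1
    rw [← Real.rpow_natCast]; push_cast; rfl
  have hE : 0 < (M : ℝ) ^ ((n : ℝ) / 2 * p - (n + 2)) := by positivity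
  suffices h : ∫ q, f q ^ p ∂(stMeas n) ≤ (A₁ + A₂ + A₃) * ((M : ℝ) ^ (n + 2))⁻¹ by
    simp_rw [hwf]
    rw [integral_const_mul, ← hBp, mul_left_comm]
    exact mul_le_mul_of_nonneg_left h (by positivity)
  have hfpi : Integrable (fun q => f q ^ p) (stMeas n) :=
    Integrable.of_bound (hfm.pow_const p).aestronglyMeasurable ((3 ^ n) ^ p)
      (Filter.Eventually.of_forall fun q => by
        rw [Real.norm_eq_abs, abs_of_nonneg (Real.rpow_nonneg (hf0 q) _)]
        exact Real.rpow_le_rpow (hf0 q) (hfB q) hp0.le)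
  have hmi : 0 < ((M : ℝ) ^ (n + 2))⁻¹ := by positivity
  by_cases hMK : (M : ℝ) ^ 2 < K
  · have hMK' : (M : ℝ) ^ (n + 2) ≤ K ^ (((n : ℝ) + 2) / 2) := by
      calc (M : ℝ) ^ (n + 2) = ((M : ℝ) ^ 2) ^ (((n : ℝ) + 2) / 2) := by
            rw [← Real.rpow_natCast, ← Real.rpow_natCast, ← Real.rpow_mul hM0.le]
            congr 1; push_cast; ring
        _ ≤ _ := Real.rpow_le_rpow (by positivity) hMK.le (by positivity)
    have h3 : ∫ q, f q ^ p ∂(stMeas n) ≤ (3 ^ n) ^ p * (stMeas n).real Set.univ := by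
      refine (integral_mono hfpi (integrable_const ((3 ^ n) ^ p)) fun q =>
        Real.rpow_le_rpow (hf0 q) (hfB q) hp0.le).trans_eq ?_
      rw [integral_const, smul_eq_mul, mul_comm]
    calc _ ≤ (3 ^ n) ^ p * (stMeas n).real Set.univ := h3
      _ ≤ A₃ * ((M : ℝ) ^ (n + 2))⁻¹ := by
        rw [← div_eq_mul_inv, le_div_iff₀ (by positivity), hA₃]
        exact mul_le_mul_of_nonneg_left hMK' (by positivity)
      _ ≤ _ := by
        refine mul_le_mul_of_nonneg_right ?_ hmi.le
        have : 0 ≤ A₁ := by positivity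
        have : 0 ≤ A₂ := by positivity
        linarith
  rw [not_lt] at hMK
  have hX1 : 1 ≤ (M ^ 2 : ℝ) / K := by rw [le_div_iff₀ hK0]; linarith
  obtain ⟨J, hJ1, hJ2⟩ := exists_nat_pow_near hX1 (y := (2 : ℝ) ^ 11) (by norm_num)
  have hlev : ∀ j ∈ Finset.range (J + 1), ∫ q, (if 1 / 2 ^ j < f q then (1 : ℝ) else 0) ∂(stMeas n)
      ≤ C₁ * ((2 : ℝ) ^ j) ^ (4 + 4 * σ + (p - k) / 2) / (M : ℝ) ^ (n + 2) := by
    intro j hj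
    have hjJ : j ≤ J := by have := Finset.mem_range.1 hj; omega
    have e : (fun q => if 1 / 2 ^ j < f q then (1 : ℝ) else 0)
        = {q | B / 2 ^ j < ‖wave S a q‖}.indicator fun _ => 1 := by
      funext q
      rw [Set.indicator_apply]
      congr 1
      rw [hf, lt_div_iff₀ hB0, Set.mem_ofPred_eq, one_div_mul_eq_div]
    rw [e, integral_indicator_const _ (measurableSet_level S a _), smul_eq_mul, mul_one]
    refine h1 M (2 ^ j) S a hM (one_le_pow₀ (by norm_num)) ?_ hS ha
    rw [← pow_mul, mul_comm j, pow_mul]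
    rw [le_div_iff₀ hK0, mul_comm] at hJ1
    refine le_trans ?_ hJ1
    exact mul_le_mul_of_nonneg_left (pow_le_pow_right₀ (by norm_num) hjJ) hK0.le
  have hpt : ∀ q, f q ^ p ≤ (2 * 3 ^ n) ^ p * ∑ j ∈ Finset.range (J + 1),
      ((2 : ℝ) ^ (-p)) ^ j * (if 1 / 2 ^ j < f q then 1 else 0) + (1 / 2 ^ J) ^ (p - k) * f q ^ k := by
    intro q
    have h0 := hf0 q
    by_cases h : 1 / 2 ^ J < f q
    · refine (rpow_le_sum_dyadic (one_le_pow₀ (by norm_num)) hp0.le h0 (hfB q) J h).trans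
        (le_add_of_nonneg_right (by positivity))
    · refine le_add_of_nonneg_of_le (mul_nonneg (by positivity) (Finset.sum_nonneg fun j _ => ?_)) ?_
      · split_ifs <;> positivity
      · rcases h0.eq_or_lt with h0 | h0
        · rw [← h0, Real.zero_rpow hp0.ne']; positivity
        · calc f q ^ p = f q ^ (p - k) * f q ^ k := by
                rw [← Real.rpow_natCast, ← Real.rpow_add h0]; congr 1; ring
            _ ≤ _ := by
              refine mul_le_mul_of_nonneg_right ?_ (by positivity)
              exact Real.rpow_le_rpow h0.le (not_lt.1 h) hpk.le
  have hlm : ∀ j : ℕ, Measurable fun q => if 1 / 2 ^ j < f q then (1 : ℝ) else 0 := fun j =>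
    Measurable.ite (measurableSet_lt measurable_const hfm) measurable_const measurable_const
  have hli : ∀ j : ℕ, Integrable (fun q => if 1 / 2 ^ j < f q then (1 : ℝ) else 0) (stMeas n) := fun j =>
    Integrable.of_bound (hlm j).aestronglyMeasurable 1 (Filter.Eventually.of_forall fun q => by
      split_ifs <;> simp)
  have hsi : Integrable (fun q => ∑ j ∈ Finset.range (J + 1),
      ((2 : ℝ) ^ (-p)) ^ j * (if 1 / 2 ^ j < f q then (1 : ℝ) else 0)) (stMeas n) :=
    integrable_finsetSum _ fun j _ => (hli j).const_mul _
  have hki : Integrable (fun q => f q ^ k) (stMeas n) :=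
    Integrable.of_bound (hfm.pow_const k).aestronglyMeasurable ((3 ^ n) ^ k)
      (Filter.Eventually.of_forall fun q => by
        rw [Real.norm_eq_abs, abs_of_nonneg (pow_nonneg (hf0 q) _)]
        exact pow_le_pow_left₀ (hf0 q) (hfB q) k)
  have hlow : ∫ q, f q ^ k ∂(stMeas n)
      ≤ C₂ * (M : ℝ) ^ (2 * (p - k) / 11) * ((M : ℝ) ^ (n + 2))⁻¹ := by
    have e : ∀ q, f q ^ k = (B ^ k)⁻¹ * ‖wave S a q‖ ^ k := fun q => by
      rw [hf, div_pow, div_eq_inv_mul]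
    simp_rw [e]
    rw [integral_const_mul]
    refine (mul_le_mul_of_nonneg_left (h2 M hM S a hS ha) (by positivity)).trans_eq ?_
    rw [Real.rpow_add hM0, Real.rpow_sub hM0, hB, ← Real.rpow_natCast ((M : ℝ) ^ ((n : ℝ) / 2)),
      ← Real.rpow_mul hM0.le, ← Real.rpow_natCast (M : ℝ) (n + 2)]
    push_cast
    field_simp
  have hJM : (1 / 2 ^ J : ℝ) ^ (p - k) * (M : ℝ) ^ (2 * (p - k) / 11)
      ≤ (2 * K ^ (1 / 11 : ℝ)) ^ (p - k) := by
    have e : (M : ℝ) ^ (2 * (p - k) / 11) = (((M : ℝ) ^ 2) ^ (1 / 11 : ℝ)) ^ (p - k) := by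
      rw [← Real.rpow_natCast, ← Real.rpow_mul hM0.le, ← Real.rpow_mul hM0.le]
      congr 1; push_cast; ring
    rw [e, ← Real.mul_rpow (by positivity) (by positivity)]
    refine Real.rpow_le_rpow (by positivity) ?_ hpk.le
    rw [one_div_mul_eq_div, div_le_iff₀ (by positivity)]
    rw [div_lt_iff₀ hK0] at hJ2
    calc ((M : ℝ) ^ 2) ^ (1 / 11 : ℝ) ≤ (((2 : ℝ) ^ 11) ^ (J + 1) * K) ^ (1 / 11 : ℝ) :=
          Real.rpow_le_rpow (by positivity) hJ2.le (by norm_num)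
      _ = _ := by
        rw [Real.mul_rpow (by positivity) hK0.le, ← pow_mul, mul_comm 11, pow_mul,
          ← Real.rpow_natCast _ 11, ← Real.rpow_mul (by positivity)]
        norm_num
        ring
  have hgeo : ∑ j ∈ Finset.range (J + 1), ((2 : ℝ) ^ (-p)) ^ j
      * ∫ q, (if 1 / 2 ^ j < f q then (1 : ℝ) else 0) ∂(stMeas n)
      ≤ C₁ * (1 - r)⁻¹ * ((M : ℝ) ^ (n + 2))⁻¹ := by
    calc _ ≤ ∑ j ∈ Finset.range (J + 1), r ^ j * (C₁ * ((M : ℝ) ^ (n + 2))⁻¹) := by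
          refine Finset.sum_le_sum fun j hj => ?_
          refine (mul_le_mul_of_nonneg_left (hlev j hj) (by positivity)).trans_eq ?_
          have e : ((2 : ℝ) ^ (-p)) ^ j * ((2 : ℝ) ^ j) ^ (4 + 4 * σ + (p - k) / 2) = r ^ j := by
            rw [← Real.rpow_natCast, ← Real.rpow_mul (by norm_num), hr,
              ← Real.rpow_natCast, ← Real.rpow_natCast, ← Real.rpow_mul (by norm_num),
              ← Real.rpow_mul (by norm_num), ← Real.rpow_add (by norm_num)]
            congr 1
            rw [← hk]; ring
          rw [← e]; ring
      _ = (∑ j ∈ Finset.range (J + 1), r ^ j) * (C₁ * ((M : ℝ) ^ (n + 2))⁻¹) := by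
          rw [Finset.sum_mul]
      _ ≤ (1 - r)⁻¹ * (C₁ * ((M : ℝ) ^ (n + 2))⁻¹) := by
          refine mul_le_mul_of_nonneg_right ?_ (by positivity)
          rw [← tsum_geometric_of_lt_one hr0.le hr1]
          exact (summable_geometric_of_lt_one hr0.le hr1).sum_le_tsum _ fun j _ => by positivity
      _ = _ := by ring
  calc ∫ q, f q ^ p ∂(stMeas n) ≤ ∫ q, ((2 * 3 ^ n) ^ p * ∑ j ∈ Finset.range (J + 1),
        ((2 : ℝ) ^ (-p)) ^ j * (if 1 / 2 ^ j < f q then 1 else 0)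
          + (1 / 2 ^ J) ^ (p - k) * f q ^ k) ∂(stMeas n) :=
        integral_mono hfpi ((hsi.const_mul _).add (hki.const_mul _)) hpt
    _ = (2 * 3 ^ n) ^ p * ∑ j ∈ Finset.range (J + 1), ((2 : ℝ) ^ (-p)) ^ j
          * ∫ q, (if 1 / 2 ^ j < f q then (1 : ℝ) else 0) ∂(stMeas n)
        + (1 / 2 ^ J) ^ (p - k) * ∫ q, f q ^ k ∂(stMeas n) := by
      rw [integral_add (hsi.const_mul _) (hki.const_mul _), integral_const_mul, integral_const_mul,
        integral_finsetSum _ fun j _ => (hli j).const_mul _]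
      simp_rw [integral_const_mul]
    _ ≤ (2 * 3 ^ n) ^ p * (C₁ * (1 - r)⁻¹ * ((M : ℝ) ^ (n + 2))⁻¹)
        + (1 / 2 ^ J) ^ (p - k) * (C₂ * (M : ℝ) ^ (2 * (p - k) / 11) * ((M : ℝ) ^ (n + 2))⁻¹) := by
      gcongr
    _ = (A₁ + ((1 / 2 ^ J : ℝ) ^ (p - k) * (M : ℝ) ^ (2 * (p - k) / 11)) * C₂)
        * ((M : ℝ) ^ (n + 2))⁻¹ := by rw [hA₁]; ring
    _ ≤ (A₁ + A₂ + A₃) * ((M : ℝ) ^ (n + 2))⁻¹ := by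
      refine mul_le_mul_of_nonneg_right ?_ hmi.le
      have := mul_le_mul_of_nonneg_right hJM hC₂.le
      linarith

lemma weylMajorant_neg (M : ℕ) (τ : ℝ) : weylMajorant M (-τ) = weylMajorant M τ := by
  unfold weylMajorant
  simp only [neg_div, mul_neg, intDist_neg]

/-- A function of weak type `2` raised to the power `γ < 2` is integrable on sets of finite measure. -/
lemma integral_rpow_le_of_weak {X : Type*} [MeasurableSpace X] (μ : Measure X) [IsFiniteMeasure μ]
    {W : X → ℝ} (hW : Measurable W) (h0 : ∀ x, 0 ≤ W x) {A : ℝ} (hA : ∀ x, W x ≤ A) {V : ℝ} (hV : 0 < V)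
    (hwk : ∀ y > 0, μ.real {x | y < W x} ≤ V / y ^ 2) {γ : ℝ} (hγ : 0 < γ) (hγ2 : γ < 2)
    (T : Set X) :
    ∫ x in T, W x ^ γ ∂μ ≤ (1 + 4 * (1 - 2 ^ (γ - 2))⁻¹) * V ^ (γ / 2) * μ.real T ^ (1 - γ / 2) := by
  have hr1 : (2 : ℝ) ^ (γ - 2) < 1 := Real.rpow_lt_one_of_one_lt_of_neg (by norm_num) (by linarith)
  set r : ℝ := 2 ^ (γ - 2) with hr
  have hr0 : 0 < r := by positivity
  have hr1' : 0 < 1 - r := by linarith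
  rcases eq_or_lt_of_le (measureReal_nonneg (μ := μ) (s := T)) with hT0 | hT0
  · have : μ T = 0 := by
      rw [measureReal_def] at hT0
      exact (ENNReal.toReal_eq_zero_iff _).1 hT0.symm |>.resolve_right (measure_ne_top _ _)
    rw [Measure.restrict_eq_zero.2 this, integral_zero_measure]
    positivity
  set v := μ.real T with hv
  set Y : ℝ := (V / v) ^ (1 / 2 : ℝ) with hY
  have hY0 : 0 < Y := by positivity
  have hY2 : Y ^ 2 = V / v := by
    rw [hY, ← Real.rpow_natCast, ← Real.rpow_mul (by positivity)]; norm_num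
  obtain ⟨J, hJ⟩ := pow_unbounded_of_one_lt (A / Y) (one_lt_two (α := ℝ))
  have hJ' : A ≤ 2 ^ J * Y := by rw [div_lt_iff₀ hY0] at hJ; exact hJ.le
  have hpt : ∀ x, W x ^ γ ≤ Y ^ γ + ∑ j ∈ Finset.range J, (2 * (2 ^ j * Y)) ^ γ
      * {x | 2 ^ j * Y < W x}.indicator (fun _ => (1 : ℝ)) x := by
    intro x
    have hn : ∀ j ∈ Finset.range J, 0 ≤ (2 * (2 ^ j * Y)) ^ γ
      * {x | 2 ^ j * Y < W x}.indicator (fun _ => (1 : ℝ)) x := fun j _ =>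
        mul_nonneg (by positivity) (Set.indicator_nonneg (fun _ _ => zero_le_one) _)
    by_cases hx : W x ≤ Y
    · exact (Real.rpow_le_rpow (h0 x) hx hγ.le).trans (le_add_of_nonneg_right (Finset.sum_nonneg hn))
    · rw [not_le] at hx
      obtain ⟨j, hj1, hj2⟩ := exists_nat_pow_near (x := W x / Y) (y := 2)
        (by rw [le_div_iff₀ hY0]; linarith) (by norm_num)
      rw [le_div_iff₀ hY0] at hj1
      rw [div_lt_iff₀ hY0] at hj2
      rcases hj1.eq_or_lt with he | hlt
      · rcases Nat.eq_zero_or_pos j with rfl | hjp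
        · rw [pow_zero, one_mul] at he
          exact absurd he hx.ne
        obtain ⟨i, rfl⟩ := Nat.exists_eq_succ_of_ne_zero hjp.ne'
        have hlt : 2 ^ i * Y < W x := by
          rw [← he, pow_succ]
          have : 0 < 2 ^ i * Y := by positivity
          linarith
        have hi : i ∈ Finset.range J := by
          rw [Finset.mem_range]
          by_contra hc
          have := pow_le_pow_right₀ (one_le_two (α := ℝ)) (not_lt.1 hc)
          have := mul_le_mul_of_nonneg_right this hY0.le
          linarith [hA x]
        refine le_add_of_nonneg_of_le (by positivity) (le_trans ?_ (Finset.single_le_sum hn hi))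
        rw [Set.indicator_of_mem (by exact hlt), mul_one]
        refine Real.rpow_le_rpow (h0 x) ?_ hγ.le
        rw [← he, pow_succ]; linarith
      · have hi : j ∈ Finset.range J := by
          rw [Finset.mem_range]
          by_contra hc
          have := pow_le_pow_right₀ (one_le_two (α := ℝ)) (not_lt.1 hc)
          have := mul_le_mul_of_nonneg_right this hY0.le
          linarith [hA x]
        refine le_add_of_nonneg_of_le (by positivity) (le_trans ?_ (Finset.single_le_sum hn hi))
        rw [Set.indicator_of_mem (by exact hlt), mul_one]
        refine Real.rpow_le_rpow (h0 x) ?_ hγ.le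
        rw [pow_succ] at hj2; linarith
  have hms : ∀ j : ℕ, MeasurableSet {x | 2 ^ j * Y < W x} := fun j =>
    measurableSet_lt measurable_const hW
  have hii : ∀ j : ℕ, Integrable ({x | 2 ^ j * Y < W x}.indicator (fun _ => (1 : ℝ))) (μ.restrict T) :=
    fun j => (integrable_const (1 : ℝ)).indicator (hms j)
  have hind : ∀ j : ℕ, ∫ x in T, {x | 2 ^ j * Y < W x}.indicator (fun _ => (1 : ℝ)) x ∂μ
      ≤ V / (2 ^ j * Y) ^ 2 := by
    intro j
    rw [integral_indicator_const _ (hms j), smul_eq_mul, mul_one]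
    refine le_trans ?_ (hwk (2 ^ j * Y) (by positivity))
    rw [measureReal_restrict_apply (hms j)]
    exact measureReal_mono Set.inter_subset_left
  have hsi : Integrable (fun x => ∑ j ∈ Finset.range J, (2 * (2 ^ j * Y)) ^ γ
      * {x | 2 ^ j * Y < W x}.indicator (fun _ => (1 : ℝ)) x) (μ.restrict T) :=
    integrable_finsetSum _ fun j _ => (hii j).const_mul _
  have hYg : Y ^ γ * v = V ^ (γ / 2) * v ^ (1 - γ / 2) := by
    rw [hY, ← Real.rpow_mul (by positivity), Real.div_rpow hV.le hT0.le, Real.rpow_sub hT0,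
      Real.rpow_one]
    rw [show 1 / 2 * γ = γ / 2 by ring]
    ring
  have hterm : ∀ j : ℕ, (2 * (2 ^ j * Y)) ^ γ * (V / (2 ^ j * Y) ^ 2) ≤ 4 * (Y ^ γ * v) * r ^ j := by
    intro j
    have h4 : (2 : ℝ) ^ γ ≤ 4 := by
      calc (2 : ℝ) ^ γ ≤ 2 ^ (2 : ℝ) := Real.rpow_le_rpow_of_exponent_le (by norm_num) hγ2.le
        _ = 4 := by norm_num
    have hrj : r ^ j = ((2 : ℝ) ^ j) ^ γ / ((2 : ℝ) ^ j) ^ 2 := by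
      rw [hr, Real.rpow_sub (by norm_num), div_pow, ← Real.rpow_natCast ((2 : ℝ) ^ γ),
        ← Real.rpow_mul (by norm_num), ← Real.rpow_natCast (2 : ℝ) j, ← Real.rpow_mul (by norm_num),
        mul_comm γ]
      congr 1
      rw [Real.rpow_two, Real.rpow_natCast, ← pow_mul, ← pow_mul, mul_comm]
    rw [Real.mul_rpow (by norm_num) (by positivity), Real.mul_rpow (by positivity) hY0.le, mul_pow, hY2,
      hrj]
    calc _ = (2 : ℝ) ^ γ * (Y ^ γ * v * (((2 : ℝ) ^ j) ^ γ / ((2 : ℝ) ^ j) ^ 2)) := by field_simp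
      _ ≤ 4 * (Y ^ γ * v * (((2 : ℝ) ^ j) ^ γ / ((2 : ℝ) ^ j) ^ 2)) :=
        mul_le_mul_of_nonneg_right h4 (by positivity)
      _ = _ := by ring
  calc ∫ x in T, W x ^ γ ∂μ ≤ ∫ x in T, (Y ^ γ + ∑ j ∈ Finset.range J, (2 * (2 ^ j * Y)) ^ γ
      * {x | 2 ^ j * Y < W x}.indicator (fun _ => (1 : ℝ)) x) ∂μ :=
        integral_mono_of_nonneg (Filter.Eventually.of_forall fun x => Real.rpow_nonneg (h0 x) _)
          ((integrable_const _).add hsi) (Filter.Eventually.of_forall hpt)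
    _ = Y ^ γ * v + ∑ j ∈ Finset.range J, (2 * (2 ^ j * Y)) ^ γ
        * ∫ x in T, {x | 2 ^ j * Y < W x}.indicator (fun _ => (1 : ℝ)) x ∂μ := by
      rw [integral_add (integrable_const _) hsi, integral_finsetSum _ fun j _ => (hii j).const_mul _]
      simp_rw [integral_const_mul]
      rw [integral_const, smul_eq_mul, mul_comm, measureReal_restrict_apply_univ]
    _ ≤ Y ^ γ * v + ∑ j ∈ Finset.range J, 4 * (Y ^ γ * v) * r ^ j := by
      refine add_le_add le_rfl (Finset.sum_le_sum fun j _ => ?_)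
      exact (mul_le_mul_of_nonneg_left (hind j) (by positivity)).trans (hterm j)
    _ ≤ Y ^ γ * v + 4 * (Y ^ γ * v) * (1 - r)⁻¹ := by
      rw [← Finset.mul_sum]
      gcongr
      rw [← tsum_geometric_of_lt_one hr0.le hr1]
      exact (summable_geometric_of_lt_one hr0.le hr1).sum_le_tsum _ fun j _ => by positivity
    _ = _ := by rw [mul_assoc _ (V ^ (γ / 2)), ← hYg]; ring

/-- The half-open dyadic interval `[δ2ⁱ, δ2ⁱ⁺¹)`. -/
def dyadicIco (δ : ℝ) (i : ℕ) : Set ℝ := Set.Ico (δ * 2 ^ i) (δ * 2 ^ (i + 1))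

lemma measurableSet_dyadicIco (δ : ℝ) (i : ℕ) : MeasurableSet (dyadicIco δ i) := measurableSet_Ico

lemma exists_mem_dyadicIco {δ v : ℝ} (hδ : 0 < δ) {N : ℕ} (h1 : δ ≤ v) (h2 : v < δ * 2 ^ N) :
    ∃ i ∈ Finset.range N, v ∈ dyadicIco δ i := by
  obtain ⟨i, hi1, hi2⟩ := exists_nat_pow_near (x := v / δ) (y := 2)
    (by rw [le_div_iff₀ hδ]; linarith) (by norm_num)
  rw [le_div_iff₀ hδ, mul_comm] at hi1
  rw [div_lt_iff₀ hδ, mul_comm] at hi2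
  refine ⟨i, Finset.mem_range.2 ?_, hi1, hi2⟩
  by_contra hc
  have := mul_le_mul_of_nonneg_left (pow_le_pow_right₀ (one_le_two (α := ℝ)) (not_lt.1 hc)) hδ.le
  linarith

lemma dyadicIco_unique {δ v : ℝ} (hδ : 0 < δ) {i j : ℕ} (hi : v ∈ dyadicIco δ i)
    (hj : v ∈ dyadicIco δ j) : i = j := by
  have key : ∀ i j : ℕ, v ∈ dyadicIco δ i → v ∈ dyadicIco δ j → i ≤ j := by
    intro i j hi hj
    by_contra hc
    have : δ * 2 ^ (j + 1) ≤ δ * 2 ^ i := mul_le_mul_of_nonneg_left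
      (pow_le_pow_right₀ (one_le_two (α := ℝ)) (Nat.succ_le_of_lt (not_le.1 hc))) hδ.le
    have h1 := hi.1
    have h2 := hj.2
    linarith
  exact le_antisymm (key i j hi hj) (key j i hj hi)

lemma sum_dyadicIco_eq {E : Type*} [AddCommMonoid E] {δ v : ℝ} (hδ : 0 < δ) {N : ℕ} (h1 : δ ≤ v)
    (h2 : v < δ * 2 ^ N) (c : E) :
    ∑ i ∈ Finset.range N, (dyadicIco δ i).indicator (fun _ => c) v = c := by
  obtain ⟨i, hi, hv⟩ := exists_mem_dyadicIco hδ h1 h2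
  rw [Finset.sum_eq_single_of_mem i hi fun j _ hji => Set.indicator_of_notMem
    (fun hj => hji (dyadicIco_unique hδ hj hv)) _, Set.indicator_of_mem hv]

lemma sum_dyadicIco_rpow_le {δ v r : ℝ} (hδ : 0 < δ) (hr : 0 ≤ r) (hv : 0 ≤ v) (N : ℕ) :
    ∑ i ∈ Finset.range N, (dyadicIco δ i).indicator (fun _ => (δ * 2 ^ i) ^ r) v ≤ v ^ r := by
  by_cases h : ∃ i ∈ Finset.range N, v ∈ dyadicIco δ i
  · obtain ⟨i, hi, hvi⟩ := h
    rw [Finset.sum_eq_single_of_mem i hi fun j _ hji => Set.indicator_of_notMem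
      (fun hj => hji (dyadicIco_unique hδ hj hvi)) _, Set.indicator_of_mem hvi]
    exact Real.rpow_le_rpow (by positivity) hvi.1 hr
  · rw [Finset.sum_eq_zero fun i hi => Set.indicator_of_notMem (fun hj => h ⟨i, hi, hj⟩) _]
    positivity

lemma sum_pow_sub_le {ρ : ℝ} (h0 : 0 ≤ ρ) (h1 : ρ < 1) (i N : ℕ) :
    ∑ j ∈ Finset.range N, (if j ≤ i then ρ ^ (i - j) else 0) ≤ (1 - ρ)⁻¹ := by
  calc _ ≤ ∑ j ∈ Finset.range (i + 1), ρ ^ (i + 1 - 1 - j) := by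
        rw [← Finset.sum_filter]
        refine Finset.sum_le_sum_of_subset_of_nonneg (fun j hj => ?_) fun _ _ _ => by positivity
        have := (Finset.mem_filter.1 hj).2
        exact Finset.mem_range.2 (by omega)
    _ = ∑ j ∈ Finset.range (i + 1), ρ ^ j := Finset.sum_range_reflect (fun j => ρ ^ j) (i + 1)
    _ ≤ _ := by
        rw [← tsum_geometric_of_lt_one h0 h1]
        exact (summable_geometric_of_lt_one h0 h1).sum_le_tsum _ fun j _ => by positivity

lemma sum_dyadic_decay_le {ρ θ : ℝ} (h0 : 0 ≤ ρ) (h1 : ρ < 1) (hθ : 0 ≤ θ) (N : ℕ) {z : ℕ → ℝ}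
    (hz : ∀ i, 0 ≤ z i) {Z : ℝ} (hZ : ∑ i ∈ Finset.range N, z i ≤ Z) {c : ℕ → ℕ → ℝ}
    (hc : ∀ i j, j ≤ i → c i j ≤ ρ ^ (i - j) * (z i * z j ^ θ) ∧
      c j i ≤ ρ ^ (i - j) * (z i * z j ^ θ)) :
    ∑ i ∈ Finset.range N, ∑ j ∈ Finset.range N, c i j ≤ 2 * (1 - ρ)⁻¹ * (Z * Z ^ θ) := by
  have hZ0 : 0 ≤ Z := (Finset.sum_nonneg fun i _ => hz i).trans hZ
  have hzZ : ∀ j ∈ Finset.range N, z j ≤ Z := fun j hj =>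
    (Finset.single_le_sum (fun i _ => hz i) hj).trans hZ
  set G : ℕ → ℕ → ℝ := fun i j => (if j ≤ i then ρ ^ (i - j) else 0) * (z i * Z ^ θ) with hG
  have hG0 : ∀ i j, 0 ≤ G i j := fun i j => by
    have := hz i
    simp only [hG]
    split_ifs <;> positivity
  have hone : ∑ i ∈ Finset.range N, ∑ j ∈ Finset.range N, G i j ≤ (1 - ρ)⁻¹ * (Z * Z ^ θ) := by
    calc _ = ∑ i ∈ Finset.range N, (∑ j ∈ Finset.range N, if j ≤ i then ρ ^ (i - j) else 0)
          * (z i * Z ^ θ) := by simp_rw [hG, Finset.sum_mul]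
      _ ≤ ∑ i ∈ Finset.range N, (1 - ρ)⁻¹ * (z i * Z ^ θ) := by
        refine Finset.sum_le_sum fun i _ => ?_
        have := hz i
        exact mul_le_mul_of_nonneg_right (sum_pow_sub_le h0 h1 i N) (by positivity)
      _ = (1 - ρ)⁻¹ * ((∑ i ∈ Finset.range N, z i) * Z ^ θ) := by rw [← Finset.mul_sum, Finset.sum_mul]
      _ ≤ _ := by
        have : 0 < 1 - ρ := by linarith
        gcongr
  have hle : ∀ i ∈ Finset.range N, ∀ j ∈ Finset.range N, c i j ≤ G i j + G j i := by
    intro i hi j hj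
    rcases le_total j i with h | h
    · refine le_add_of_le_of_nonneg ((hc i j h).1.trans ?_) (hG0 j i)
      simp only [hG, if_pos h]
      have := hz i
      have := hz j
      have := hzZ j hj
      gcongr
    · refine le_add_of_nonneg_of_le (hG0 i j) ((hc j i h).2.trans ?_)
      simp only [hG, if_pos h]
      have := hz i
      have := hz j
      have := hzZ i hi
      gcongr
  calc _ ≤ ∑ i ∈ Finset.range N, ∑ j ∈ Finset.range N, (G i j + G j i) :=
        Finset.sum_le_sum fun i hi => Finset.sum_le_sum fun j hj => hle i hi j hj
    _ = ∑ i ∈ Finset.range N, ∑ j ∈ Finset.range N, G i j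
        + ∑ i ∈ Finset.range N, ∑ j ∈ Finset.range N, G i j := by
      simp_rw [Finset.sum_add_distrib]
      congr 1
      exact Finset.sum_comm
    _ ≤ _ := by linarith

section
variable {X : Type*} [MeasurableSpace X] (μ : Measure X) [IsFiniteMeasure μ]

lemma dyadic_level_identity {δ r θ : ℝ} (hδ : 0 < δ) (hr : r + r * θ = 2) {i j : ℕ} (h : j ≤ i)
    (a : ℝ) {b : ℝ} (hb : 0 ≤ b) :
    (δ * 2 ^ i) * (δ * 2 ^ j) * (a * b ^ θ) =
      ((2 : ℝ) ^ (1 - r)) ^ (i - j) * ((((δ * 2 ^ i) ^ r) * a) * (((δ * 2 ^ j) ^ r) * b) ^ θ) := by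
  obtain ⟨d, rfl⟩ := Nat.exists_eq_add_of_le h
  set u : ℝ := δ * 2 ^ j with hu
  have hu0 : 0 < u := by positivity
  have e1 : δ * 2 ^ (j + d) = u * 2 ^ d := by rw [pow_add]; ring
  have hd : (0 : ℝ) < 2 ^ d := by positivity
  have e2 : ((2 : ℝ) ^ (1 - r)) ^ d = ((2 : ℝ) ^ d) ^ (1 - r) := by
    rw [← Real.rpow_natCast, ← Real.rpow_natCast, ← Real.rpow_mul (by norm_num),
      ← Real.rpow_mul (by norm_num), mul_comm]
  have e3 : u * u = u ^ r * u ^ (r * θ) := by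
    rw [← Real.rpow_add hu0, hr, Real.rpow_two, sq]
  rw [e1, Nat.add_sub_cancel_left, e2, Real.mul_rpow hu0.le hd.le,
    Real.mul_rpow (by positivity) hb, ← Real.rpow_mul hu0.le, Real.rpow_sub hd, Real.rpow_one]
  calc _ = (u * u) * (2 ^ d * (a * b ^ θ)) := by ring
    _ = _ := by rw [e3]; field_simp

/-- A bilinear form bounded on pairs of indicators is bounded on `L^r`, `r = 2 / (1 + θ)`. -/
lemma exists_integral_mul_kernel_le {θ r : ℝ} (hθ : 0 < θ) (hθ1 : θ < 1) (hr : r + r * θ = 2) :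
    ∃ C > 0, ∀ (κ : X × X → ℝ) (K A B : ℝ) (F : X → ℝ), Measurable κ → (∀ z, 0 ≤ κ z) →
      (∀ z, κ z ≤ B) → 0 < K →
      (∀ S T : Set X, MeasurableSet S → MeasurableSet T →
        ∫ z in S ×ˢ T, κ z ∂(μ.prod μ) ≤ K * (μ.real S * μ.real T ^ θ) ∧
        ∫ z in S ×ˢ T, κ z ∂(μ.prod μ) ≤ K * (μ.real T * μ.real S ^ θ)) →
      Measurable F → (∀ x, 0 ≤ F x) → (∀ x, F x ≤ A) → ∀ η > 0,
      ∫ z, F z.1 * F z.2 * κ z ∂(μ.prod μ) ≤ C * K * (∫ x, F x ^ r ∂μ + η) ^ (2 / r) := by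
  have hr0 : 0 < r := by nlinarith
  have hr1 : 1 < r := by nlinarith
  set ρ : ℝ := 2 ^ (1 - r) with hρ
  have hρ0 : 0 < ρ := by positivity
  have hρ1 : ρ < 1 := Real.rpow_lt_one_of_one_lt_of_neg (by norm_num) (by linarith)
  have hρ1' : 0 < 1 - ρ := by linarith
  refine ⟨4 * (2 * (1 - ρ)⁻¹) * 4, by positivity, ?_⟩
  intro κ K A B F hκ hκ0 hκB hK hrest hF h0 hA η hη
  set δ : ℝ := (η / (μ.real Set.univ + 1)) ^ (1 / r) with hδ
  have hu1 : 0 < μ.real Set.univ + 1 := by positivity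
  have hδ0 : 0 < δ := by positivity
  have hδr : δ ^ r * μ.real Set.univ ≤ η := by
    rw [hδ, ← Real.rpow_mul (by positivity), one_div_mul_cancel hr0.ne', Real.rpow_one,
      div_mul_eq_mul_div, div_le_iff₀ hu1]
    nlinarith
  set f : X → ℝ := fun x => F x + δ with hf
  have hfm : Measurable f := hF.add_const δ
  have hfδ : ∀ x, δ ≤ f x := fun x => by simp only [hf]; linarith [h0 x]
  have hf0 : ∀ x, 0 ≤ f x := fun x => hδ0.le.trans (hfδ x)
  obtain ⟨N, hN⟩ := pow_unbounded_of_one_lt ((A + δ) / δ) (one_lt_two (α := ℝ))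
  rw [div_lt_iff₀ hδ0] at hN
  have hfN : ∀ x, f x < δ * 2 ^ N := fun x => by simp only [hf]; linarith [hA x]
  set T : ℕ → Set X := fun i => f ⁻¹' dyadicIco δ i with hT
  have hTm : ∀ i, MeasurableSet (T i) := fun i => hfm (measurableSet_dyadicIco δ i)
  set z : ℕ → ℝ := fun i => (δ * 2 ^ i) ^ r * μ.real (T i) with hz
  have hz0 : ∀ i, 0 ≤ z i := fun i => by positivity
  have hFr : Integrable (fun x => F x ^ r) μ :=
    Integrable.of_bound (hF.pow_const r).aestronglyMeasurable (A ^ r)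
      (Filter.Eventually.of_forall fun x => by
        rw [Real.norm_eq_abs, abs_of_nonneg (Real.rpow_nonneg (h0 x) _)]
        exact Real.rpow_le_rpow (h0 x) (hA x) hr0.le)
  have hI0 : 0 ≤ ∫ x, F x ^ r ∂μ := integral_nonneg fun x => Real.rpow_nonneg (h0 x) _
  have hZ : ∑ i ∈ Finset.range N, z i ≤ 2 ^ r * (∫ x, F x ^ r ∂μ + η) := by
    have e : ∀ i, z i = ∫ x, (T i).indicator (fun _ => (δ * 2 ^ i) ^ r) x ∂μ := fun i => by
      rw [integral_indicator_const _ (hTm i), smul_eq_mul, mul_comm]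
    have hi : ∀ i, Integrable (fun x => (T i).indicator (fun _ => (δ * 2 ^ i) ^ r) x) μ := fun i =>
      (integrable_const _).indicator (hTm i)
    simp_rw [e]
    rw [← integral_finsetSum _ fun i _ => hi i]
    calc ∫ x, ∑ i ∈ Finset.range N, (T i).indicator (fun _ => (δ * 2 ^ i) ^ r) x ∂μ
        ≤ ∫ x, (2 ^ r * F x ^ r + 2 ^ r * δ ^ r) ∂μ := by
          refine integral_mono (integrable_finsetSum _ fun i _ => hi i)
            ((hFr.const_mul _).add (integrable_const _)) fun x => ?_
          refine (sum_dyadicIco_rpow_le hδ0 hr0.le (hf0 x) N).trans ?_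
          have h1 := h0 x
          rw [← Real.mul_rpow (by norm_num) h1, ← Real.mul_rpow (by norm_num) hδ0.le]
          rcases le_total (F x) δ with h | h
          · refine le_add_of_nonneg_of_le (by positivity) (Real.rpow_le_rpow (hf0 x) ?_ hr0.le)
            simp only [hf]; linarith
          · refine le_add_of_le_of_nonneg (Real.rpow_le_rpow (hf0 x) ?_ hr0.le) (by positivity)
            simp only [hf]; linarith
      _ = 2 ^ r * ∫ x, F x ^ r ∂μ + 2 ^ r * (δ ^ r * μ.real Set.univ) := by
          rw [integral_add (hFr.const_mul _) (integrable_const _), integral_const_mul, integral_const,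
            smul_eq_mul]
          ring
      _ ≤ _ := by
          rw [mul_add]
          gcongr
  have hκi : ∀ S : Set (X × X), IntegrableOn κ S (μ.prod μ) := fun S =>
    (Integrable.of_bound hκ.aestronglyMeasurable B (Filter.Eventually.of_forall fun z => by
      rw [Real.norm_eq_abs, abs_of_nonneg (hκ0 z)]; exact hκB z)).integrableOn
  set c : ℕ → ℕ → ℝ := fun i j =>
    (δ * 2 ^ i) * (δ * 2 ^ j) * (K⁻¹ * ∫ z in T i ×ˢ T j, κ z ∂(μ.prod μ)) with hc
  have hsum := sum_dyadic_decay_le hρ0.le hρ1 hθ.le N hz0 hZ (c := c) fun i j hij => by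
    have h1 := (hrest (T i) (T j) (hTm i) (hTm j)).1
    have h2 := (hrest (T j) (T i) (hTm j) (hTm i)).2
    rw [← inv_mul_le_iff₀ hK] at h1 h2
    rw [hρ, ← dyadic_level_identity hδ0 hr hij _ measureReal_nonneg]
    constructor
    · exact mul_le_mul_of_nonneg_left h1 (by positivity)
    · simp only [hc]
      rw [mul_comm (δ * 2 ^ j)]
      exact mul_le_mul_of_nonneg_left h2 (by positivity)
  have hind : ∀ i j,
      ∫ z, ((T i ×ˢ T j).indicator (fun z => (4 * K) * ((δ * 2 ^ i) * (δ * 2 ^ j) * (K⁻¹ * κ z)))) z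
      ∂(μ.prod μ) = 4 * K * c i j := fun i j => by
    rw [integral_indicator ((hTm i).prod (hTm j)), integral_const_mul, integral_const_mul,
      integral_const_mul]
  have hii : ∀ i j, Integrable (fun z => ((T i ×ˢ T j).indicator
      (fun z => (4 * K) * ((δ * 2 ^ i) * (δ * 2 ^ j) * (K⁻¹ * κ z)))) z) (μ.prod μ) := fun i j =>
    (integrable_indicator_iff ((hTm i).prod (hTm j))).2
      ((((hκi _).const_mul _).const_mul _).const_mul _)
  have hpt : ∀ z : X × X, F z.1 * F z.2 * κ z ≤ ∑ i ∈ Finset.range N, ∑ j ∈ Finset.range N,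
      (T i ×ˢ T j).indicator (fun z => (4 * K) * ((δ * 2 ^ i) * (δ * 2 ^ j) * (K⁻¹ * κ z))) z := by
    intro z
    obtain ⟨i, hi, hvi⟩ := exists_mem_dyadicIco hδ0 (hfδ z.1) (hfN z.1)
    obtain ⟨j, hj, hvj⟩ := exists_mem_dyadicIco hδ0 (hfδ z.2) (hfN z.2)
    have hk := hκ0 z
    have hnn : ∀ i j, 0 ≤ (T i ×ˢ T j).indicator
        (fun z => (4 * K) * ((δ * 2 ^ i) * (δ * 2 ^ j) * (K⁻¹ * κ z))) z := fun i j =>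
      Set.indicator_nonneg (fun z _ => by have := hκ0 z; positivity) z
    refine le_trans ?_ (Finset.single_le_sum (fun i _ => Finset.sum_nonneg fun j _ => hnn i j) hi)
    refine le_trans ?_ (Finset.single_le_sum (fun j _ => hnn i j) hj)
    rw [Set.indicator_of_mem (show z ∈ T i ×ˢ T j from ⟨hvi, hvj⟩)]
    have h1 : F z.1 ≤ 2 * (δ * 2 ^ i) := by
      have := hvi.2; rw [pow_succ] at this; simp only [hf] at this; linarith
    have h2 : F z.2 ≤ 2 * (δ * 2 ^ j) := by
      have := hvj.2; rw [pow_succ] at this; simp only [hf] at this; linarith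
    calc F z.1 * F z.2 * κ z ≤ (2 * (δ * 2 ^ i)) * (2 * (δ * 2 ^ j)) * κ z :=
          mul_le_mul_of_nonneg_right (mul_le_mul h1 h2 (h0 _) (by positivity)) hk
      _ = _ := by field_simp; ring
  set Z : ℝ := 2 ^ r * (∫ x, F x ^ r ∂μ + η) with hZdef
  have hZ0 : 0 < Z := by positivity
  have hZr : Z * Z ^ θ = 4 * (∫ x, F x ^ r ∂μ + η) ^ (2 / r) := by
    have e : (2 : ℝ) / r = 1 + θ := by rw [div_eq_iff hr0.ne']; linarith
    rw [← Real.rpow_one_add' hZ0.le (by positivity), ← e, hZdef,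
      Real.mul_rpow (by positivity) (by positivity),
      ← Real.rpow_mul (by norm_num), mul_div_cancel₀ _ hr0.ne']
    norm_num
  calc ∫ z, F z.1 * F z.2 * κ z ∂(μ.prod μ) ≤ ∫ z, ∑ i ∈ Finset.range N, ∑ j ∈ Finset.range N,
      (T i ×ˢ T j).indicator (fun z => (4 * K) * ((δ * 2 ^ i) * (δ * 2 ^ j) * (K⁻¹ * κ z))) z
        ∂(μ.prod μ) := by
        refine integral_mono_of_nonneg (Filter.Eventually.of_forall fun z =>
          mul_nonneg (mul_nonneg (h0 _) (h0 _)) (hκ0 z)) ?_ (Filter.Eventually.of_forall hpt)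
        exact integrable_finsetSum _ fun i _ => integrable_finsetSum _ fun j _ => hii i j
    _ = 4 * K * ∑ i ∈ Finset.range N, ∑ j ∈ Finset.range N, c i j := by
        rw [integral_finsetSum _ fun i _ => integrable_finsetSum _ fun j _ => hii i j]
        simp_rw [integral_finsetSum _ fun j _ => hii _ j, hind, ← Finset.mul_sum]
    _ ≤ 4 * K * (2 * (1 - ρ)⁻¹ * (Z * Z ^ θ)) := mul_le_mul_of_nonneg_left hsum (by positivity)
    _ = _ := by rw [hZr]; ring

end

lemma exists_integral_weylMajorant_mul_le {γ r : ℝ} (hγ : 0 < γ) (hγ2 : γ < 2)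
    (hr : r + r * (1 - γ / 2) = 2) :
    ∃ C > 0, ∀ (M : ℕ) (F : ℝ → ℝ) (A : ℝ), 1 ≤ M → Measurable F → (∀ t, 0 ≤ F t) → (∀ t, F t ≤ A) →
      ∀ η > 0, ∫ z : ℝ × ℝ, F z.1 * F z.2 * weylMajorant M (z.1 - z.2) ^ γ ∂(timeMeas.prod timeMeas)
        ≤ C * (M : ℝ) ^ γ * (∫ t, F t ^ r ∂timeMeas + η) ^ (2 / r) := by
  obtain ⟨C, hC, hyoung⟩ := exists_integral_mul_kernel_le timeMeas (θ := 1 - γ / 2) (by linarith)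
    (by linarith) hr
  have hr1' : 0 < 1 - (2 : ℝ) ^ (γ - 2) := by
    have := Real.rpow_lt_one_of_one_lt_of_neg (x := 2) (z := γ - 2) (by norm_num) (by linarith)
    linarith
  set L : ℝ := 2000000000000 with hL
  refine ⟨C * ((1 + 4 * (1 - 2 ^ (γ - 2))⁻¹) * L ^ (γ / 2)), by positivity, ?_⟩
  intro M F A hM hF h0 hA η hη
  have hM0 : (0 : ℝ) < M := by exact_mod_cast hM
  set K : ℝ := (1 + 4 * (1 - 2 ^ (γ - 2))⁻¹) * (L * M ^ 2) ^ (γ / 2) with hK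
  have hK0 : 0 < K := by positivity
  have hKe : K = (1 + 4 * (1 - 2 ^ (γ - 2))⁻¹) * L ^ (γ / 2) * (M : ℝ) ^ γ := by
    rw [hK, Real.mul_rpow (by positivity) (by positivity), ← Real.rpow_natCast (M : ℝ) 2,
      ← Real.rpow_mul hM0.le, mul_assoc]
    congr 3; push_cast; ring
  have hW := measurable_weylMajorant M
  have hκ : Measurable fun z : ℝ × ℝ => weylMajorant M (z.1 - z.2) ^ γ :=
    (hW.comp (measurable_fst.sub measurable_snd)).pow_const γ
  have hκ0 : ∀ z : ℝ × ℝ, 0 ≤ weylMajorant M (z.1 - z.2) ^ γ := fun z =>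
    Real.rpow_nonneg (weylMajorant_nonneg _ _) _
  have hκB : ∀ z : ℝ × ℝ, weylMajorant M (z.1 - z.2) ^ γ ≤ (12 * M * (4 * M + 1)) ^ γ := fun z =>
    Real.rpow_le_rpow (weylMajorant_nonneg _ _) (weylMajorant_le_sq _ _) hγ.le
  have hκi : Integrable (fun z : ℝ × ℝ => weylMajorant M (z.1 - z.2) ^ γ) (timeMeas.prod timeMeas) :=
    Integrable.of_bound hκ.aestronglyMeasurable _ (Filter.Eventually.of_forall fun z => by
      rw [Real.norm_eq_abs, abs_of_nonneg (hκ0 z)]; exact hκB z)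
  have hone : ∀ S T : Set ℝ, MeasurableSet S → MeasurableSet T →
      ∫ z in S ×ˢ T, weylMajorant M (z.1 - z.2) ^ γ ∂(timeMeas.prod timeMeas)
        ≤ K * (timeMeas.real S * timeMeas.real T ^ (1 - γ / 2)) := by
    intro S T hS hT
    rw [setIntegral_prod _ hκi.integrableOn]
    have hin : ∀ᵐ t ∂(timeMeas.restrict S), ∫ s in T, weylMajorant M (t - s) ^ γ ∂timeMeas
        ≤ K * timeMeas.real T ^ (1 - γ / 2) := by
      refine ae_restrict_of_ae ?_
      filter_upwards [ae_restrict_mem measurableSet_Icc] with t ht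
      exact integral_rpow_le_of_weak timeMeas (hW.comp (measurable_const.sub measurable_id))
        (fun s => weylMajorant_nonneg _ _) (fun s => weylMajorant_le_sq _ _) (by positivity)
        (fun y hy => volume_weylMajorant_gt_le hM hy ht) hγ hγ2 T
    refine (integral_mono_of_nonneg (Filter.Eventually.of_forall fun t =>
      integral_nonneg fun s => Real.rpow_nonneg (weylMajorant_nonneg _ _) _)
      (integrable_const _) hin).trans_eq ?_
    rw [integral_const, smul_eq_mul, measureReal_restrict_apply_univ]
    ring
  have hswap : ∀ S T : Set ℝ,
      ∫ z in S ×ˢ T, weylMajorant M (z.1 - z.2) ^ γ ∂(timeMeas.prod timeMeas)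
        = ∫ z in T ×ˢ S, weylMajorant M (z.1 - z.2) ^ γ ∂(timeMeas.prod timeMeas) := by
    intro S T
    rw [← setIntegral_prod_swap]
    congr 1
    funext z
    rw [Prod.fst_swap, Prod.snd_swap, ← weylMajorant_neg, neg_sub]
  have := hyoung _ K A _ F hκ hκ0 hκB hK0 (fun S T hS hT => ⟨hone S T hS hT, by
    rw [hswap]; exact hone T S hT hS⟩) hF h0 hA η hη
  rw [hKe] at this
  refine this.trans_eq ?_
  ring

lemma sum_geom_up_le {B c w : ℝ} (hB : 0 < B) (hc : 0 < c) (hw : 0 < w) (N : ℕ) :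
    ∑ l ∈ Finset.range N, (if B * 2 ^ l ≤ w then (B * 2 ^ l) ^ c else 0)
      ≤ (1 - 2 ^ (-c))⁻¹ * w ^ c := by
  have hρ : (2 : ℝ) ^ (-c) < 1 := Real.rpow_lt_one_of_one_lt_of_neg (by norm_num) (by linarith)
  set ρ : ℝ := 2 ^ (-c) with hρdef
  have hρ0 : 0 < ρ := by positivity
  have h1 : 0 < 1 - ρ := by linarith
  have hfull : ∀ l : ℕ, ∑ i ∈ Finset.range (l + 1), (B * 2 ^ i) ^ c ≤ (1 - ρ)⁻¹ * (B * 2 ^ l) ^ c := by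
    intro l
    have hgeo := sum_pow_sub_le hρ0.le hρ l (l + 1)
    have e : ∀ i ∈ Finset.range (l + 1), (B * 2 ^ i) ^ c
        = (if i ≤ l then ρ ^ (l - i) else 0) * (B * 2 ^ l) ^ c := by
      intro i hi
      have hil : i ≤ l := by have := Finset.mem_range.1 hi; omega
      obtain ⟨d, rfl⟩ := Nat.exists_eq_add_of_le hil
      have e2 : ρ ^ d = (((2 : ℝ) ^ d) ^ c)⁻¹ := by
        rw [hρdef, ← Real.rpow_natCast, ← Real.rpow_natCast, ← Real.rpow_mul (by norm_num),
          ← Real.rpow_mul (by norm_num), ← Real.rpow_neg (by norm_num)]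
        congr 1; ring
      rw [if_pos hil, Nat.add_sub_cancel_left, e2, pow_add, ← mul_assoc B,
        Real.mul_rpow (x := B * 2 ^ i) (by positivity) (by positivity)]
      field_simp
    rw [Finset.sum_congr rfl e, ← Finset.sum_mul]
    exact mul_le_mul_of_nonneg_right hgeo (by positivity)
  induction N with
  | zero => simp only [Finset.range_zero, Finset.sum_empty]; positivity
  | succ N ih =>
    by_cases h : B * 2 ^ N ≤ w
    · calc _ ≤ ∑ i ∈ Finset.range (N + 1), (B * 2 ^ i) ^ c := by
            refine Finset.sum_le_sum fun i _ => ?_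
            split_ifs
            · exact le_rfl
            · positivity
        _ ≤ (1 - ρ)⁻¹ * (B * 2 ^ N) ^ c := hfull N
        _ ≤ _ := by gcongr
    · rw [Finset.sum_range_succ, if_neg h, add_zero]; exact ih

/-- Summation of a dyadically decomposed bilinear form bounded both on `L¹` and on `L²`. -/
lemma sum_bilinear_le {r : ℝ} (hr1 : 1 < r) (hr2 : r < 2) {δ k X Y : ℝ} (hδ : 0 < δ) (hk : 0 ≤ k)
    (N : ℕ) {x y : ℕ → ℝ} (hx : ∀ j, 0 ≤ x j) (hy : ∀ j, 0 ≤ y j)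
    (hX : ∑ j ∈ Finset.range N, x j ≤ X) (hY : ∑ j ∈ Finset.range N, y j ≤ Y) {c : ℕ → ℕ → ℝ}
    (h1 : ∀ j l, c j l ≤ k * ((δ * 2 ^ j) * (δ * 2 ^ l)) ^ (1 - r) * (x j * y l))
    (h2 : ∀ j l, c j l ≤ ((δ * 2 ^ j) * (δ * 2 ^ l)) ^ (1 - r / 2) * (√(x j) * √(y l))) :
    ∑ j ∈ Finset.range N, ∑ l ∈ Finset.range N, c j l
      ≤ ((1 - 2 ^ (-(1 - r / 2)))⁻¹ + 1) * (k ^ (2 / r - 1) * (X * Y) ^ (1 / r)) := by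
  have hr0 : 0 < r := by linarith
  have hg : 0 < 1 - (2 : ℝ) ^ (-(1 - r / 2)) := by
    have := Real.rpow_lt_one_of_one_lt_of_neg (x := 2) (z := -(1 - r / 2)) (by norm_num) (by linarith)
    linarith
  have hX0 : 0 ≤ X := (Finset.sum_nonneg fun i _ => hx i).trans hX
  have hY0 : 0 ≤ Y := (Finset.sum_nonneg fun i _ => hy i).trans hY
  by_cases hdeg : k = 0 ∨ X = 0 ∨ Y = 0
  · refine le_trans (Finset.sum_nonpos fun j hj => Finset.sum_nonpos fun l hl => ?_) (by positivity)
    refine (h1 j l).trans (le_of_eq ?_)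
    rcases hdeg with h | h | h
    · rw [h]; ring
    · have : x j = 0 := le_antisymm
        ((Finset.single_le_sum (fun i _ => hx i) hj).trans (hX.trans_eq h)) (hx j)
      rw [this]; ring
    · have : y l = 0 := le_antisymm
        ((Finset.single_le_sum (fun i _ => hy i) hl).trans (hY.trans_eq h)) (hy l)
      rw [this]; ring
  push Not at hdeg
  have hk : 0 < k := lt_of_le_of_ne hk hdeg.1.symm
  have hX0 : 0 < X := lt_of_le_of_ne hX0 hdeg.2.1.symm
  have hY0 : 0 < Y := lt_of_le_of_ne hY0 hdeg.2.2.symm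
  set a := √X with ha
  set b := √Y with hb
  have ha0 : 0 < a := Real.sqrt_pos.2 hX0
  have hb0 : 0 < b := Real.sqrt_pos.2 hY0
  have haX : X = a ^ 2 := (Real.sq_sqrt hX0.le).symm
  have hbY : Y = b ^ 2 := (Real.sq_sqrt hY0.le).symm
  set w : ℝ := (k * (a * b)) ^ (2 / r) with hw
  have hw0 : 0 < w := by positivity
  set g : ℝ := (1 - 2 ^ (-(1 - r / 2)))⁻¹ with hgdef
  have hg0 : 0 < g := by positivity
  have hc : 0 < 1 - r / 2 := by linarith
  have hwr : w ^ (r / 2) = k * (a * b) := by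
    rw [hw, ← Real.rpow_mul (by positivity)]
    rw [show 2 / r * (r / 2) = 1 by field_simp, Real.rpow_one]
  have hwe : w ^ (1 - r / 2) * (a * b) = k ^ (2 / r - 1) * (X * Y) ^ (1 / r) := by
    rw [hw, ← Real.rpow_mul (by positivity), Real.mul_rpow hk.le (by positivity), haX, hbY, ← mul_pow,
      ← Real.rpow_natCast (a * b) 2, ← Real.rpow_mul (by positivity), mul_assoc,
      ← Real.rpow_add_one (by positivity)]
    congr 2
    · field_simp
    · push_cast; field_simp; ring
  have hwk : k * w ^ (1 - r) * (X * Y) = w ^ (1 - r / 2) * (a * b) := by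
    rw [show 1 - r / 2 = r / 2 + (1 - r) by ring, Real.rpow_add hw0, hwr, haX, hbY]
    ring
  set P : ℕ → ℕ → ℝ := fun j l => (δ * 2 ^ j) * (δ * 2 ^ l) with hP
  have hP0 : ∀ j l, 0 < P j l := fun j l => by positivity
  set q : ℕ → ℕ → ℝ := fun j l => if P j l ≤ w then P j l ^ (1 - r / 2) else 0 with hq
  have hq0 : ∀ j l, 0 ≤ q j l := fun j l => by
    simp only [hq]; have := hP0 j l; split_ifs <;> positivity
  have hqs : ∀ j, ∑ l ∈ Finset.range N, q j l ≤ g * w ^ (1 - r / 2) := by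
    intro j
    refine le_trans (le_of_eq (Finset.sum_congr rfl fun l _ => ?_))
      (sum_geom_up_le (B := δ * 2 ^ j * δ) (by positivity) hc hw0 N)
    simp only [hq, hP, mul_assoc]
  have hqs' : ∀ l, ∑ j ∈ Finset.range N, q j l ≤ g * w ^ (1 - r / 2) := by
    intro l
    refine le_trans (le_of_eq (Finset.sum_congr rfl fun j _ => ?_)) (hqs l)
    simp only [hq, hP, mul_comm (δ * 2 ^ j)]
  have hpt : ∀ j l, c j l ≤ q j l * (b / (2 * a) * x j) + q j l * (a / (2 * b) * y l)
      + k * w ^ (1 - r) * (x j * y l) := by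
    intro j l
    have hxj := hx j
    have hyl := hy l
    have hp := hP0 j l
    by_cases h : P j l ≤ w
    · refine le_add_of_le_of_nonneg ((h2 j l).trans ?_) (by positivity)
      simp only [hq, if_pos h]
      rw [← mul_add]
      refine mul_le_mul_of_nonneg_left ?_ (by positivity)
      have e : b / (2 * a) * x j + a / (2 * b) * y l = (b ^ 2 * x j + a ^ 2 * y l) / (2 * (a * b)) := by
        field_simp
      rw [e, le_div_iff₀ (by positivity)]
      have := sq_nonneg (b * √(x j) - a * √(y l))
      nlinarith [Real.sq_sqrt hxj, Real.sq_sqrt hyl]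
    · refine le_add_of_nonneg_of_le ?_ ((h1 j l).trans ?_)
      · simp only [hq, if_neg h]; simp
      · refine mul_le_mul_of_nonneg_right ?_ (by positivity)
        refine mul_le_mul_of_nonneg_left ?_ hk.le
        exact Real.rpow_le_rpow_of_nonpos hw0 (not_le.1 h).le (by linarith)
  have hS1 : ∑ j ∈ Finset.range N, ∑ l ∈ Finset.range N, q j l * (b / (2 * a) * x j)
      ≤ g * w ^ (1 - r / 2) * (a * b / 2) := by
    calc _ = ∑ j ∈ Finset.range N, (∑ l ∈ Finset.range N, q j l) * (b / (2 * a) * x j) := by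
          simp_rw [Finset.sum_mul]
      _ ≤ ∑ j ∈ Finset.range N, g * w ^ (1 - r / 2) * (b / (2 * a) * x j) := by
          refine Finset.sum_le_sum fun j _ => ?_
          have := hx j
          exact mul_le_mul_of_nonneg_right (hqs j) (by positivity)
      _ = g * w ^ (1 - r / 2) * (b / (2 * a) * ∑ j ∈ Finset.range N, x j) := by
          rw [← Finset.mul_sum, ← Finset.mul_sum]
      _ ≤ g * w ^ (1 - r / 2) * (b / (2 * a) * X) := by gcongr
      _ = _ := by rw [haX]; field_simp
  have hS2 : ∑ j ∈ Finset.range N, ∑ l ∈ Finset.range N, q j l * (a / (2 * b) * y l)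
      ≤ g * w ^ (1 - r / 2) * (a * b / 2) := by
    rw [Finset.sum_comm]
    calc _ = ∑ l ∈ Finset.range N, (∑ j ∈ Finset.range N, q j l) * (a / (2 * b) * y l) := by
          simp_rw [Finset.sum_mul]
      _ ≤ ∑ l ∈ Finset.range N, g * w ^ (1 - r / 2) * (a / (2 * b) * y l) := by
          refine Finset.sum_le_sum fun j _ => ?_
          have := hy j
          exact mul_le_mul_of_nonneg_right (hqs' j) (by positivity)
      _ = g * w ^ (1 - r / 2) * (a / (2 * b) * ∑ l ∈ Finset.range N, y l) := by
          rw [← Finset.mul_sum, ← Finset.mul_sum]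
      _ ≤ g * w ^ (1 - r / 2) * (a / (2 * b) * Y) := by gcongr
      _ = _ := by rw [hbY]; field_simp
  have hS3 : ∑ j ∈ Finset.range N, ∑ l ∈ Finset.range N, k * w ^ (1 - r) * (x j * y l)
      ≤ k * w ^ (1 - r) * (X * Y) := by
    simp_rw [← Finset.mul_sum]
    rw [← Finset.sum_mul]
    have : 0 ≤ ∑ l ∈ Finset.range N, y l := Finset.sum_nonneg fun l _ => hy l
    gcongr
  calc _ ≤ ∑ j ∈ Finset.range N, ∑ l ∈ Finset.range N, (q j l * (b / (2 * a) * x j)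
        + q j l * (a / (2 * b) * y l) + k * w ^ (1 - r) * (x j * y l)) :=
        Finset.sum_le_sum fun j _ => Finset.sum_le_sum fun l _ => hpt j l
    _ ≤ g * w ^ (1 - r / 2) * (a * b / 2) + g * w ^ (1 - r / 2) * (a * b / 2)
        + k * w ^ (1 - r) * (X * Y) := by
        simp_rw [Finset.sum_add_distrib]
        gcongr
    _ = _ := by rw [hwk, ← hwe]; ring

section
variable {n : ℕ}

/-- The part of `f` where `‖f‖` lies in `[δ2ʲ, δ2ʲ⁺¹)`. -/
noncomputable def dyadicPart (δ : ℝ) (f : (Fin n → ℝ) → ℂ) (j : ℕ) : (Fin n → ℝ) → ℂ :=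
  {x | ‖f x‖ ∈ dyadicIco δ j}.indicator f

lemma measurableSet_norm_mem_dyadicIco {f : (Fin n → ℝ) → ℂ} (hf : Measurable f) (δ : ℝ) (j : ℕ) :
    MeasurableSet {x | ‖f x‖ ∈ dyadicIco δ j} := hf.norm (measurableSet_dyadicIco δ j)

lemma measurable_dyadicPart {f : (Fin n → ℝ) → ℂ} (hf : Measurable f) (δ : ℝ) (j : ℕ) :
    Measurable (dyadicPart δ f j) := hf.indicator (measurableSet_norm_mem_dyadicIco hf δ j)

lemma norm_dyadicPart_le (δ : ℝ) (f : (Fin n → ℝ) → ℂ) (j : ℕ) (x : Fin n → ℝ) :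
    ‖dyadicPart δ f j x‖ ≤ ‖f x‖ := norm_indicator_le_norm_self _ _

lemma integral_norm_dyadicPart_pow_le (δ : ℝ) {f : (Fin n → ℝ) → ℂ} (hf : Measurable f)
    (j : ℕ) {m : ℕ} (hm : m ≠ 0) : ∫ x, ‖dyadicPart δ f j x‖ ^ m ∂(spaceMeas n)
      ≤ (2 * (δ * 2 ^ j)) ^ m * (spaceMeas n).real {x | ‖f x‖ ∈ dyadicIco δ j} := by
  have hE := measurableSet_norm_mem_dyadicIco hf δ j
  have e : ∫ x, {x | ‖f x‖ ∈ dyadicIco δ j}.indicator (fun _ => (2 * (δ * 2 ^ j)) ^ m) x ∂(spaceMeas n)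
      = (2 * (δ * 2 ^ j)) ^ m * (spaceMeas n).real {x | ‖f x‖ ∈ dyadicIco δ j} := by
    rw [integral_indicator_const _ hE, smul_eq_mul, mul_comm]
  rw [← e]
  refine integral_mono_of_nonneg (Filter.Eventually.of_forall fun x => by positivity)
    ((integrable_const _).indicator hE) (Filter.Eventually.of_forall fun x => ?_)
  by_cases hx : x ∈ {x | ‖f x‖ ∈ dyadicIco δ j}
  · have h2 := (show ‖f x‖ ∈ dyadicIco δ j from hx).2
    simp only [dyadicPart, Set.indicator_of_mem hx]
    refine pow_le_pow_left₀ (norm_nonneg _) ?_ m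
    rw [pow_succ] at h2
    linarith
  · simp [dyadicPart, Set.indicator_of_notMem hx, hm]

lemma sum_dyadic_measure_le {δ r : ℝ} (hδ : 0 < δ) (hr : 0 ≤ r) {f : (Fin n → ℝ) → ℂ}
    (hf : Measurable f) {A : ℝ} (hA : ∀ x, ‖f x‖ ≤ A) (N : ℕ) :
    ∑ j ∈ Finset.range N, (δ * 2 ^ j) ^ r * (spaceMeas n).real {x | ‖f x‖ ∈ dyadicIco δ j}
      ≤ ∫ x, ‖f x‖ ^ r ∂(spaceMeas n) := by
  have e : ∀ j, (δ * 2 ^ j) ^ r * (spaceMeas n).real {x | ‖f x‖ ∈ dyadicIco δ j}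
      = ∫ x, {x | ‖f x‖ ∈ dyadicIco δ j}.indicator (fun _ => (δ * 2 ^ j) ^ r) x ∂(spaceMeas n) := by
    intro j
    rw [integral_indicator_const _ (measurableSet_norm_mem_dyadicIco hf δ j), smul_eq_mul, mul_comm]
  have hi : ∀ j, Integrable ({x | ‖f x‖ ∈ dyadicIco δ j}.indicator fun _ => (δ * 2 ^ j) ^ r)
      (spaceMeas n) := fun j =>
    (integrable_const _).indicator (measurableSet_norm_mem_dyadicIco hf δ j)
  simp_rw [e]
  rw [← integral_finsetSum _ fun j _ => hi j]
  refine integral_mono (integrable_finsetSum _ fun j _ => hi j) ?_ fun x => ?_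
  · refine Integrable.of_bound (hf.norm.pow_const r).aestronglyMeasurable (A ^ r)
      (Filter.Eventually.of_forall fun x => ?_)
    rw [Real.norm_eq_abs, abs_of_nonneg (by positivity)]
    exact Real.rpow_le_rpow (norm_nonneg _) (hA x) hr
  · exact sum_dyadicIco_rpow_le hδ hr (norm_nonneg (f x)) N

lemma sum_dyadicPart {δ : ℝ} (hδ : 0 < δ) {f : (Fin n → ℝ) → ℂ} {N : ℕ}
    (h0 : ∀ x, f x = 0 ∨ δ ≤ ‖f x‖) (hN : ∀ x, ‖f x‖ < δ * 2 ^ N) (x : Fin n → ℝ) :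
    ∑ j ∈ Finset.range N, dyadicPart δ f j x = f x := by
  rcases h0 x with h | h
  · have : ∀ j, dyadicPart δ f j x = 0 := fun j => by
      have := norm_dyadicPart_le δ f j x
      rw [h, norm_zero] at this
      exact norm_le_zero_iff.1 this
    simp [this, h]
  · exact sum_dyadicIco_eq hδ h (hN x) (f x)

lemma spaceCoeff_eq_sum {δ : ℝ} (hδ : 0 < δ) {f : (Fin n → ℝ) → ℂ} (hf : Measurable f) {A : ℝ}
    (hA : ∀ x, ‖f x‖ ≤ A) {N : ℕ} (h0 : ∀ x, f x = 0 ∨ δ ≤ ‖f x‖) (hN : ∀ x, ‖f x‖ < δ * 2 ^ N)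
    (ξ : Fin n → ℤ) : spaceCoeff f ξ = ∑ j ∈ Finset.range N, spaceCoeff (dyadicPart δ f j) ξ := by
  unfold spaceCoeff
  rw [← integral_finsetSum _ fun j _ => integrable_mul_conj_spaceChar (measurable_dyadicPart hf δ j)
    (fun x => (norm_dyadicPart_le δ f j x).trans (hA x)) ξ]
  congr 1
  funext x
  rw [← Finset.sum_mul, sum_dyadicPart hδ h0 hN]

lemma propForm_eq_sum {δ : ℝ} (hδ : 0 < δ) {f h : (Fin n → ℝ) → ℂ} (hf : Measurable f)
    (hh : Measurable h) {A : ℝ} (hA : ∀ x, ‖f x‖ ≤ A) (hB : ∀ x, ‖h x‖ ≤ A)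
    (hf0 : ∀ x, f x = 0 ∨ δ ≤ ‖f x‖) (hh0 : ∀ x, h x = 0 ∨ δ ≤ ‖h x‖) {N : ℕ} (hN : A < δ * 2 ^ N)
    (M : ℕ) (τ : ℝ) : propForm M τ f h = ∑ j ∈ Finset.range N, ∑ l ∈ Finset.range N,
      propForm M τ (dyadicPart δ f j) (dyadicPart δ h l) := by
  have e : ∀ ξ, spaceCoeff f ξ * (starRingEnd ℂ) (spaceCoeff h ξ)
      = ∑ j ∈ Finset.range N, ∑ l ∈ Finset.range N,
        spaceCoeff (dyadicPart δ f j) ξ * (starRingEnd ℂ) (spaceCoeff (dyadicPart δ h l) ξ) := by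
    intro ξ
    rw [spaceCoeff_eq_sum hδ hf hA hf0 (fun x => (hA x).trans_lt hN),
      spaceCoeff_eq_sum hδ hh hB hh0 (fun x => (hB x).trans_lt hN), map_sum, Finset.sum_mul_sum]
  unfold propForm
  simp_rw [e, Finset.mul_sum]
  rw [Finset.sum_comm]
  exact Finset.sum_congr rfl fun j _ => Finset.sum_comm

lemma one_le_two_pi_pow (n : ℕ) : 1 ≤ (2 * π) ^ n :=
  one_le_pow₀ (by have := Real.pi_gt_three; linarith)

/-- The interpolated dispersive bound, for functions bounded below on their support. -/
lemma exists_norm_propForm_le (n : ℕ) {r : ℝ} (hr1 : 1 < r) (hr2 : r < 2) :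
    ∃ C > 0, ∀ (M : ℕ) (τ δ A : ℝ) (f h : (Fin n → ℝ) → ℂ), 1 ≤ M → 0 < δ → Measurable f → Measurable h →
      (∀ x, ‖f x‖ ≤ A) → (∀ x, ‖h x‖ ≤ A) → (∀ x, f x = 0 ∨ δ ≤ ‖f x‖) →
      (∀ x, h x = 0 ∨ δ ≤ ‖h x‖) → ‖propForm M τ f h‖ ≤
        C * ((weylMajorant M τ ^ ((n : ℝ) / 2)) ^ (2 / r - 1) *
          ((∫ x, ‖f x‖ ^ r ∂(spaceMeas n)) * ∫ x, ‖h x‖ ^ r ∂(spaceMeas n)) ^ (1 / r)) := by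
  have hg : 0 < 1 - (2 : ℝ) ^ (-(1 - r / 2)) := by
    have := Real.rpow_lt_one_of_one_lt_of_neg (x := 2) (z := -(1 - r / 2)) (by norm_num) (by linarith)
    linarith
  set K : ℝ := 4 * (2 * π) ^ n with hK
  have hK4 : 4 ≤ K := by have := one_le_two_pi_pow n; linarith
  have hK0 : 0 < K := by linarith
  refine ⟨K * ((1 - 2 ^ (-(1 - r / 2)))⁻¹ + 1), by positivity, ?_⟩
  intro M τ δ A f h hM hδ hf hh hA hB hf0 hh0
  obtain ⟨N, hN⟩ := pow_unbounded_of_one_lt (A / δ) (one_lt_two (α := ℝ))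
  rw [div_lt_iff₀ hδ, mul_comm] at hN
  set u : ℕ → ℝ := fun j => δ * 2 ^ j with hu
  have hu0 : ∀ j, 0 < u j := fun j => by positivity
  set α : ℕ → ℝ := fun j => (spaceMeas n).real {x | ‖f x‖ ∈ dyadicIco δ j} with hα
  set β : ℕ → ℝ := fun j => (spaceMeas n).real {x | ‖h x‖ ∈ dyadicIco δ j} with hβ
  have hα0 : ∀ j, 0 ≤ α j := fun j => measureReal_nonneg
  have hβ0 : ∀ j, 0 ≤ β j := fun j => measureReal_nonneg
  set k : ℝ := weylMajorant M τ ^ ((n : ℝ) / 2) with hk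
  have hk0 : 0 ≤ k := Real.rpow_nonneg (weylMajorant_nonneg _ _) _
  set c : ℕ → ℕ → ℝ := fun j l => ‖propForm M τ (dyadicPart δ f j) (dyadicPart δ h l)‖ / K with hc
  have key := sum_bilinear_le hr1 hr2 hδ hk0 N (x := fun j => u j ^ r * α j)
    (y := fun j => u j ^ r * β j) (fun j => mul_nonneg (Real.rpow_nonneg (hu0 j).le _) (hα0 j))
    (fun j => mul_nonneg (Real.rpow_nonneg (hu0 j).le _) (hβ0 j))
    (sum_dyadic_measure_le hδ (by linarith) hf hA N) (sum_dyadic_measure_le hδ (by linarith) hh hB N)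
    (c := c) ?_ ?_
  · rw [propForm_eq_sum hδ hf hh hA hB hf0 hh0 hN]
    calc _ ≤ ∑ j ∈ Finset.range N, ∑ l ∈ Finset.range N, K * c j l := by
          refine (norm_sum_le _ _).trans (Finset.sum_le_sum fun j _ => (norm_sum_le _ _).trans
            (Finset.sum_le_sum fun l _ => le_of_eq (mul_div_cancel₀ _ hK0.ne').symm))
      _ = K * ∑ j ∈ Finset.range N, ∑ l ∈ Finset.range N, c j l := by simp_rw [← Finset.mul_sum]
      _ ≤ _ := by
          rw [mul_assoc K]
          exact mul_le_mul_of_nonneg_left key hK0.le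
  · intro j l
    have h1 := norm_propForm_le_one hM τ (measurable_dyadicPart hf δ j) (measurable_dyadicPart hh δ l)
      (fun x => (norm_dyadicPart_le δ f j x).trans (hA x))
      (fun x => (norm_dyadicPart_le δ h l x).trans (hB x))
    have h2 := integral_norm_dyadicPart_pow_le δ hf j one_ne_zero
    have h3 := integral_norm_dyadicPart_pow_le δ hh l one_ne_zero
    simp only [pow_one] at h2 h3
    have hp : (0 : ℝ) < u j * u l := mul_pos (hu0 j) (hu0 l)
    have e : k * (u j * u l) ^ (1 - r) * (u j ^ r * α j * (u l ^ r * β l))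
        = k * (u j * u l * (α j * β l)) := by
      have : (u j * u l) ^ (1 - r) * (u j ^ r * u l ^ r) = u j * u l := by
        rw [← Real.mul_rpow (hu0 j).le (hu0 l).le, ← Real.rpow_add hp, sub_add_cancel, Real.rpow_one]
      linear_combination k * α j * β l * this
    change _ ≤ k * (u j * u l) ^ (1 - r) * (u j ^ r * α j * (u l ^ r * β l))
    rw [e]
    simp only [hc]
    rw [div_le_iff₀ hK0]
    have hnn : 0 ≤ k * (u j * u l * (α j * β l)) :=
      mul_nonneg hk0 (mul_nonneg hp.le (mul_nonneg (hα0 j) (hβ0 l)))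
    calc _ ≤ k * ((2 * u j * α j) * (2 * u l * β l)) := h1.trans
          (mul_le_mul_of_nonneg_left (mul_le_mul h2 h3 (integral_nonneg fun _ => norm_nonneg _)
            (mul_nonneg (mul_nonneg zero_le_two (hu0 j).le) (hα0 j))) hk0)
      _ = k * (u j * u l * (α j * β l)) * 4 := by ring
      _ ≤ _ := mul_le_mul_of_nonneg_left hK4 hnn
  · intro j l
    have h1 := norm_propForm_le_two M τ (measurable_dyadicPart hf δ j) (measurable_dyadicPart hh δ l)
      (fun x => (norm_dyadicPart_le δ f j x).trans (hA x))
      (fun x => (norm_dyadicPart_le δ h l x).trans (hB x))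
    have h2 := Real.sqrt_le_sqrt (integral_norm_dyadicPart_pow_le δ hf j two_ne_zero)
    have h3 := Real.sqrt_le_sqrt (integral_norm_dyadicPart_pow_le δ hh l two_ne_zero)
    rw [Real.sqrt_mul (sq_nonneg _), Real.sqrt_sq (by positivity)] at h2 h3
    have hp : (0 : ℝ) < u j * u l := mul_pos (hu0 j) (hu0 l)
    have hs : ∀ v w : ℝ, 0 < v → √(v ^ r * w) = v ^ (r / 2) * √w := fun v w hv => by
      rw [Real.sqrt_mul (by positivity), Real.sqrt_eq_rpow (v ^ r), ← Real.rpow_mul hv.le]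
      congr 2; ring
    have e : (u j * u l) ^ (1 - r / 2) * (√(u j ^ r * α j) * √(u l ^ r * β l))
        = u j * u l * (√(α j) * √(β l)) := by
      have : (u j * u l) ^ (1 - r / 2) * (u j ^ (r / 2) * u l ^ (r / 2)) = u j * u l := by
        rw [← Real.mul_rpow (hu0 j).le (hu0 l).le, ← Real.rpow_add hp, sub_add_cancel, Real.rpow_one]
      rw [hs _ _ (hu0 j), hs _ _ (hu0 l)]
      linear_combination √(α j) * √(β l) * this
    change _ ≤ (u j * u l) ^ (1 - r / 2) * (√(u j ^ r * α j) * √(u l ^ r * β l))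
    rw [e]
    simp only [hc]
    rw [div_le_iff₀ hK0]
    calc _ ≤ (2 * π) ^ n * ((2 * u j * √(α j)) * (2 * u l * √(β l))) := h1.trans
          (mul_le_mul_of_nonneg_left (mul_le_mul h2 h3 (Real.sqrt_nonneg _)
            (mul_nonneg (mul_nonneg zero_le_two (hu0 j).le) (Real.sqrt_nonneg _))) (by positivity))
      _ = _ := by rw [hK]; ring

end

section
variable {n : ℕ}

/-- The dual function `|u|^{p-2} u` of a wave, restricted to the set where `|u| > 1`. -/
noncomputable def dualWave (S : Finset (Fin n → ℤ)) (a : (Fin n → ℤ) → ℂ) (p : ℝ)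
    (q : ℝ × (Fin n → ℝ)) : ℂ :=
  {q | 1 < ‖wave S a q‖}.indicator (fun q => ((‖wave S a q‖ ^ (p - 2) : ℝ) : ℂ) * wave S a q) q

lemma measurable_dualWave (S : Finset (Fin n → ℤ)) (a : (Fin n → ℤ) → ℂ) (p : ℝ) :
    Measurable (dualWave S a p) := by
  unfold dualWave
  exact ((Complex.measurable_ofReal.comp ((wave_measurable S a).norm.pow_const _)).mul
    (wave_measurable S a)).indicator (measurableSet_level S a 1)

lemma norm_dualWave (S : Finset (Fin n → ℤ)) (a : (Fin n → ℤ) → ℂ) (p : ℝ) (q : ℝ × (Fin n → ℝ)) :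
    ‖dualWave S a p q‖ = {q | 1 < ‖wave S a q‖}.indicator (fun q => ‖wave S a q‖ ^ (p - 1)) q := by
  unfold dualWave
  by_cases h : q ∈ {q | 1 < ‖wave S a q‖}
  · have h0 : 0 < ‖wave S a q‖ := zero_lt_one.trans h
    rw [Set.indicator_of_mem h, Set.indicator_of_mem h, norm_mul, Complex.norm_real,
      Real.norm_of_nonneg (by positivity), ← Real.rpow_add_one h0.ne']
    congr 1; ring
  · rw [Set.indicator_of_notMem h, Set.indicator_of_notMem h, norm_zero]

lemma dualWave_eq_zero_or (S : Finset (Fin n → ℤ)) (a : (Fin n → ℤ) → ℂ) {p : ℝ} (hp : 1 ≤ p)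
    (q : ℝ × (Fin n → ℝ)) : dualWave S a p q = 0 ∨ 1 ≤ ‖dualWave S a p q‖ := by
  by_cases h : q ∈ {q | 1 < ‖wave S a q‖}
  · right
    rw [norm_dualWave, Set.indicator_of_mem h]
    exact Real.one_le_rpow (le_of_lt h) (by linarith)
  · left
    rw [dualWave, Set.indicator_of_notMem h]

lemma norm_dualWave_le (S : Finset (Fin n → ℤ)) (a : (Fin n → ℤ) → ℂ) {p : ℝ} (hp : 1 ≤ p)
    (q : ℝ × (Fin n → ℝ)) : ‖dualWave S a p q‖ ≤ (∑ ξ ∈ S, ‖a ξ‖) ^ (p - 1) := by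
  rw [norm_dualWave]
  refine (Set.indicator_le_self' (fun _ _ => by positivity) q).trans ?_
  exact Real.rpow_le_rpow (norm_nonneg _) (wave_norm_le S a q) (by linarith)

lemma norm_dualWave_rpow (S : Finset (Fin n → ℤ)) (a : (Fin n → ℤ) → ℂ) {p r : ℝ} (hr : 0 < r)
    (hpr : (p - 1) * r = p) (q : ℝ × (Fin n → ℝ)) : ‖dualWave S a p q‖ ^ r
      = {q | 1 < ‖wave S a q‖}.indicator (fun q => ‖wave S a q‖ ^ p) q := by
  rw [norm_dualWave]
  by_cases h : q ∈ {q | 1 < ‖wave S a q‖}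
  · rw [Set.indicator_of_mem h, Set.indicator_of_mem h, ← Real.rpow_mul (norm_nonneg _), hpr]
  · rw [Set.indicator_of_notMem h, Set.indicator_of_notMem h, Real.zero_rpow hr.ne']

lemma dualWave_mul_conj (S : Finset (Fin n → ℤ)) (a : (Fin n → ℤ) → ℂ) (p : ℝ)
    (q : ℝ × (Fin n → ℝ)) : dualWave S a p q * (starRingEnd ℂ) (wave S a q)
      = (({q | 1 < ‖wave S a q‖}.indicator (fun q => ‖wave S a q‖ ^ p) q : ℝ) : ℂ) := by
  unfold dualWave
  by_cases h : q ∈ {q | 1 < ‖wave S a q‖}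
  · have h0 : 0 < ‖wave S a q‖ := zero_lt_one.trans h
    rw [Set.indicator_of_mem h, Set.indicator_of_mem h, mul_assoc, Complex.mul_conj,
      Complex.normSq_eq_norm_sq, ← Complex.ofReal_mul, ← Real.rpow_natCast _ 2,
      ← Real.rpow_add h0]
    congr 2; push_cast; ring
  · rw [Set.indicator_of_notMem h, Set.indicator_of_notMem h, zero_mul, Complex.ofReal_zero]

end

/-- The endpoint estimate in dimension at least four, for the superlevel set of height one. -/
lemma exists_sq_integral_dualWave_le {n : ℕ} {p r : ℝ} (hp : 1 ≤ p) (hpr : (p - 1) * r = p) (hr1 : 1 < r)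
    (hr2 : r < 2) (hγ : 0 < (n : ℝ) / 2 * (2 / r - 1)) (hγ2 : (n : ℝ) / 2 * (2 / r - 1) < 2)
    (hr : r + r * (1 - (n : ℝ) / 2 * (2 / r - 1) / 2) = 2) :
    ∃ C > 0, ∀ M : ℕ, 1 ≤ M → ∀ (S : Finset (Fin n → ℤ)) (a : (Fin n → ℤ) → ℂ),
      (∀ ξ ∈ S, ∀ i, 2 * |ξ i| ≤ M) → ∑ ξ ∈ S, ‖a ξ‖ ^ 2 ≤ 1 → ∀ η > 0,
      (∫ q, ‖dualWave S a p q‖ ^ r ∂(stMeas n)) ^ 2 ≤ C * (M : ℝ) ^ ((n : ℝ) / 2 * (2 / r - 1)) *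
        ((∫ q, ‖dualWave S a p q‖ ^ r ∂(stMeas n)) + η) ^ (2 / r) := by
  obtain ⟨C₁, hC₁, H₁⟩ := exists_norm_propForm_le n hr1 hr2
  obtain ⟨C₂, hC₂, H₂⟩ := exists_integral_weylMajorant_mul_le hγ hγ2 hr
  have hr0 : 0 < r := by linarith
  refine ⟨2 ^ n * (C₁ * C₂), by positivity, ?_⟩
  intro M hM S a hS ha η hη
  set γ := (n : ℝ) / 2 * (2 / r - 1) with hγdef
  set g := dualWave S a p with hgdef
  have hg : Measurable g := measurable_dualWave S a p
  set A : ℝ := (∑ ξ ∈ S, ‖a ξ‖) ^ (p - 1) with hA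
  have hA0 : 0 ≤ A := Real.rpow_nonneg (Finset.sum_nonneg fun _ _ => norm_nonneg _) _
  have hgA : ∀ q, ‖g q‖ ≤ A := norm_dualWave_le S a hp
  have hgr : Measurable fun q => ‖g q‖ ^ r := hg.norm.pow_const r
  have hgr0 : ∀ q, 0 ≤ ‖g q‖ ^ r := fun q => by positivity
  have hgrA : ∀ q, ‖g q‖ ^ r ≤ A ^ r := fun q => Real.rpow_le_rpow (norm_nonneg _) (hgA q) hr0.le
  have hgri : Integrable (fun q => ‖g q‖ ^ r) (stMeas n) :=
    Integrable.of_bound hgr.aestronglyMeasurable (A ^ r) (Filter.Eventually.of_forall fun q => by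
      rw [Real.norm_of_nonneg (hgr0 q)]; exact hgrA q)
  set I : ℝ → ℝ := fun t => ∫ x, ‖g (t, x)‖ ^ r ∂(spaceMeas n) with hI
  have hI0 : ∀ t, 0 ≤ I t := fun t => integral_nonneg fun x => hgr0 _
  have hIm : Measurable I := hgr.stronglyMeasurable.integral_prod_right'.measurable
  have hIB : ∀ t, I t ≤ A ^ r * (spaceMeas n).real Set.univ := by
    intro t
    refine (integral_mono_of_nonneg (Filter.Eventually.of_forall fun x => hgr0 _)
      (integrable_const (A ^ r)) (Filter.Eventually.of_forall fun x => hgrA _)).trans_eq ?_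
    rw [integral_const, smul_eq_mul, mul_comm]
  set F : ℝ → ℝ := fun t => I t ^ (1 / r) with hF
  have hF0 : ∀ t, 0 ≤ F t := fun t => Real.rpow_nonneg (hI0 t) _
  have hFm : Measurable F := hIm.pow_const _
  set B : ℝ := (A ^ r * (spaceMeas n).real Set.univ) ^ (1 / r) with hB
  have hFB : ∀ t, F t ≤ B := fun t => Real.rpow_le_rpow (hI0 t) (hIB t) (by positivity)
  have hB0 : 0 ≤ B := (hF0 0).trans (hFB 0)
  have hFr : ∫ t, F t ^ r ∂timeMeas = ∫ q, ‖g q‖ ^ r ∂(stMeas n) := by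
    rw [stMeas, integral_prod _ hgri]
    congr 1; funext t
    change (I t ^ (1 / r)) ^ r = I t
    rw [← Real.rpow_mul (hI0 t), one_div, inv_mul_cancel₀ hr0.ne', Real.rpow_one]
  have hpair : ‖∫ q, g q * (starRingEnd ℂ) (wave S a q) ∂(stMeas n)‖ = ∫ q, ‖g q‖ ^ r ∂(stMeas n) := by
    simp_rw [hgdef, dualWave_mul_conj, ← norm_dualWave_rpow S a hr0 hpr]
    rw [integral_complex_ofReal, Complex.norm_real, Real.norm_of_nonneg (integral_nonneg hgr0)]
  have hW := measurable_weylMajorant M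
  have hκ0 : ∀ z : ℝ × ℝ, 0 ≤ weylMajorant M (z.1 - z.2) ^ γ := fun z =>
    Real.rpow_nonneg (weylMajorant_nonneg _ _) _
  have hκB : ∀ z : ℝ × ℝ, weylMajorant M (z.1 - z.2) ^ γ ≤ (12 * M * (4 * M + 1)) ^ γ := fun z =>
    Real.rpow_le_rpow (weylMajorant_nonneg _ _) (weylMajorant_le_sq _ _) hγ.le
  have hint : Integrable (fun z : ℝ × ℝ => F z.1 * F z.2 * weylMajorant M (z.1 - z.2) ^ γ)
      (timeMeas.prod timeMeas) := by
    refine Integrable.of_bound (((hFm.comp measurable_fst).mul (hFm.comp measurable_snd)).mul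
      ((hW.comp (measurable_fst.sub measurable_snd)).pow_const γ)).aestronglyMeasurable
      (B * B * (12 * M * (4 * M + 1)) ^ γ) (Filter.Eventually.of_forall fun z => ?_)
    have h1 := hF0 z.1
    have h2 := hF0 z.2
    rw [Real.norm_of_nonneg (mul_nonneg (mul_nonneg h1 h2) (hκ0 z))]
    exact mul_le_mul (mul_le_mul (hFB _) (hFB _) h2 hB0) (hκB z) (hκ0 z) (by positivity)
  have hprop : ∀ z : ℝ × ℝ, ‖propForm M (z.1 - z.2) (fun x => g (z.1, x)) (fun x => g (z.2, x))‖
      ≤ C₁ * (F z.1 * F z.2 * weylMajorant M (z.1 - z.2) ^ γ) := by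
    intro z
    have h := H₁ M (z.1 - z.2) 1 A (fun x => g (z.1, x)) (fun x => g (z.2, x)) hM one_pos
      (hg.comp measurable_prodMk_left) (hg.comp measurable_prodMk_left) (fun x => hgA _)
      (fun x => hgA _) (fun x => dualWave_eq_zero_or S a hp _) (fun x => dualWave_eq_zero_or S a hp _)
    rw [← Real.rpow_mul (weylMajorant_nonneg _ _)] at h
    have e : (I z.1 * I z.2) ^ (1 / r) = F z.1 * F z.2 := Real.mul_rpow (hI0 z.1) (hI0 z.2)
    refine h.trans_eq ?_
    rw [← e, mul_comm ((I z.1 * I z.2) ^ (1 / r))]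
  have hTT := norm_integral_wave_sq_le hM hg hgA S a hS
  rw [hpair] at hTT
  have hY := H₂ M F B hM hFm hF0 hFB η hη
  rw [hFr] at hY
  have hmono : ∫ z : ℝ × ℝ, ‖propForm M (z.1 - z.2) (fun x => g (z.1, x)) (fun x => g (z.2, x))‖
      ∂(timeMeas.prod timeMeas)
      ≤ C₁ * ∫ z : ℝ × ℝ, F z.1 * F z.2 * weylMajorant M (z.1 - z.2) ^ γ ∂(timeMeas.prod timeMeas) := by
    rw [← integral_const_mul]
    exact integral_mono_of_nonneg (Filter.Eventually.of_forall fun z => norm_nonneg _)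
      (hint.const_mul C₁) (Filter.Eventually.of_forall hprop)
  have hP0 : 0 ≤ ∫ z : ℝ × ℝ, ‖propForm M (z.1 - z.2) (fun x => g (z.1, x)) (fun x => g (z.2, x))‖
      ∂(timeMeas.prod timeMeas) := integral_nonneg fun _ => norm_nonneg _
  calc _ ≤ 2 ^ n * (∑ ξ ∈ S, ‖a ξ‖ ^ 2) * _ := hTT
    _ ≤ 2 ^ n * 1 * _ := by
        refine mul_le_mul_of_nonneg_right (mul_le_mul_of_nonneg_left ha (by positivity)) hP0
    _ ≤ 2 ^ n * 1 * (C₁ * (C₂ * (M : ℝ) ^ γ * (∫ q, ‖g q‖ ^ r ∂(stMeas n) + η) ^ (2 / r))) :=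
        mul_le_mul_of_nonneg_left (hmono.trans (mul_le_mul_of_nonneg_left hY hC₁.le)) (by positivity)
    _ = _ := by ring

lemma exists_integral_wave_rpow_endpoint {n : ℕ} (hn : 4 ≤ n) :
    ∃ C > 0, ∀ M : ℕ, 1 ≤ M → ∀ (S : Finset (Fin n → ℤ)) (a : (Fin n → ℤ) → ℂ),
      (∀ ξ ∈ S, ∀ i, 2 * |ξ i| ≤ M) → ∑ ξ ∈ S, ‖a ξ‖ ^ 2 ≤ 1 →
      ∫ q, ‖wave S a q‖ ^ (2 * ((n : ℝ) + 4) / n) ∂(stMeas n) ≤ C * (M : ℝ) ^ (2 : ℝ) := by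
  have hn4 : (4 : ℝ) ≤ n := by exact_mod_cast hn
  have hn0 : (0 : ℝ) < n := by linarith
  set p : ℝ := 2 * ((n : ℝ) + 4) / n with hp
  set r : ℝ := 2 * ((n : ℝ) + 4) / (n + 8) with hr
  have hp2 : 2 < p := by rw [hp, lt_div_iff₀ hn0]; linarith
  have hr1 : 1 < r := by rw [hr, lt_div_iff₀ (by linarith)]; linarith
  have hr2 : r < 2 := by rw [hr, div_lt_iff₀ (by linarith)]; linarith
  have hr0 : 0 < r := by linarith
  have hγe : (n : ℝ) / 2 * (2 / r - 1) = 2 * n / (n + 4) := by rw [hr]; field_simp; ring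
  have hγ2 : 2 * (n : ℝ) / (n + 4) < 2 := by rw [div_lt_iff₀ (by linarith)]; linarith
  have hpr : (p - 1) * r = p := by rw [hp, hr]; field_simp; ring
  obtain ⟨C, hC, H⟩ := exists_sq_integral_dualWave_le (n := n) (p := p) (r := r) (by linarith) hpr
    hr1 hr2 (by rw [hγe]; positivity) (by rw [hγe]; exact hγ2)
    (by rw [hγe, hr]; field_simp; ring)
  rw [hγe] at H
  refine ⟨(C * 2 ^ (2 / r)) ^ (p / 2) + (stMeas n).real Set.univ, by positivity, ?_⟩
  intro M hM S a hS ha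
  have hM1 : (1 : ℝ) ≤ M := by exact_mod_cast hM
  have hM0 : (0 : ℝ) < M := by linarith
  set Z : ℝ := ∫ q, ‖dualWave S a p q‖ ^ r ∂(stMeas n) with hZ
  have hZ0 : 0 ≤ Z := integral_nonneg fun q => by positivity
  have hZle : Z ≤ (C * 2 ^ (2 / r)) ^ (p / 2) * (M : ℝ) ^ (2 : ℝ) := by
    rcases hZ0.eq_or_lt with h | h
    · rw [← h]; positivity
    have key := H M hM S a hS ha Z h
    rw [← hZ, ← two_mul, Real.mul_rpow zero_le_two h.le] at key
    have e1 : Z ^ 2 = Z ^ (2 / p) * Z ^ (2 / r) := by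
      rw [← Real.rpow_add h, ← Real.rpow_natCast]
      congr 1; rw [hp, hr]; push_cast; field_simp; ring
    have e2 : Z ^ (2 / p) ≤ C * 2 ^ (2 / r) * (M : ℝ) ^ (2 * (n : ℝ) / (n + 4)) := by
      refine le_of_mul_le_mul_right ?_ (Real.rpow_pos_of_pos h (2 / r))
      rw [← e1]
      refine key.trans_eq ?_
      ring
    have e3 := Real.rpow_le_rpow (by positivity) e2 (show 0 ≤ p / 2 by positivity)
    rw [← Real.rpow_mul h.le, Real.mul_rpow (by positivity) (by positivity), ← Real.rpow_mul hM0.le] at e3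
    have e4 : 2 / p * (p / 2) = 1 := by field_simp
    have e5 : 2 * (n : ℝ) / (n + 4) * (p / 2) = 2 := by rw [hp]; field_simp
    rwa [e4, e5, Real.rpow_one] at e3
  have hZi : Integrable (fun q => ‖dualWave S a p q‖ ^ r) (stMeas n) :=
    Integrable.of_bound ((measurable_dualWave S a p).norm.pow_const r).aestronglyMeasurable
      (((∑ ξ ∈ S, ‖a ξ‖) ^ (p - 1)) ^ r) (Filter.Eventually.of_forall fun q => by
        rw [Real.norm_of_nonneg (by positivity)]
        exact Real.rpow_le_rpow (norm_nonneg _) (norm_dualWave_le S a (by linarith) q) hr0.le)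
  calc _ ≤ ∫ q, (‖dualWave S a p q‖ ^ r + 1) ∂(stMeas n) := by
        refine integral_mono_of_nonneg (Filter.Eventually.of_forall fun q => by positivity)
          (hZi.add (integrable_const _)) (Filter.Eventually.of_forall fun q => ?_)
        change ‖wave S a q‖ ^ p ≤ ‖dualWave S a p q‖ ^ r + 1
        rw [norm_dualWave_rpow S a hr0 hpr]
        by_cases h : q ∈ {q | 1 < ‖wave S a q‖}
        · rw [Set.indicator_of_mem h]; linarith
        · rw [Set.indicator_of_notMem h, zero_add]
          exact Real.rpow_le_one (norm_nonneg _) (not_lt.1 h) (by linarith)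
    _ = Z + (stMeas n).real Set.univ := by
        rw [integral_add hZi (integrable_const _), integral_const, smul_eq_mul, mul_one]
    _ ≤ _ := by
        rw [add_mul]
        refine add_le_add hZle (le_mul_of_one_le_right measureReal_nonneg ?_)
        exact Real.one_le_rpow hM1 zero_le_two

lemma exists_integral_wave_rpow_le_high {n : ℕ} (hn : 4 ≤ n) {p : ℝ} (hp : 2 * ((n : ℝ) + 4) / n ≤ p) :
    ∃ C > 0, ∀ M : ℕ, 1 ≤ M → ∀ (S : Finset (Fin n → ℤ)) (a : (Fin n → ℤ) → ℂ),
      (∀ ξ ∈ S, ∀ i, 2 * |ξ i| ≤ M) → ∑ ξ ∈ S, ‖a ξ‖ ^ 2 ≤ 1 →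
      ∫ q, ‖wave S a q‖ ^ p ∂(stMeas n) ≤ C * (M : ℝ) ^ ((n : ℝ) / 2 * p - (n + 2)) := by
  obtain ⟨C, hC, H⟩ := exists_integral_wave_rpow_endpoint hn
  have hn0 : (0 : ℝ) < n := by have : 0 < n := by omega
                               exact_mod_cast this
  set p₀ : ℝ := 2 * ((n : ℝ) + 4) / n with hp₀
  have hp₀0 : 0 < p₀ := by positivity
  refine ⟨(3 ^ n) ^ (p - p₀) * C, by positivity, ?_⟩
  intro M hM S a hS ha
  have hM0 : (0 : ℝ) < M := by exact_mod_cast hM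
  have hi : Integrable (fun q => ‖wave S a q‖ ^ p₀) (stMeas n) :=
    Integrable.of_bound ((wave_measurable S a).norm.pow_const p₀).aestronglyMeasurable
      ((∑ ξ ∈ S, ‖a ξ‖) ^ p₀) (Filter.Eventually.of_forall fun q => by
        rw [Real.norm_of_nonneg (by positivity)]
        exact Real.rpow_le_rpow (norm_nonneg _) (wave_norm_le S a q) hp₀0.le)
  calc _ ≤ ∫ q, (3 ^ n * (M : ℝ) ^ ((n : ℝ) / 2)) ^ (p - p₀) * ‖wave S a q‖ ^ p₀ ∂(stMeas n) := by
        refine integral_mono_of_nonneg (Filter.Eventually.of_forall fun q => by positivity)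
          (hi.const_mul _) (Filter.Eventually.of_forall fun q => ?_)
        change ‖wave S a q‖ ^ p ≤ _
        rw [show p = (p - p₀) + p₀ by ring, Real.rpow_add_of_nonneg (norm_nonneg _) (by linarith)
          hp₀0.le, sub_add_cancel]
        exact mul_le_mul_of_nonneg_right (Real.rpow_le_rpow (norm_nonneg _)
          (norm_wave_le hM S a hS ha q) (by linarith)) (by positivity)
    _ ≤ (3 ^ n * (M : ℝ) ^ ((n : ℝ) / 2)) ^ (p - p₀) * (C * (M : ℝ) ^ (2 : ℝ)) := by
        rw [integral_const_mul]
        exact mul_le_mul_of_nonneg_left (H M hM S a hS ha) (by positivity)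
    _ = (3 ^ n) ^ (p - p₀) * C * ((M : ℝ) ^ ((n : ℝ) / 2 * (p - p₀)) * (M : ℝ) ^ (2 : ℝ)) := by
        rw [Real.mul_rpow (by positivity) (by positivity), ← Real.rpow_mul hM0.le]; ring
    _ = _ := by
        rw [← Real.rpow_add hM0]
        congr 2
        rw [hp₀]; field_simp; ring

lemma abs_le_of_two_mul_abs_le {M : ℕ} {k : ℤ} (h : 2 * |k| ≤ M) : |k| ≤ M := by
  have := abs_nonneg k
  omega

lemma exists_integral_wave_rpow_le_one {p : ℝ} (hp : 6 < p) :
    ∃ C > 0, ∀ M : ℕ, 1 ≤ M → ∀ (S : Finset (Fin 1 → ℤ)) (a : (Fin 1 → ℤ) → ℂ),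
      (∀ ξ ∈ S, ∀ i, 2 * |ξ i| ≤ M) → ∑ ξ ∈ S, ‖a ξ‖ ^ 2 ≤ 1 →
      ∫ q, ‖wave S a q‖ ^ p ∂(stMeas 1) ≤ C * (M : ℝ) ^ (((1 : ℕ) : ℝ) / 2 * p - ((1 : ℕ) + 2)) := by
  refine exists_integral_wave_rpow_le (k := 6) (σ := 1 / 2) le_rfl (by norm_num) (by norm_num)
    (by norm_num) (by norm_num) (by exact_mod_cast hp) fun ε hε => ?_
  obtain ⟨C, hC, H⟩ := exists_integral_wave_pow_six_le hε
  refine ⟨C, hC, fun M hM S a hS ha => ?_⟩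
  refine (H M hM S a fun ξ hξ i => abs_le_of_two_mul_abs_le (hS ξ hξ i)).trans ?_
  rw [show ((1 : ℕ) : ℝ) / 2 * (6 : ℕ) - ((1 : ℕ) + 2) + ε = ε by push_cast; ring]
  exact mul_le_of_le_one_right (by positivity)
    (pow_le_one₀ (Finset.sum_nonneg fun _ _ => by positivity) ha)

lemma exists_integral_wave_rpow_le_two {p : ℝ} (hp : 4 < p) :
    ∃ C > 0, ∀ M : ℕ, 1 ≤ M → ∀ (S : Finset (Fin 2 → ℤ)) (a : (Fin 2 → ℤ) → ℂ),
      (∀ ξ ∈ S, ∀ i, 2 * |ξ i| ≤ M) → ∑ ξ ∈ S, ‖a ξ‖ ^ 2 ≤ 1 →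
      ∫ q, ‖wave S a q‖ ^ p ∂(stMeas 2) ≤ C * (M : ℝ) ^ (((2 : ℕ) : ℝ) / 2 * p - ((2 : ℕ) + 2)) := by
  refine exists_integral_wave_rpow_le (k := 4) (σ := 0) one_le_two le_rfl zero_le_one
    (by norm_num) (by norm_num) (by exact_mod_cast hp) fun ε hε => ?_
  obtain ⟨C, hC, H⟩ := exists_integral_wave_pow_four_le_two hε
  refine ⟨C, hC, fun M hM S a hS ha => ?_⟩
  refine (H M hM S a fun ξ hξ i => abs_le_of_two_mul_abs_le (hS ξ hξ i)).trans ?_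
  rw [show ((2 : ℕ) : ℝ) / 2 * (4 : ℕ) - ((2 : ℕ) + 2) + ε = ε by push_cast; ring]
  exact mul_le_of_le_one_right (by positivity)
    (pow_le_one₀ (Finset.sum_nonneg fun _ _ => by positivity) ha)

lemma exists_integral_wave_rpow_le_three {p : ℝ} (hp : 4 < p) :
    ∃ C > 0, ∀ M : ℕ, 1 ≤ M → ∀ (S : Finset (Fin 3 → ℤ)) (a : (Fin 3 → ℤ) → ℂ),
      (∀ ξ ∈ S, ∀ i, 2 * |ξ i| ≤ M) → ∑ ξ ∈ S, ‖a ξ‖ ^ 2 ≤ 1 →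
      ∫ q, ‖wave S a q‖ ^ p ∂(stMeas 3) ≤ C * (M : ℝ) ^ (((3 : ℕ) : ℝ) / 2 * p - ((3 : ℕ) + 2)) := by
  refine exists_integral_wave_rpow_le (k := 4) (σ := 0) (by norm_num) le_rfl zero_le_one
    (by norm_num) (by norm_num) (by exact_mod_cast hp) fun ε hε => ?_
  obtain ⟨C, hC, H⟩ := exists_integral_wave_pow_four_le_three hε
  refine ⟨C, hC, fun M hM S a hS ha => ?_⟩
  refine (H M hM S a fun ξ hξ i => abs_le_of_two_mul_abs_le (hS ξ hξ i)).trans ?_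
  rw [show ((3 : ℕ) : ℝ) / 2 * (4 : ℕ) - ((3 : ℕ) + 2) + ε = 1 + ε by push_cast; ring]
  exact mul_le_of_le_one_right (by positivity)
    (pow_le_one₀ (Finset.sum_nonneg fun _ _ => by positivity) ha)

/-- The `L^p` estimate for normalised waves with frequencies in a cube. -/
lemma AdmissibleStrichartz.exists_integral_wave_rpow_le {n : ℕ} {p : ℝ} (h : AdmissibleStrichartz n p) :
    ∃ C > 0, ∀ M : ℕ, 1 ≤ M → ∀ (S : Finset (Fin n → ℤ)) (a : (Fin n → ℤ) → ℂ),
      (∀ ξ ∈ S, ∀ i, 2 * |ξ i| ≤ M) → ∑ ξ ∈ S, ‖a ξ‖ ^ 2 ≤ 1 →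
      ∫ q, ‖wave S a q‖ ^ p ∂(stMeas n) ≤ C * (M : ℝ) ^ ((n : ℝ) / 2 * p - (n + 2)) := by
  rcases h with ⟨rfl, hp⟩ | ⟨rfl | rfl, hp⟩ | ⟨hn, hp⟩
  · exact exists_integral_wave_rpow_le_one hp
  · exact exists_integral_wave_rpow_le_two hp
  · exact exists_integral_wave_rpow_le_three hp
  · exact exists_integral_wave_rpow_le_high hn hp

lemma AdmissibleStrichartz.pos {n : ℕ} {p : ℝ} (h : AdmissibleStrichartz n p) : 0 < p := by
  rcases h with ⟨_, hp⟩ | ⟨_, hp⟩ | ⟨_, hp⟩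
  · linarith
  · linarith
  · exact lt_of_lt_of_le (by positivity) hp

lemma AdmissibleStrichartz.exponent_nonneg {n : ℕ} {p : ℝ} (h : AdmissibleStrichartz n p) :
    0 ≤ (n : ℝ) / 2 * p - (n + 2) := by
  rcases h with ⟨rfl, hp⟩ | ⟨rfl | rfl, hp⟩ | ⟨hn, hp⟩
  · push_cast; linarith
  · push_cast; linarith
  · push_cast; linarith
  · have hn4 : (4 : ℝ) ≤ n := by exact_mod_cast hn
    rw [div_le_iff₀ (by linarith)] at hp
    linarith

lemma abs_le_znorm {n : ℕ} (ξ : Fin n → ℤ) (i : Fin n) : |(ξ i : ℝ)| ≤ znorm n ξ :=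
  Real.abs_le_sqrt (Finset.single_le_sum (f := fun i => (ξ i : ℝ) ^ 2) (fun _ _ => sq_nonneg _)
    (Finset.mem_univ i))

lemma l2Norm_eq_zero {n : ℕ} {a : (Fin n → ℤ) →₀ ℂ} (h : l2Norm n a = 0) : a.support = ∅ := by
  rw [l2Norm, Real.sqrt_eq_zero (Finset.sum_nonneg fun _ _ => by positivity),
    Finset.sum_eq_zero_iff_of_nonneg fun _ _ => by positivity] at h
  refine Finset.eq_empty_of_forall_notMem fun ξ hξ => Finsupp.mem_support_iff.1 hξ ?_
  simpa using h ξ hξ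

/-- Bourgain's Strichartz estimate for frequencies in a ball of radius `N`. -/
theorem strichartz_frequency_localized (n : ℕ) (p : ℝ) (h : AdmissibleStrichartz n p) :
    ∃ C > 0, ∀ N : ℝ, 1 ≤ N → ∀ a : (Fin n → ℤ) →₀ ℂ,
      (∀ ξ ∈ a.support, znorm n ξ ≤ N) →
      boxLpNorm n p (tWave n a) ≤ C * N ^ ((n : ℝ) / 2 - ((n : ℝ) + 2) / p) * l2Norm n a := by
  obtain ⟨C, hC, H⟩ := h.exists_integral_wave_rpow_le
  have hp := h.pos
  have he := h.exponent_nonneg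
  set e : ℝ := (n : ℝ) / 2 * p - (n + 2) with hedef
  refine ⟨(C * 4 ^ e) ^ (1 / p), by positivity, ?_⟩
  intro N hN a ha
  have hN0 : 0 < N := by linarith
  set M : ℕ := 2 * ⌈N⌉₊ with hM
  have hM2 : 2 * N ≤ M := by rw [hM]; push_cast; linarith [Nat.le_ceil N]
  have hM4 : (M : ℝ) ≤ 4 * N := by
    rw [hM]; push_cast; linarith [Nat.ceil_lt_add_one hN0.le]
  have hM1 : 1 ≤ M := by
    have : (1 : ℝ) ≤ M := by linarith
    exact_mod_cast this
  set ℓ := l2Norm n a with hℓ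
  have hℓ0 : 0 ≤ ℓ := Real.sqrt_nonneg _
  have hwave : ∀ q : ℝ × (Fin n → ℝ), tWave n a q.1 q.2 = wave a.support a q :=
    fun q => tWave_eq n a q.1 q.2
  have hbox : boxLpNorm n p (tWave n a) = (∫ q, ‖wave a.support a q‖ ^ p ∂(stMeas n)) ^ (1 / p) := by
    rw [boxLpNorm, restrict_stBox]
    simp_rw [hwave]
  rw [hbox]
  rcases hℓ0.eq_or_lt with hz | hpos
  · rw [← hz, mul_zero]
    simp [wave, l2Norm_eq_zero (hℓ.symm.trans hz.symm), Real.zero_rpow hp.ne', hp.ne']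
  set b : (Fin n → ℤ) → ℂ := fun ξ => a ξ / ℓ with hb
  have hab : ∀ q, wave a.support a q = ℓ * wave a.support b q := by
    intro q
    have : (ℓ : ℂ) ≠ 0 := by exact_mod_cast hpos.ne'
    simp only [wave, hb, Finset.mul_sum]
    exact Finset.sum_congr rfl fun ξ _ => by field_simp
  have hbs : ∑ ξ ∈ a.support, ‖b ξ‖ ^ 2 ≤ 1 := by
    have h2 : ℓ ^ 2 = ∑ ξ ∈ a.support, ‖a ξ‖ ^ 2 :=
      Real.sq_sqrt (Finset.sum_nonneg fun _ _ => by positivity)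
    simp only [hb, norm_div, Complex.norm_real, Real.norm_of_nonneg hℓ0, div_pow]
    rw [← Finset.sum_div, ← h2, div_self (by positivity)]
  have hS : ∀ ξ ∈ a.support, ∀ i, 2 * |ξ i| ≤ M := by
    intro ξ hξ i
    have h1 := (abs_le_znorm ξ i).trans (ha ξ hξ)
    have : (2 : ℝ) * |(ξ i : ℝ)| ≤ M := by linarith
    exact_mod_cast this
  have key := H M hM1 a.support b hS hbs
  have hMe : (M : ℝ) ^ e ≤ 4 ^ e * N ^ e := by
    rw [← Real.mul_rpow (by norm_num) hN0.le]
    exact Real.rpow_le_rpow (by positivity) hM4 he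
  have hint : ∫ q, ‖wave a.support a q‖ ^ p ∂(stMeas n) ≤ C * 4 ^ e * N ^ e * ℓ ^ p := by
    simp_rw [hab, norm_mul, Complex.norm_real, Real.norm_of_nonneg hℓ0,
      Real.mul_rpow hℓ0 (norm_nonneg _)]
    rw [integral_const_mul, mul_comm]
    refine mul_le_mul_of_nonneg_right (key.trans ?_) (by positivity)
    rw [mul_assoc]
    exact mul_le_mul_of_nonneg_left hMe hC.le
  refine (Real.rpow_le_rpow (integral_nonneg fun q => by positivity) hint (by positivity)).trans_eq ?_
  rw [Real.mul_rpow (by positivity) (by positivity), Real.mul_rpow (by positivity) (by positivity),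
    ← Real.rpow_mul hN0.le, ← Real.rpow_mul hℓ0, mul_one_div_cancel hp.ne', Real.rpow_one]
  congr 3
  rw [hedef]; field_simp
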